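/- Let d = 2^r · 5^s · 7^t with integers r ≥ 1, s ≥ 0, t ≥ 0, and assume d ≡ 1 (mod 3). Let c be a nonzero integer and f(z) = z^d + 1/c ∈ ℚ[z]. If f is irreducible over ℚ, then f is stable over ℚ, i.e., every iterate fⁿ (n ≥ 1) is irreducible over ℚ. -/

import Mathlib

open Polynomial


section Capelli
open IntermediateField

theorem cap_norm {K : Type*} [Field K] {E : Type*} [Field E] [Algebra K E] {m : ℕ} (hm : m ≠ 0) {a : K} (x : E)
    (hx : minpoly K x = X ^ m - C a) :
    Algebra.norm K (AdjoinSimple.gen K x) = (-1) ^ m * (-a) ∧ Module.finrank K K⟮x⟯ = m := by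
  have : IsIntegral K x := not_not.mp fun h ↦ by
    have := hx.symm.trans (dif_neg h)
    exact (monic_X_pow_sub_C a hm).ne_zero this
  constructor
  · rw [← adjoin.powerBasis_gen this, Algebra.PowerBasis.norm_gen_eq_coeff_zero_minpoly]
    simp [minpoly_gen, hx, hm.symm]
  · rw [adjoin.finrank this, hx, natDegree_X_pow_sub_C]

theorem cap_two {K : Type*} [Field K] (r : ℕ) {a : K} (h1 : ∀ b : K, b ^ 2 ≠ a)
    (h2 : 2 ≤ r → ∀ b : K, b ^ 2 ≠ -a) : Irreducible (X ^ (2 ^ r) - C a : K[X]) := by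
  induction r generalizing K a with
  | zero => simpa using irreducible_X_sub_C a
  | succ r IH =>
    have hs := X_pow_sub_C_irreducible_of_prime Nat.prime_two h1
    rcases Nat.eq_zero_or_pos r with rfl | hr
    · simpa using hs
    rw [pow_succ]
    apply X_pow_mul_sub_C_irreducible hs
    intro E _ _ x hx
    obtain ⟨hn, hfr⟩ := cap_norm two_ne_zero x hx
    refine IH ?_ ?_
    · intro b hb
      apply h2 (by omega) (Algebra.norm K b)
      rw [← map_pow, hb, hn]; ring
    · intro _ b hb
      apply h2 (by omega) (Algebra.norm K b)
      rw [← map_pow, hb, neg_eq_neg_one_mul, map_mul, hn]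
      have : (-1 : K⟮x⟯) = algebraMap K _ (-1) := by simp
      rw [this, Algebra.norm_algebraMap, hfr]; ring

/-- Capelli type criterion. -/
theorem cap_main {K : Type*} [Field K] (r e : ℕ) (he : Odd e) {a : K}
    (h0 : ∀ p : ℕ, p.Prime → p ∣ e → ∀ b : K, b ^ p ≠ a)
    (h1 : 1 ≤ r → ∀ b : K, b ^ 2 ≠ a)
    (h2 : 2 ≤ r → ∀ b : K, b ^ 2 ≠ -a) : Irreducible (X ^ (2 ^ r * e) - C a : K[X]) := by
  have hs := X_pow_sub_C_irreducible_of_odd he h0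
  rcases Nat.eq_zero_or_pos r with rfl | hr
  · simpa using hs
  apply X_pow_mul_sub_C_irreducible hs
  intro E _ _ x hx
  have he0 : e ≠ 0 := by rintro rfl; simp at he
  obtain ⟨hn, hfr⟩ := cap_norm he0 x hx
  rw [he.neg_one_pow] at hn
  apply cap_two
  · intro b hb
    apply h1 (by omega) (Algebra.norm K b)
    rw [← map_pow, hb, hn]; ring
  · intro h b hb
    apply h2 h (Algebra.norm K b)
    rw [← map_pow, hb, neg_eq_neg_one_mul, map_mul, hn]
    have : (-1 : K⟮x⟯) = algebraMap K _ (-1) := by simp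
    rw [this, Algebra.norm_algebraMap, hfr, he.neg_one_pow]; ring
end Capelli


section Key
open IntermediateField

theorem key_norm {F K : Type*} [Field F] [Field K] [Algebra F K] [FiniteDimensional F K] [CharZero F]
    (α : K) (P : F[X]) (hP : P.Monic) (h0 : aeval α P = 0) (hdeg : P.natDegree = Module.finrank F K)
    (hα : (minpoly F α).natDegree = Module.finrank F K) (t : F) :
    Algebra.norm F (α - algebraMap F K t) = (-1) ^ (Module.finrank F K) * P.eval t := by
  have hint : IsIntegral F α := IsIntegral.of_finite F α
  have hmin : minpoly F α = P := by
    symm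
    refine eq_of_monic_of_dvd_of_natDegree_le (minpoly.monic hint) hP (minpoly.dvd _ _ h0) ?_
    rw [hdeg, hα]
  have hy := minpoly.sub_algebraMap α t
  set y := α - algebraMap F K t with hyd
  have hinty : IsIntegral F y := IsIntegral.of_finite F y
  have hdy : (minpoly F y).natDegree = Module.finrank F K := by
    rw [hy, natDegree_comp, natDegree_X_add_C, mul_one, hα]
  have htow := Module.finrank_mul_finrank F F⟮y⟯ K
  rw [adjoin.finrank hinty, hdy] at htow
  have h1 : Module.finrank F⟮y⟯ K = 1 := by
    have : 0 < Module.finrank F K := Module.finrank_pos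
    nlinarith
  rw [Algebra.norm_eq_norm_adjoin, h1, pow_one, ← adjoin.powerBasis_gen hinty,
    Algebra.PowerBasis.norm_gen_eq_coeff_zero_minpoly]
  simp only [adjoin.powerBasis_dim, adjoin.powerBasis_gen, minpoly_gen]
  rw [hdy, hy, hmin, coeff_zero_eq_eval_zero]
  simp

/-- iterates -/
noncomputable def itP (f : ℚ[X]) (n : ℕ) : ℚ[X] := (f.comp ·)^[n] X

theorem itP_zero (f : ℚ[X]) : itP f 0 = X := rfl
theorem itP_succ (f : ℚ[X]) (n : ℕ) : itP f (n + 1) = f.comp (itP f n) := by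
  unfold itP; rw [Function.iterate_succ_apply']
theorem itP_succ' (f : ℚ[X]) (n : ℕ) : itP f (n + 1) = (itP f n).comp f := by
  induction n with
  | zero => simp [itP]
  | succ n ih => rw [itP_succ, ih, ← comp_assoc, ← itP_succ, ih]

/-- numerators of the orbit of zero -/
def aS (d : ℕ) (c : ℤ) : ℕ → ℤ
  | 0 => 1
  | k + 1 => (aS d c k) ^ d + c ^ (d ^ (k + 1) - 1)

noncomputable def fP (d : ℕ) (c : ℤ) : ℚ[X] := X ^ d + C (1 / (c : ℚ))

theorem fP_monic {d : ℕ} (hd : d ≠ 0) (c : ℤ) : (fP d c).Monic := monic_X_pow_add_C _ hd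
theorem fP_natDegree (d : ℕ) (c : ℤ) : (fP d c).natDegree = d := natDegree_X_pow_add_C

theorem itP_natDegree (d : ℕ) (c : ℤ) (n : ℕ) : (itP (fP d c) n).natDegree = d ^ n := by
  induction n with
  | zero => simp [itP]
  | succ n ih => rw [itP_succ, natDegree_comp, ih, fP_natDegree, pow_succ']

theorem itP_monic {d : ℕ} (hd : d ≠ 0) (c : ℤ) (n : ℕ) : (itP (fP d c) n).Monic := by
  induction n with
  | zero => simp [itP, monic_X]
  | succ n ih =>
    rw [itP_succ]
    apply (fP_monic hd c).comp ih
    rw [itP_natDegree]; positivity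

theorem itP_eval {d : ℕ} (hd : d ≠ 0) {c : ℤ} (hc : c ≠ 0) (k : ℕ) :
    (itP (fP d c) k).eval (1 / (c : ℚ)) = (aS d c k : ℚ) / (c : ℚ) ^ (d ^ k) := by
  have hc' : (c : ℚ) ≠ 0 := by exact_mod_cast hc
  induction k with
  | zero => simp [itP, aS]
  | succ k ih =>
    rw [itP_succ, eval_comp, ih, aS]
    have h1 : 1 ≤ d ^ (k + 1) := Nat.one_le_pow _ _ (by omega)
    obtain ⟨e, he⟩ := Nat.exists_eq_add_of_le' h1
    simp only [fP, eval_add, eval_pow, eval_X, eval_C, div_pow, ← pow_mul]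
    rw [← pow_succ, he, Nat.add_sub_cancel]
    push_cast
    field_simp
    ring

theorem key_lemma {d : ℕ} (hd : d ≠ 0) {c : ℤ} (hc : c ≠ 0) (hirr : Irreducible (fP d c)) (k : ℕ)
    {K : Type*} [Field K] [Algebra ℚ K] [FiniteDimensional ℚ K] (α : K)
    (hα : minpoly ℚ α = itP (fP d c) (k + 1)) (hK : Module.finrank ℚ K = d ^ (k + 1))
    (p : ℕ) (s : ℚ) (w : K) (hw : w ^ p = algebraMap ℚ K s * (1 - (c : K) * α))
    (j : ℕ) (hj : j ∣ d) (hs : s ^ (d ^ k * (d / j)) = 1) :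
    ∃ q : ℚ[X], X ^ j + C ((c : ℚ) ^ (d ^ (k + 1) - 1)) ∣ q ^ p - C ((aS d c k : ℚ) ^ (d / j)) + X := by
  have hc' : (c : ℚ) ≠ 0 := by exact_mod_cast hc
  have : CharZero K := algebraRat.charZero K
  have hcK : (c : K) ≠ 0 := by exact_mod_cast hc
  obtain ⟨e, rfl⟩ := hj
  have hj0 : j ≠ 0 := by rintro rfl; simp at hd
  have he0 : e ≠ 0 := by rintro rfl; simp at hd
  rw [Nat.mul_div_cancel_left e (Nat.pos_of_ne_zero hj0)] at *
  set δ : K := (aeval α (itP (fP (j * e) c) k)) ^ e with hδ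
  have hδj : δ ^ j = - (algebraMap ℚ K (1 / c)) := by
    have h0 : aeval α (itP (fP (j * e) c) (k + 1)) = 0 := by rw [← hα]; exact minpoly.aeval _ _
    rw [itP_succ, aeval_comp] at h0
    simp only [fP, map_add, map_pow, aeval_X, aeval_C] at h0
    rw [hδ, ← pow_mul, mul_comm e j]
    exact eq_neg_of_add_eq_zero_left h0
  have hirrj : Irreducible (X ^ j + C (1 / (c : ℚ))) := by
    apply of_irreducible_expand he0
    simpa [fP, expand_C, ← pow_mul, mul_comm] using hirr
  have hmonj : (X ^ j + C (1 / (c : ℚ))).Monic := monic_X_pow_add_C _ hj0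
  have hminδ : minpoly ℚ δ = X ^ j + C (1 / (c : ℚ)) := by
    symm
    apply minpoly.eq_of_irreducible_of_monic hirrj _ hmonj
    simp [hδj]
  set F := ℚ⟮δ⟯ with hF
  have hintδ : IsIntegral ℚ δ := IsIntegral.of_finite _ _
  have hfF : Module.finrank ℚ F = j := by
    rw [hF, adjoin.finrank hintδ, hminδ, natDegree_X_pow_add_C]
  have hFK : Module.finrank F K = (j * e) ^ k * e := by
    have := Module.finrank_mul_finrank ℚ F K
    rw [hfF, hK] at this
    have : j * Module.finrank F K = j * ((j * e) ^ k * e) := by rw [this]; ring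
    exact Nat.eq_of_mul_eq_mul_left (Nat.pos_of_ne_zero hj0) this
  set δ' : F := AdjoinSimple.gen ℚ δ with hδ'
  have hδ'm : algebraMap F K δ' = δ := AdjoinSimple.algebraMap_gen ℚ δ
  set P0 : F[X] := (itP (fP (j * e) c) k).map (algebraMap ℚ F) with hP0
  have hP0m : P0.Monic := (itP_monic hd c k).map _
  have hP0d : P0.natDegree = (j * e) ^ k := by
    rw [hP0, natDegree_map, itP_natDegree]
  set P : F[X] := P0 ^ e - C δ' with hP
  have hpm : (P0 ^ e).Monic := hP0m.pow e
  have hpd : (P0 ^ e).natDegree = (j * e) ^ k * e := by rw [hP0m.natDegree_pow, hP0d, mul_comm]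
  have hpos : 0 < (j * e) ^ k * e := by positivity
  have hPm : P.Monic := by
    apply hpm.sub_of_left
    rw [degree_eq_natDegree hpm.ne_zero, hpd]
    exact lt_of_le_of_lt degree_C_le (by exact_mod_cast hpos)
  have hPd : P.natDegree = (j * e) ^ k * e := by rw [hP, natDegree_sub_C, hpd]
  have hPα : aeval α P = 0 := by
    simp only [hP, hP0, map_sub, map_pow, aeval_map_algebraMap, aeval_C, hδ'm, hδ, sub_self]
  have hfd : FiniteDimensional F K := inferInstance
  -- degree of minpoly over F
  have hmF : (minpoly F α).natDegree = Module.finrank F K := by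
    rw [← Field.primitive_element_iff_minpoly_natDegree_eq]
    have htop : ℚ⟮α⟯ = ⊤ := by
      rw [Field.primitive_element_iff_minpoly_natDegree_eq, hα, itP_natDegree, hK]
    rw [eq_top_iff]
    intro z _
    have hz : z ∈ ℚ⟮α⟯ := by rw [htop]; trivial
    have hle : ℚ⟮α⟯ ≤ (F⟮α⟯).restrictScalars ℚ := by
      rw [adjoin_simple_le_iff]
      exact mem_adjoin_simple_self F α
    exact hle hz
  have hnorm := key_norm α P hPm hPα (hPd.trans hFK.symm) hmF (algebraMap ℚ F (1 / c))
  have hN : Algebra.norm F (1 - (c : K) * α) =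
      algebraMap ℚ F ((aS (j * e) c k : ℚ) ^ e) - algebraMap ℚ F ((c : ℚ) ^ ((j * e) ^ k * e)) * δ' := by
    have e1 : (1 - (c : K) * α) = algebraMap F K (- (c : F)) * (α - algebraMap F K (algebraMap ℚ F (1 / c))) := by
      rw [← IsScalarTower.algebraMap_apply]
      simp only [map_neg, map_intCast, map_div₀, map_one]
      field_simp
      ring
    rw [e1, map_mul, Algebra.norm_algebraMap, hnorm, hFK]
    have e2 : eval (algebraMap ℚ F (1 / c)) P =
        algebraMap ℚ F (((aS (j * e) c k : ℚ) / (c : ℚ) ^ ((j * e) ^ k)) ^ e) - δ' := by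
      rw [hP, hP0, eval_sub, eval_pow, eval_map_algebraMap, eval_C, aeval_algebraMap_apply, map_pow]
      rw [coe_aeval_eq_eval, itP_eval hd hc]
    rw [e2, neg_pow, mul_assoc, mul_comm, mul_assoc, mul_sub]
    have hcF : (algebraMap ℚ F (c : ℚ)) ≠ 0 := by simpa using hc
    have e3 : ((-1 : F)) ^ ((j * e) ^ k * e) * (-1) ^ ((j * e) ^ k * e) = 1 := by
      rw [← mul_pow]; simp
    have e4 : (c : F) = algebraMap ℚ F (c : ℚ) := by simp
    rw [e4, div_pow, ← pow_mul, map_div₀, map_pow (algebraMap ℚ F) (c : ℚ)]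
    field_simp
    linear_combination (algebraMap ℚ F (aS (j * e) c k ^ e) -
      δ' * (algebraMap ℚ F (c : ℚ)) ^ ((j * e) ^ k * e)) * e3
  set κ := Algebra.norm F w with hκ
  have hκp : κ ^ p = algebraMap ℚ F ((aS (j * e) c k : ℚ) ^ e) - algebraMap ℚ F ((c : ℚ) ^ ((j * e) ^ k * e)) * δ' := by
    rw [hκ, ← map_pow, hw, map_mul, hN, IsScalarTower.algebraMap_apply ℚ F K, Algebra.norm_algebraMap, hFK,
      ← map_pow, hs, map_one, one_mul]
  -- κ is a polynomial in δ'
  obtain ⟨q, hq⟩ : ∃ q : ℚ[X], (κ : K) = aeval δ q := by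
    have hmem : (κ : K) ∈ (ℚ⟮δ⟯).toSubalgebra := κ.2
    rw [adjoin_simple_toSubalgebra_of_isAlgebraic hintδ.isAlgebraic,
      Algebra.adjoin_singleton_eq_range_aeval] at hmem
    obtain ⟨q, hq⟩ := hmem
    exact ⟨q, hq.symm⟩
  have hκK : (κ : K) ^ p = algebraMap ℚ K ((aS (j * e) c k : ℚ) ^ e) -
      algebraMap ℚ K ((c : ℚ) ^ ((j * e) ^ k * e)) * δ := by
    have := congrArg (algebraMap F K) hκp
    rw [map_pow, map_sub, map_mul, hδ'm] at this
    have e9 : ∀ u : ℚ, algebraMap F K (algebraMap ℚ F u) = algebraMap ℚ K u := fun u => by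
      simp only [eq_ratCast, map_ratCast]
    rw [e9, e9] at this
    exact this
  have hdvd : X ^ j + C (1 / (c : ℚ)) ∣ q ^ p - C ((aS (j * e) c k : ℚ) ^ e) + C ((c : ℚ) ^ ((j * e) ^ k * e)) * X := by
    rw [← hminδ]
    apply minpoly.dvd
    simp only [map_add, map_sub, map_mul, aeval_C, aeval_X]
    rw [map_pow (aeval δ), ← hq, hκK]; ring
  set N := (j * e) ^ k * e with hNdef
  set cn : ℚ := (c : ℚ) ^ N with hcn
  have hcn0 : cn ≠ 0 := pow_ne_zero _ hc'
  refine ⟨q.comp (C cn⁻¹ * X), ?_⟩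
  obtain ⟨g, hg⟩ := hdvd
  have hg2 := congrArg (fun u => u.comp (C cn⁻¹ * X)) hg
  simp only [mul_comp, add_comp, sub_comp, pow_comp, X_comp, C_comp] at hg2
  refine ⟨C (cn⁻¹ ^ j) * g.comp (C cn⁻¹ * X), ?_⟩
  have e5 : (q.comp (C cn⁻¹ * X)) ^ p - C ((aS (j * e) c k : ℚ) ^ e) + X =
     (q.comp (C cn⁻¹ * X)) ^ p - C ((aS (j * e) c k : ℚ)) ^ e + C cn * (C cn⁻¹ * X) := by
    rw [← mul_assoc, ← C_mul, mul_inv_cancel₀ hcn0, C_1, one_mul, C_pow]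
  have e7 : (c : ℚ) ^ ((j * e) ^ (k + 1) - 1) * cn⁻¹ ^ j = 1 / c := by
    have h1 : 1 ≤ (j * e) ^ (k + 1) := Nat.one_le_pow _ _ (by positivity)
    have h2 : N * j = (j * e) ^ (k + 1) - 1 + 1 := by rw [Nat.sub_add_cancel h1, hNdef]; ring
    rw [hcn, inv_pow, ← pow_mul, h2]
    generalize (j * e) ^ (k + 1) - 1 = m
    rw [pow_succ]
    field_simp
  rw [e5, ← C_pow] 
  rw [hg2]
  rw [mul_pow, ← C_pow]
  rw [← e7, C_mul]
  ring
end Key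


section Red
open IntermediateField

/-- the divisibility produced by the key lemma -/
def KeyP (d : ℕ) (c : ℤ) (k p j : ℕ) : Prop :=
  ∃ q : ℚ[X], X ^ j + C ((c : ℚ) ^ (d ^ (k + 1) - 1)) ∣ q ^ p - C ((aS d c k : ℚ) ^ (d / j)) + X

theorem red_step (r e : ℕ) (he : Odd e) (hr : 1 ≤ r) (d : ℕ) (hd : d = 2 ^ r * e) (hd0 : d ≠ 0)
    {c : ℤ} (hc : c ≠ 0) (hirr : Irreducible (fP d c))
    (h2 : ∀ k, KeyP d c k 2 2 → (4 ∣ d → 1 ≤ k → KeyP d c k 2 4) →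
      (¬ 4 ∣ d → 10 ∣ d → KeyP d c k 2 10) → False)
    (hp : ∀ k p, p.Prime → p ∣ e → (∀ j, j ∣ d → KeyP d c k p j) → False) (k : ℕ)
    {K : Type*} [Field K] [Algebra ℚ K] [FiniteDimensional ℚ K] (α : K)
    (hαm : minpoly ℚ α = itP (fP d c) (k + 1)) (hfr : Module.finrank ℚ K = d ^ (k + 1)) :
    Irreducible ((fP d c).map (algebraMap ℚ K) - C α) := by
  have hchar : CharZero K := algebraRat.charZero K
  have hcK : (c : K) ≠ 0 := by exact_mod_cast hc
  set α1 : K := aeval α (itP (fP d c) k) with hα1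
  have hα1d : α1 ^ d = - (c : K)⁻¹ := by
    have h0 : aeval α (itP (fP d c) (k + 1)) = 0 := by rw [← hαm]; exact minpoly.aeval _ _
    rw [itP_succ, aeval_comp] at h0
    rw [← hα1] at h0
    simp only [fP, map_add, map_pow, aeval_X, aeval_C] at h0
    have := eq_neg_of_add_eq_zero_left h0
    rw [this]; simp
  have hmap : (fP d c).map (algebraMap ℚ K) - C α = X ^ (2 ^ r * e) - C (α - (c : K)⁻¹) := by
    rw [← hd, fP]; simp only [Polynomial.map_add, Polynomial.map_pow, map_X, map_C, C_sub]
    simp only [one_div, map_inv₀, map_intCast]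
    ring
  rw [hmap]
  -- key application
  have happ : ∀ (p : ℕ) (s : ℚ) (z : K), p ∣ d → (z ^ p = algebraMap ℚ K s * (α - (c : K)⁻¹)) →
      ∀ j, j ∣ d → s ^ (d ^ k * (d / j)) = 1 → KeyP d c k p j := by
    intro p s z hpd hz j hj hs
    refine key_lemma hd0 hc hirr k α hαm hfr p s (z * (α1 ^ (d / p))⁻¹) ?_ j hj hs
    rw [mul_pow, hz, inv_pow, ← pow_mul, Nat.div_mul_cancel hpd, hα1d]
    field_simp
    ring
  apply cap_main r e he
  · intro p hpp hpe b hb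
    refine hp k p hpp hpe fun j hj => happ p 1 b (hd ▸ Dvd.dvd.mul_left hpe _) (by simpa using hb) j hj (one_pow _)
  · intro _ b hb
    have h2d : 2 ∣ d := by rw [hd]; exact Dvd.dvd.mul_right (dvd_pow_self 2 (by omega)) _
    have := happ 2 1 b h2d (by simpa using hb)
    exact h2 k (this 2 h2d (one_pow _)) (fun h _ => this 4 h (one_pow _)) (fun _ h => this 10 h (one_pow _))
  · intro hr2 b hb
    have h4d : 4 ∣ d := by
      rw [hd]; exact Dvd.dvd.mul_right (pow_dvd_pow 2 hr2) _
    have h2d : 2 ∣ d := dvd_trans (by norm_num) h4d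
    have := happ 2 (-1) b h2d (by simpa using hb)
    refine h2 k (this 2 h2d ?_) (fun h hk => this 4 h ?_) (fun h => absurd h4d h)
    · apply Even.neg_one_pow
      apply Even.mul_left
      obtain ⟨t, ht⟩ := h4d
      rw [ht]; exact ⟨t, by omega⟩
    · apply Even.neg_one_pow
      apply Even.mul_right
      apply Even.pow_of_ne_zero _ (by omega)
      exact even_iff_two_dvd.mpr h2d
theorem reduction (r e : ℕ) (he : Odd e) (hr : 1 ≤ r) (d : ℕ) (hd : d = 2 ^ r * e)
    {c : ℤ} (hc : c ≠ 0) (hirr : Irreducible (fP d c))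
    (h2 : ∀ k, KeyP d c k 2 2 → (4 ∣ d → 1 ≤ k → KeyP d c k 2 4) →
      (¬ 4 ∣ d → 10 ∣ d → KeyP d c k 2 10) → False)
    (hp : ∀ k p, p.Prime → p ∣ e → (∀ j, j ∣ d → KeyP d c k p j) → False) :
    ∀ n : ℕ, 1 ≤ n → Irreducible (itP (fP d c) n) := by
  have hd0 : d ≠ 0 := by
    rw [hd]; have : e ≠ 0 := by rintro rfl; simp at he
    positivity
  have hc' : (c : ℚ) ≠ 0 := by exact_mod_cast hc
  intro n hn
  induction n, hn using Nat.le_induction with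
  | base => simpa [itP] using hirr
  | succ n hn ih =>
    obtain ⟨k, rfl⟩ := Nat.exists_eq_add_of_le' hn
    rw [itP_succ']
    apply irreducible_comp (itP_monic hd0 c _) (fP_monic hd0 c) ih
    intro E _ _ x hx
    have hint : IsIntegral ℚ x := not_not.mp fun h ↦ by
      have := hx.symm.trans (dif_neg h)
      exact (itP_monic hd0 c _).ne_zero this
    have hfdim : FiniteDimensional ℚ ℚ⟮x⟯ := adjoin.finiteDimensional hint
    have hfr : Module.finrank ℚ ℚ⟮x⟯ = d ^ (k + 1) := by
      rw [adjoin.finrank hint, hx, itP_natDegree]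
    exact @red_step r e he hr d hd hd0 c hc hirr h2 hp k ℚ⟮x⟯ _ (ℚ⟮x⟯).algebra' hfdim _ ((minpoly_gen ℚ x).trans hx) hfr
end Red


section Conc

theorem conc_one {d : ℕ} {c : ℤ} {k p : ℕ} (h : KeyP d c k p 1) :
    ∃ y : ℚ, y ^ p = (aS d c k : ℚ) ^ d + (c : ℚ) ^ (d ^ (k + 1) - 1) := by
  obtain ⟨q, g, hg⟩ := h
  refine ⟨q.eval (-(c : ℚ) ^ (d ^ (k + 1) - 1)), ?_⟩
  have := congrArg (eval (-(c : ℚ) ^ (d ^ (k + 1) - 1))) hg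
  simp at this
  linarith

theorem lin_dvd {D a b : ℚ} (h : X ^ 2 + C D ∣ C a + C b * X) : a = 0 ∧ b = 0 := by
  have hz : C b * X + C a = 0 := by
    by_contra hne
    rw [add_comm (C a)] at h
    have h1 := natDegree_le_of_dvd h hne
    rw [natDegree_X_pow_add_C] at h1
    have := natDegree_linear_le (a := b) (b := a)
    omega
  constructor
  · simpa using congrArg (coeff · 0) hz
  · simpa using congrArg (coeff · 1) hz

theorem lin_mod (D : ℚ) (q : ℚ[X]) : ∃ u v : ℚ, X ^ 2 + C D ∣ q - (C u + C v * X) := by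
  have hm : (X ^ 2 + C D).Monic := monic_X_pow_add_C D two_ne_zero
  have hdeg : (q %ₘ (X ^ 2 + C D)).natDegree ≤ 1 := by
    have := natDegree_modByMonic_lt q hm (by
      intro h; have := congrArg natDegree h; rw [natDegree_X_pow_add_C] at this; simp at this)
    rw [natDegree_X_pow_add_C] at this; omega
  refine ⟨(q %ₘ (X ^ 2 + C D)).coeff 0, (q %ₘ (X ^ 2 + C D)).coeff 1, q /ₘ (X ^ 2 + C D), ?_⟩
  have h1 := exists_eq_X_add_C_of_natDegree_le_one hdeg
  obtain ⟨a, b, hab⟩ := h1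
  have h2 := modByMonic_add_div q (X ^ 2 + C D)
  rw [hab] at h2 ⊢
  simp
  linear_combination -h2

theorem conc_two {d : ℕ} {c : ℤ} {k p : ℕ} (h : KeyP d c k p 2) :
    ∃ u v : ℚ, X ^ 2 + C ((c : ℚ) ^ (d ^ (k + 1) - 1)) ∣
      (C u + C v * X) ^ p - C ((aS d c k : ℚ) ^ (d / 2)) + X := by
  obtain ⟨q, hq⟩ := h
  obtain ⟨u, v, huv⟩ := lin_mod ((c : ℚ) ^ (d ^ (k + 1) - 1)) q
  refine ⟨u, v, ?_⟩
  have h1 := dvd_sub hq (huv.trans (sub_dvd_pow_sub_pow _ _ p))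
  convert h1 using 1; ring

theorem conc_two_two {d : ℕ} {c : ℤ} {k : ℕ} (h : KeyP d c k 2 2) :
    ∃ u v : ℚ, u ^ 2 - (c : ℚ) ^ (d ^ (k + 1) - 1) * v ^ 2 = (aS d c k : ℚ) ^ (d / 2) ∧ 2 * u * v = -1 := by
  obtain ⟨u, v, huv⟩ := conc_two h
  set D := (c : ℚ) ^ (d ^ (k + 1) - 1)
  set A := (aS d c k : ℚ) ^ (d / 2)
  have : X ^ 2 + C D ∣ C (u ^ 2 - D * v ^ 2 - A) + C (2 * u * v + 1) * X := by
    have h2 := dvd_sub huv (Dvd.intro (C (v ^ 2)) rfl)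
    convert h2 using 1
    simp only [C_sub, C_add, C_mul, C_pow, C_1, C_ofNat]
    ring
  obtain ⟨h1, h2⟩ := lin_dvd this
  exact ⟨u, v, by linarith, by linarith⟩

theorem conc_two_five {d : ℕ} {c : ℤ} {k : ℕ} (h : KeyP d c k 5 2) :
    ∃ u v : ℚ, u * (u ^ 4 - 10 * u ^ 2 * ((c : ℚ) ^ (d ^ (k + 1) - 1) * v ^ 2)
      + 5 * ((c : ℚ) ^ (d ^ (k + 1) - 1) * v ^ 2) ^ 2) = (aS d c k : ℚ) ^ (d / 2) ∧
      v * (5 * u ^ 4 - 10 * u ^ 2 * ((c : ℚ) ^ (d ^ (k + 1) - 1) * v ^ 2)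
      + ((c : ℚ) ^ (d ^ (k + 1) - 1) * v ^ 2) ^ 2) = -1 := by
  obtain ⟨u, v, huv⟩ := conc_two h
  set D := (c : ℚ) ^ (d ^ (k + 1) - 1)
  set A := (aS d c k : ℚ) ^ (d / 2)
  have : X ^ 2 + C D ∣ C (u * (u ^ 4 - 10 * u ^ 2 * (D * v ^ 2) + 5 * (D * v ^ 2) ^ 2) - A) +
      C (v * (5 * u ^ 4 - 10 * u ^ 2 * (D * v ^ 2) + (D * v ^ 2) ^ 2) + 1) * X := by
    have h2 := dvd_sub huv (Dvd.intro (10 * C u ^ 3 * C v ^ 2 + 10 * C u ^ 2 * C v ^ 3 * X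
      + 5 * C u * C v ^ 4 * (X ^ 2 - C D) + C v ^ 5 * X * (X ^ 2 - C D)) rfl)
    convert h2 using 1
    simp only [C_sub, C_add, C_mul, C_pow, C_1, C_ofNat]
    ring
  obtain ⟨h1, h2⟩ := lin_dvd this
  exact ⟨u, v, by linarith, by linarith⟩

theorem even_odd (q : ℚ[X]) : ∃ x z : ℚ[X], q = expand ℚ 2 x + X * expand ℚ 2 z := by
  induction q using Polynomial.induction_on' with
  | add p q hp hq =>
    obtain ⟨x, z, h⟩ := hp
    obtain ⟨x', z', h'⟩ := hq
    exact ⟨x + x', z + z', by rw [h, h', map_add, map_add]; ring⟩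
  | monomial n a =>
    rcases Nat.even_or_odd' n with ⟨t, rfl | rfl⟩
    · exact ⟨monomial t a, 0, by simp [expand_monomial, mul_comm]⟩
    · refine ⟨0, monomial t a, ?_⟩
      simp [expand_monomial, mul_comm, X_mul_monomial]

theorem even_odd_zero {x z : ℚ[X]} (h : expand ℚ 2 x + X * expand ℚ 2 z = 0) : x = 0 ∧ z = 0 := by
  constructor
  · ext n
    have := congrArg (coeff · (n * 2)) h
    simp only [coeff_add, coeff_zero] at this
    rw [coeff_expand_mul two_pos] at this
    rcases n with _ | n
    · simpa using this
    · rw [show (n + 1) * 2 = (2 * n + 1) + 1 by ring, coeff_X_mul, coeff_expand two_pos, if_neg (by omega)] at this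
      simpa using this
  · ext n
    have := congrArg (coeff · (n * 2 + 1)) h
    simp only [coeff_add, coeff_zero] at this
    rw [coeff_X_mul, coeff_expand_mul two_pos, coeff_expand two_pos, if_neg (by omega)] at this
    simpa using this

theorem even_odd_dvd {P x z : ℚ[X]} (h : expand ℚ 2 P ∣ expand ℚ 2 x + X * expand ℚ 2 z) : P ∣ x ∧ P ∣ z := by
  obtain ⟨g, hg⟩ := h
  obtain ⟨a, b, rfl⟩ := even_odd g
  have : expand ℚ 2 (x - P * a) + X * expand ℚ 2 (z - P * b) = 0 := by
    simp only [map_sub, map_mul]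
    linear_combination hg
  obtain ⟨h1, h2⟩ := even_odd_zero this
  exact ⟨⟨a, by linear_combination h1⟩, ⟨b, by linear_combination h2⟩⟩

theorem conc_even {d : ℕ} {c : ℤ} {k j : ℕ} (h : KeyP d c k 2 (2 * j)) :
    ∃ x z : ℚ[X], X ^ j + C ((c : ℚ) ^ (d ^ (k + 1) - 1)) ∣
      x ^ 2 + X * z ^ 2 - C ((aS d c k : ℚ) ^ (d / (2 * j))) ∧
      X ^ j + C ((c : ℚ) ^ (d ^ (k + 1) - 1)) ∣ 2 * x * z + 1 := by
  obtain ⟨q, hq⟩ := h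
  obtain ⟨x, z, rfl⟩ := even_odd q
  refine ⟨x, z, even_odd_dvd (P := X ^ j + C ((c : ℚ) ^ (d ^ (k + 1) - 1))) ?_⟩
  have e1 : expand ℚ 2 (X ^ j + C ((c : ℚ) ^ (d ^ (k + 1) - 1))) =
      X ^ (2 * j) + C ((c : ℚ) ^ (d ^ (k + 1) - 1)) := by
    simp only [map_add, map_pow, expand_X, expand_C, ← pow_mul]
  rw [e1]
  convert hq using 1
  simp only [map_add, map_sub, map_mul, map_pow, expand_X, expand_C, map_one, map_ofNat]
  ring

theorem conc_even' {d : ℕ} {c : ℤ} {k j : ℕ} (h : KeyP d c k 2 (2 * j)) :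
    ∃ x : ℚ[X], X ^ j + C ((c : ℚ) ^ (d ^ (k + 1) - 1)) ∣
      (2 * x ^ 2 - C ((aS d c k : ℚ) ^ (d / (2 * j)))) ^ 2 - C ((aS d c k : ℚ) ^ (d / (2 * j))) ^ 2 + X := by
  obtain ⟨x, z, ⟨g, hg⟩, ⟨g', hg'⟩⟩ := conc_even h
  refine ⟨x, 4 * x ^ 2 * g - X * (2 * x * z - 1) * g', ?_⟩
  linear_combination 4 * x ^ 2 * hg - X * (2 * x * z - 1) * hg'

theorem conc_four {d : ℕ} {c : ℤ} {k : ℕ} (h : KeyP d c k 2 4) :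
    ∃ u v z : ℚ, u ^ 2 - (c : ℚ) ^ (d ^ (k + 1) - 1) * v ^ 2 = ((aS d c k : ℚ) ^ (d / 4)) ^ 2 ∧ 2 * u * v = -1 ∧
      u * (u + (aS d c k : ℚ) ^ (d / 4)) = 2 * z ^ 2 := by
  obtain ⟨x, hx⟩ := conc_even' (j := 2) h
  norm_num only at hx
  set D := (c : ℚ) ^ (d ^ (k + 1) - 1)
  set b := (aS d c k : ℚ) ^ (d / 4)
  obtain ⟨p0, p1, hp⟩ := lin_mod D x
  set u := 2 * p0 ^ 2 - 2 * D * p1 ^ 2 - b with hu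
  set v := 4 * p0 * p1 with hv
  have : X ^ 2 + C D ∣ C (u ^ 2 - D * v ^ 2 - b ^ 2) + C (2 * u * v + 1) * X := by
    have h1 : X ^ 2 + C D ∣ 2 * x ^ 2 - C b - (C u + C v * X) := by
      have h2 := dvd_add (Dvd.dvd.mul_left (hp.trans (sub_dvd_pow_sub_pow _ _ 2)) 2) (Dvd.intro (2 * C p1 ^ 2) rfl)
      convert h2 using 1
      simp only [hu, hv, C_sub, C_mul, C_pow, C_ofNat]
      ring
    have h3 := dvd_sub hx (h1.trans (sub_dvd_pow_sub_pow _ _ 2))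
    have h4 := dvd_sub h3 (Dvd.intro (C v ^ 2) rfl)
    convert h4 using 1
    simp only [C_sub, C_add, C_mul, C_pow, C_1, C_ofNat]
    ring
  obtain ⟨h1, h2⟩ := lin_dvd this
  refine ⟨u, v, p0 ^ 2 + D * p1 ^ 2, by linarith, by linarith, ?_⟩
  have : (u + b) ^ 2 + D * v ^ 2 = 4 * (p0 ^ 2 + D * p1 ^ 2) ^ 2 := by rw [hu, hv]; ring
  linarith
end Conc


section IntHelpers

theorem rat_int_of_pow {y : ℚ} {n : ℕ} (hn : 0 < n) {z : ℤ} (h : y ^ n = z) : ∃ Y : ℤ, y = Y := by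
  have : IsIntegral ℤ (y ^ n) := by rw [h]; exact isIntegral_algebraMap (x := z)
  have h2 : IsIntegral ℤ y := IsIntegral.of_pow hn this
  obtain ⟨Y, hY⟩ := IsIntegrallyClosed.isIntegral_iff.mp h2
  exact ⟨Y, hY.symm⟩

theorem int_pow_odd {a b c : ℤ} {k : ℕ} (hk : Odd k) (hab : IsCoprime a b) (h : a * b = c ^ k) :
    ∃ d : ℤ, a = d ^ k := by
  obtain ⟨d, hd⟩ := exists_associated_pow_of_mul_eq_pow' hab h
  rcases Int.associated_iff.mp hd with h1 | h1
  · exact ⟨d, h1.symm⟩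
  · exact ⟨-d, by rw [hk.neg_pow, h1, neg_neg]⟩

theorem int_pow_natAbs {a b c : ℤ} {k : ℕ} (hab : IsCoprime a b) (h : a * b = c ^ k) :
    ∃ d : ℕ, |a| = (d : ℤ) ^ k := by
  obtain ⟨d, hd⟩ := exists_associated_pow_of_mul_eq_pow' hab h
  refine ⟨d.natAbs, ?_⟩
  rw [Int.natCast_natAbs, ← abs_pow]
  rcases Int.associated_iff.mp hd with h1 | h1
  · rw [h1]
  · rw [h1, abs_neg]

theorem int_pow_nonneg {a b c : ℤ} {k : ℕ} (ha : 0 ≤ a) (hab : IsCoprime a b) (h : a * b = c ^ k) :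
    ∃ d : ℤ, 0 ≤ d ∧ a = d ^ k := by
  obtain ⟨d, hd⟩ := int_pow_natAbs hab h
  exact ⟨d, by positivity, by rw [← hd, abs_of_nonneg ha]⟩

theorem int_pow_cop {x y : ℤ} {m n : ℕ} (hm : 0 < m) (hn : 0 < n) (hmn : m.Coprime n) (h : x ^ m = y ^ n) :
    ∃ z : ℤ, x = z ^ n ∧ y = z ^ m := by
  have h' : (x : ℚ) ^ m = (y : ℚ) ^ n := by exact_mod_cast h
  obtain ⟨z, h1, h2⟩ := (pow_eq_pow_iff_of_coprime hmn).mp h'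
  obtain ⟨Z, hZ⟩ := rat_int_of_pow hn h1.symm
  rw [hZ] at h1 h2
  exact ⟨Z, by exact_mod_cast h1, by exact_mod_cast h2⟩

theorem int_split {q : ℕ} (hq : IsPrimePow q) {A B W : ℤ} (hab : IsCoprime A B) (h : A * B = q * W) :
    (∃ A', A = q * A' ∧ A' * B = W ∧ IsCoprime A' B) ∨ (∃ B', B = q * B' ∧ A * B' = W ∧ IsCoprime A B') := by
  have hq0 : (q : ℤ) ≠ 0 := by exact_mod_cast hq.ne_zero
  have hd : q ∣ A.natAbs * B.natAbs := by
    rw [← Int.natAbs_mul, h, Int.natAbs_mul]; simp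
  have hc : Nat.Coprime A.natAbs B.natAbs := Int.isCoprime_iff_gcd_eq_one.mp hab
  rcases (hc.isPrimePow_dvd_mul hq).mp hd with h1 | h1
  · left
    obtain ⟨A', rfl⟩ := Int.natCast_dvd.mpr h1
    refine ⟨A', rfl, ?_, hab.of_mul_left_right⟩
    apply mul_left_cancel₀ hq0; linarith
  · right
    obtain ⟨A', rfl⟩ := Int.natCast_dvd.mpr h1
    refine ⟨A', rfl, ?_, hab.of_mul_right_right⟩
    apply mul_left_cancel₀ hq0; linarith

theorem flt3 {a b c : ℤ} (ha : a ≠ 0) (hb : b ≠ 0) (hc : c ≠ 0) (h : a ^ 3 + b ^ 3 = c ^ 3) : False :=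
  fermatLastTheoremFor_iff_int.mp fermatLastTheoremThree a b c ha hb hc h

theorem cop_half {u B X Y : ℤ} (h : IsCoprime u B) (h1 : u = X + Y) (h2 : B = X - Y) : IsCoprime X Y := by
  obtain ⟨s, t, h⟩ := h
  exact ⟨s + t, s - t, by rw [← h, h1, h2]; ring⟩

theorem cop_odd {u B : ℤ} (h : IsCoprime u B) (h1 : Odd (u - B)) : IsCoprime (u - B) (u + B) := by
  obtain ⟨s, t, h⟩ := h
  obtain ⟨k, hk⟩ := h1
  exact ⟨1 - k * (s - t), - k * (s + t), by linear_combination (-2 * k) * h + hk⟩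
end IntHelpers

section PTwoA

theorem p2_four (u B C : ℤ) (hC : C ≠ 0) (huB : IsCoprime u B) (hB : Odd B)
    (h : 4 * u ^ 2 * (u ^ 2 - B ^ 2) = C ^ 3) :
    Odd u ∧ (∃ P, u = P ^ 3) ∧ ∃ C2, (u - B) * (u + B) = 4 * (4 * C2 ^ 3) ∧ C2 ≠ 0 := by
  have hu0 : u ≠ 0 := by rintro rfl; simp at h; exact hC (by simpa using h.symm)
  have hCe : 2 ∣ C := by
    apply Int.prime_two.dvd_of_dvd_pow (n := 3)
    rw [← h]; exact ⟨2 * u ^ 2 * (u ^ 2 - B ^ 2), by ring⟩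
  rcases Int.even_or_odd u with hu | hu
  · exfalso
    have hodd : Odd (u - B) := hu.sub_odd hB
    have hodd2 : Odd (u + B) := hu.add_odd hB
    have hcop : IsCoprime (u - B) (u + B) := cop_odd huB hodd
    have hc1 : IsCoprime (4 * u ^ 2) (u ^ 2 - B ^ 2) := by
      have e1 : IsCoprime u (u ^ 2 - B ^ 2) := by
        have := (huB.pow_right (n := 2)).neg_right
        have := this.add_mul_left_right u
        rw [show u ^ 2 - B ^ 2 = -B ^ 2 + u * u by ring]; exact this
      have e2 : IsCoprime 2 (u ^ 2 - B ^ 2) := by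
        have : Odd (u ^ 2 - B ^ 2) := by
          rw [show u ^ 2 - B ^ 2 = (u - B) * (u + B) by ring]; exact hodd.mul hodd2
        obtain ⟨k, hk⟩ := this
        exact ⟨-k, 1, by linear_combination hk⟩
      have := (IsCoprime.mul_left (e2.pow_left (m := 2)) (e1.pow_left (m := 2)))
      norm_num at this
      exact this
    obtain ⟨e, he⟩ := int_pow_odd (by decide) hc1 h
    obtain ⟨e', he'⟩ := int_pow_odd (k := 3) (by decide) hc1.symm (by rw [mul_comm, h])
    obtain ⟨g, hg⟩ := int_pow_odd (k := 3) (by decide) hcop (by rw [← he']; ring)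
    obtain ⟨g', hg'⟩ := int_pow_odd (k := 3) (by decide) hcop.symm (by rw [← he']; ring)
    obtain ⟨z, hz, _⟩ := int_pow_cop (x := 2 * u) (y := e) (m := 2) (n := 3) (by decide) (by decide) (by decide)
      (by rw [← he]; ring)
    refine flt3 (a := g) (b := g') (c := z) ?_ ?_ ?_ (by rw [← hg, ← hg', ← hz]; ring)
    · rintro rfl; simp at hg; rw [hg] at hodd; simp at hodd
    · rintro rfl; simp at hg'; rw [hg'] at hodd2; simp at hodd2
    · rintro rfl; simp at hz; exact hu0 hz
  · refine ⟨hu, ?_⟩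
    have hc1 : IsCoprime (u ^ 2) (4 * (u ^ 2 - B ^ 2)) := by
      have e1 : IsCoprime u (u ^ 2 - B ^ 2) := by
        have := (huB.pow_right (n := 2)).neg_right
        have := this.add_mul_left_right u
        rw [show u ^ 2 - B ^ 2 = -B ^ 2 + u * u by ring]; exact this
      have e2 : IsCoprime u 2 := by
        obtain ⟨k, hk⟩ := hu
        exact ⟨1, -k, by linear_combination hk⟩
      have := (IsCoprime.mul_right (e2.pow_right (n := 2)) e1).pow_left (m := 2)
      norm_num at this
      exact this
    obtain ⟨e, he⟩ := int_pow_odd (k := 3) (c := C) (by decide) hc1 (by rw [← h]; ring)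
    obtain ⟨e', he'⟩ := int_pow_odd (k := 3) (c := C) (by decide) hc1.symm (by rw [← h]; ring)
    obtain ⟨P, hP, _⟩ := int_pow_cop (x := u) (y := e) (m := 2) (n := 3) (by decide) (by decide) (by decide) he
    refine ⟨⟨P, hP⟩, ?_⟩
    -- u^2 - B^2 = 2 C1^3, C1 even
    have hm8 : (8 : ℤ) ∣ u ^ 2 - B ^ 2 := Int.sq_mod_four_eq_one_of_odd hu |> fun _ => by
      obtain ⟨a, rfl⟩ := hu
      obtain ⟨b, rfl⟩ := hB
      obtain ⟨s, hs⟩ := Int.even_mul_succ_self a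
      obtain ⟨t, ht⟩ := Int.even_mul_succ_self b
      exact ⟨s - t, by linear_combination 4 * hs - 4 * ht⟩
    obtain ⟨w, hw⟩ := hm8
    have h4 : (2 : ℤ) ∣ e' := by
      apply Int.prime_two.dvd_of_dvd_pow (n := 3)
      rw [← he', hw]; exact ⟨16 * w, by ring⟩
    obtain ⟨f, rfl⟩ := h4
    have h5 : (2 : ℤ) ∣ f := by
      apply Int.prime_two.dvd_of_dvd_pow (n := 3)
      exact ⟨2 * w, by linarith⟩
    obtain ⟨g, rfl⟩ := h5
    refine ⟨g, by linarith, ?_⟩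
    rintro rfl
    apply hC
    have : C ^ 3 = 0 := by rw [← h]; linear_combination u ^ 2 * he'
    simpa using this

theorem p2_one (u C : ℤ) (hC : C ≠ 0) (h : 4 * u ^ 2 * (u ^ 2 - 1) = C ^ 3) : False := by
  obtain ⟨hu, ⟨P, hP⟩, C2, h2, hC2⟩ := p2_four u 1 C hC isCoprime_one_right odd_one (by rw [← h]; ring)
  obtain ⟨t, ht⟩ := hu
  have hP0 : P ≠ 0 := by rintro rfl; simp at hP; omega
  have hprod : t * (t + 1) = (4 : ℕ) * C2 ^ 3 := by push_cast; rw [ht] at h2; linarith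
  have hcop : IsCoprime t (t + 1) := ⟨-1, 1, by ring⟩
  have ht0 : t ≠ 0 := by
    rintro rfl; simp at hprod; exact hC2 hprod
  have ht1 : t + 1 ≠ 0 := by
    intro h0; rw [h0] at hprod; simp at hprod; exact hC2 hprod
  rcases int_split (q := 4) (by exact ⟨2, 2, Nat.prime_two.prime, by norm_num, by norm_num⟩) hcop hprod with ⟨A, hA, hA2, hA3⟩ | ⟨A, hA, hA2, hA3⟩
  · obtain ⟨s, hs⟩ := int_pow_odd (k := 3) (by decide) hA3 hA2
    refine flt3 (a := 2 * s) (b := 1) (c := P) ?_ one_ne_zero hP0 ?_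
    · intro h0
      have : s = 0 := by linarith
      rw [this] at hs; simp at hs; rw [hs] at hA; simp at hA; exact ht0 hA
    · rw [← hP, ht, hA, hs]; push_cast; ring
  · obtain ⟨s, hs⟩ := int_pow_odd (k := 3) (by decide) hA3.symm (by rw [mul_comm]; exact hA2)
    refine flt3 (a := P) (b := 1) (c := 2 * s) hP0 one_ne_zero ?_ ?_
    · intro h0
      have : s = 0 := by linarith
      rw [this] at hs; simp at hs; rw [hs] at hA; simp at hA; exact ht1 hA
    · rw [← hP, ht]; push_cast at hA; rw [hs] at hA; linear_combination 2 * hA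

theorem p2_pos (u B C z : ℤ) (hC : C ≠ 0) (huB : IsCoprime u B) (hB : Odd B) (hup : 0 < u)
    (h : 4 * u ^ 2 * (u ^ 2 - B ^ 2) = C ^ 3) (hz : u * (u + B) = 2 * z ^ 2) : False := by
  obtain ⟨hu, ⟨P, hP⟩, C2, h2, hC2⟩ := p2_four u B C hC huB hB h
  obtain ⟨X, hX⟩ := hu.add_odd hB
  set Y := u - X with hY
  have hBX : B = X - Y := by omega
  have huX : u = X + Y := by omega
  have hcop : IsCoprime X Y := cop_half huB huX hBX
  have hcopu : IsCoprime u X := by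
    obtain ⟨a, b, hab⟩ := hcop
    exact ⟨b, a - b, by rw [huX]; linear_combination hab⟩
  have hsq : u * X = z ^ 2 := by
    have : u * (2 * X) = 2 * z ^ 2 := by rw [← hz, hX]; ring
    linarith
  obtain ⟨Q0, hQ0, hQ⟩ := int_pow_nonneg hup.le hcopu hsq
  have hX0 : 0 ≤ X := by
    by_contra hneg
    push Not at hneg
    nlinarith [sq_nonneg z]
  obtain ⟨R, hR0, hR⟩ := int_pow_nonneg hX0 hcopu.symm (by rw [mul_comm]; exact hsq)
  obtain ⟨Q, hQP, _⟩ := int_pow_cop (x := Q0) (y := P) (m := 2) (n := 3) (by decide) (by decide) (by decide)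
    (by rw [← hQ, hP])
  have huQ : u = Q ^ 6 := by rw [hQ, hQP]; ring
  have hQne : Q ≠ 0 := by rintro rfl; simp at huQ; omega
  have hprod : X * Y = (4 : ℕ) * C2 ^ 3 := by
    have e1 : u - B = 2 * Y := by omega
    have e2 : u + B = 2 * X := by omega
    rw [e1, e2] at h2; push_cast; linarith
  have hXne : X ≠ 0 := by rintro rfl; simp at hprod; exact hC2 hprod
  have hYne : Y ≠ 0 := by intro h0; rw [h0] at hprod; simp at hprod; exact hC2 hprod
  rcases int_split (q := 4) (by exact ⟨2, 2, Nat.prime_two.prime, by norm_num, by norm_num⟩) hcop hprod with ⟨A, hA, hA2, hA3⟩ | ⟨A, hA, hA2, hA3⟩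
  · -- X = 4 s^3, Y = t^3
    obtain ⟨s, hs⟩ := int_pow_odd (k := 3) (by decide) hA3 hA2
    obtain ⟨t, ht⟩ := int_pow_odd (k := 3) (by decide) hA3.symm (by rw [mul_comm]; exact hA2)
    have hR2 : (2 : ℤ) ∣ R := by
      apply Int.prime_two.dvd_of_dvd_pow (n := 2)
      rw [← hR, hA]; exact ⟨2 * A, by push_cast; ring⟩
    obtain ⟨R', rfl⟩ := hR2
    obtain ⟨σ, h3, h4⟩ := int_pow_cop (x := R') (y := s) (m := 2) (n := 3) (by decide) (by decide) (by decide)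
      (by push_cast at hA; rw [hs, hR] at hA; linarith)
    have hσ0 : σ ≠ 0 := by rintro rfl; simp at h3; rw [h3] at hR; simp at hR; exact hXne hR
    have hfac : (Q ^ 3 - 2 * σ ^ 3) * (Q ^ 3 + 2 * σ ^ 3) = t ^ 3 := by
      have : Y = Q ^ 6 - 4 * σ ^ 6 := by rw [hY, huQ, hR, h3]; ring
      rw [← ht, this]; ring
    have hQodd : Odd (Q ^ 3 - 2 * σ ^ 3) := by
      have h1 : Odd Q := by
        rw [huQ] at hu
        exact (Int.odd_pow.mp hu).resolve_right (by decide)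
      exact (h1.pow).sub_even ⟨σ ^ 3, by ring⟩
    have hcop2 : IsCoprime (Q ^ 3) (2 * σ ^ 3) := by
      have : IsCoprime u X := hcopu
      rw [huQ, hR, h3] at this
      have h6 : IsCoprime (Q ^ 3 * Q ^ 3) (2 * σ ^ 3 * (2 * σ ^ 3)) := by
        convert this using 1 <;> ring
      exact h6.of_mul_left_left.of_mul_right_left
    have hcop3 := cop_odd hcop2 hQodd
    obtain ⟨g, hg⟩ := int_pow_odd (k := 3) (by decide) hcop3 hfac
    obtain ⟨g', hg'⟩ := int_pow_odd (k := 3) (by decide) hcop3.symm (by rw [mul_comm]; exact hfac)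
    have hgne : g * g' ≠ 0 := by
      intro h0
      have : t ^ 3 = (g * g') ^ 3 := by rw [← hfac, hg, hg']; ring
      rw [h0] at this; rw [this] at ht; simp at ht; exact hYne ht
    refine flt3 (a := g ^ 2) (b := 2 * σ * Q) (c := g' ^ 2) ?_ ?_ ?_ ?_
    · exact pow_ne_zero 2 (left_ne_zero_of_mul hgne)
    · exact mul_ne_zero (mul_ne_zero two_ne_zero hσ0) hQne
    · exact pow_ne_zero 2 (right_ne_zero_of_mul hgne)
    · have e1 : (g ^ 2) ^ 3 = (g ^ 3) ^ 2 := by ring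
      have e2 : (g' ^ 2) ^ 3 = (g' ^ 3) ^ 2 := by ring
      rw [e1, e2, ← hg, ← hg']; ring
  · obtain ⟨s, hs⟩ := int_pow_odd (k := 3) (by decide) hA3.symm (by rw [mul_comm]; exact hA2)
    obtain ⟨t, ht⟩ := int_pow_odd (k := 3) (by decide) hA3 hA2
    obtain ⟨σ, h3, h4⟩ := int_pow_cop (x := R) (y := t) (m := 2) (n := 3) (by decide) (by decide) (by decide)
      (by rw [← hR, ← ht])
    have hXσ : X = σ ^ 6 := by rw [hR, h3]; ring
    have hXodd : Odd σ := by
      have : Odd X := by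
        have e1 : X = u - Y := by omega
        rw [e1]; apply hu.sub_even; rw [hA]; exact ⟨2 * A, by push_cast; ring⟩
      rw [hXσ] at this
      exact (Int.odd_pow.mp this).resolve_right (by decide)
    have hQodd : Odd Q := by
        rw [huQ] at hu
        exact (Int.odd_pow.mp hu).resolve_right (by decide)
    obtain ⟨x, hx⟩ := (hQodd.pow (n := 3)).add_odd (hXodd.pow (n := 3))
    set y := Q ^ 3 - x with hy
    have e1 : Q ^ 3 = x + y := by omega
    have e2 : σ ^ 3 = x - y := by omega
    have hcop2 : IsCoprime (Q ^ 3) (σ ^ 3) := by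
      have : IsCoprime u X := hcopu
      rw [huQ, hXσ] at this
      exact ((IsCoprime.pow_iff (by decide) (by decide)).mp this).pow
    have hcop3 := cop_half hcop2 e1 e2
    have hxy : x * y = s ^ 3 := by
      have e3 : Y = 4 * (x * y) := by
        rw [hY, huQ, hXσ]
        have : Q ^ 6 - σ ^ 6 = (Q ^ 3) ^ 2 - (σ ^ 3) ^ 2 := by ring
        rw [this, e1, e2]; ring
      rw [hA, hs] at e3; push_cast at e3; linarith
    obtain ⟨g, hg⟩ := int_pow_odd (k := 3) (by decide) hcop3 hxy
    obtain ⟨g', hg'⟩ := int_pow_odd (k := 3) (by decide) hcop3.symm (by rw [mul_comm]; exact hxy)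
    have hgne : g * g' ≠ 0 := by
      intro h0
      have : s ^ 3 = (g * g') ^ 3 := by rw [← hxy, hg, hg']; ring
      rw [h0] at this; rw [this] at hs; simp at hs; rw [hs] at hA; simp at hA; exact hYne hA
    exact flt3 (a := g) (b := g') (c := Q) (left_ne_zero_of_mul hgne) (right_ne_zero_of_mul hgne) hQne
      (by rw [← hg, ← hg', ← e1])

theorem p2_gen (u B C z : ℤ) (hC : C ≠ 0) (huB : IsCoprime u B) (hB : Odd B)
    (h : 4 * u ^ 2 * (u ^ 2 - B ^ 2) = C ^ 3) (hz : u * (u + B) = 2 * z ^ 2) : False := by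
  rcases lt_trichotomy u 0 with h0 | h0 | h0
  · exact p2_pos (-u) (-B) C z hC huB.neg_neg hB.neg (by omega) (by rw [← h]; ring) (by rw [← hz]; ring)
  · subst h0; simp at h; exact hC (by simpa using h.symm)
  · exact p2_pos u B C z hC huB hB h0 h hz
end PTwoA


section PTwoB

theorem aS_cop {d : ℕ} (hd : 2 ≤ d) (c : ℤ) (k : ℕ) : IsCoprime (aS d c k) c := by
  induction k with
  | zero => simpa [aS] using isCoprime_one_left
  | succ k ih =>
    rw [aS]
    have h1 : d ^ (k + 1) - 1 ≠ 0 := by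
      have : 2 ^ (k + 1) ≤ d ^ (k + 1) := Nat.pow_le_pow_left hd _
      have : 2 ≤ 2 ^ (k + 1) := by rw [pow_succ]; have := Nat.one_le_two_pow (n := k); omega
      omega
    obtain ⟨e, he⟩ := Nat.exists_eq_succ_of_ne_zero h1
    rw [he, pow_succ']
    exact (ih.pow_left (m := d)).add_mul_left_left _

theorem three_dvd {d : ℕ} (hd : d % 3 = 1) (n : ℕ) : 3 ∣ d ^ n - 1 := by
  have h1 : (1 : ℕ) ≡ d ^ n [MOD 3] := by
    have : d ≡ 1 [MOD 3] := hd
    simpa using (this.pow n).symm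
  exact (Nat.modEq_iff_dvd' (Nat.one_le_pow _ _ (by omega))).mp h1

theorem p2_setup {A c : ℤ} {m : ℕ} (hm : m ≠ 0) {u v : ℚ} (hcop : IsCoprime A c)
    (h1 : u ^ 2 - (c : ℚ) ^ m * v ^ 2 = A) (h2 : 2 * u * v = -1) :
    ∃ U : ℤ, u = U ∧ 4 * U ^ 2 * (U ^ 2 - A) = c ^ m ∧ IsCoprime U A ∧ 2 ∣ c ∧ Odd A := by
  have e1 : 4 * u ^ 2 * (u ^ 2 - A) = (c : ℚ) ^ m := by
    have : u ^ 2 - A = (c : ℚ) ^ m * v ^ 2 := by linarith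
    rw [this]; linear_combination (c : ℚ) ^ m * (2 * u * v - 1) * h2
  obtain ⟨y, hy⟩ := rat_int_of_pow (y := 2 * u ^ 2 - A) (n := 2) (z := A ^ 2 + c ^ m) two_pos
    (by push_cast; linear_combination e1)
  obtain ⟨t, ht⟩ := rat_int_of_pow (y := 2 * u) (n := 2) (z := 2 * (y + A)) two_pos
    (by push_cast; rw [← hy]; ring)
  have ht2 : t ^ 2 = 2 * (y + A) := by
    have : (t : ℚ) ^ 2 = 2 * (y + A) := by rw [← ht, ← hy]; ring
    exact_mod_cast this
  obtain ⟨U, rfl⟩ : (2 : ℤ) ∣ t := Int.prime_two.dvd_of_dvd_pow (n := 2) ⟨_, ht2⟩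
  have hu : u = U := by push_cast at ht; linarith
  subst hu
  have e2 : 4 * U ^ 2 * (U ^ 2 - A) = c ^ m := by exact_mod_cast e1
  have h2c : 2 ∣ c := Int.prime_two.dvd_of_dvd_pow (n := m) ⟨2 * U ^ 2 * (U ^ 2 - A), by rw [← e2]; ring⟩
  refine ⟨U, rfl, e2, ?_, h2c, ?_⟩
  · have h3 : IsCoprime A (c ^ m) := hcop.pow_right
    rw [← e2, show 4 * U ^ 2 * (U ^ 2 - A) = U * (4 * U * (U ^ 2 - A)) by ring] at h3
    exact h3.of_mul_right_left.symm
  · rw [← Int.not_even_iff_odd, even_iff_two_dvd]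
    intro h
    have := hcop.isUnit_of_dvd' h h2c
    exact Int.prime_two.not_isUnit this

theorem p2_zero {d : ℕ} (hd : 2 ≤ d) (hmod : d % 3 = 1) {c : ℤ} (hc : c ≠ 0) (h : KeyP d c 0 2 2) : False := by
  obtain ⟨u, v, h1, h2⟩ := conc_two_two h
  have hm : d ^ (0 + 1) - 1 ≠ 0 := by simp; omega
  obtain ⟨e, he⟩ := three_dvd hmod (0 + 1)
  simp only [aS, Int.cast_one, one_pow] at h1
  obtain ⟨U, hU, hU2, -⟩ := p2_setup (A := 1) hm isCoprime_one_left (by simpa using h1) h2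
  refine p2_one U (c ^ e) (pow_ne_zero _ hc) ?_
  rw [hU2, he, mul_comm, pow_mul]

theorem p2_succ {d : ℕ} (hd : 2 ≤ d) (hmod : d % 3 = 1) (k : ℕ) {c : ℤ} (hc : c ≠ 0) (h4 : 4 ∣ d) (h : KeyP d c k 2 4) : False := by
  obtain ⟨u, v, z, h1, h2, h3⟩ := conc_four h
  have hm : d ^ (k + 1) - 1 ≠ 0 := by
    have : d ^ 1 ≤ d ^ (k + 1) := Nat.pow_le_pow_right (by omega) (by omega)
    rw [pow_one] at this
    omega
  obtain ⟨e, he⟩ := three_dvd hmod (k + 1)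
  have hcop := aS_cop hd c k
  obtain ⟨U, hU, hU2, hU3, hc2, hodd⟩ := p2_setup (A := ((aS d c k) ^ (d / 4)) ^ 2) hm (hcop.pow_left.pow_left)
    (by push_cast; exact h1) h2
  set B := (aS d c k) ^ (d / 4) with hB
  have h3' : (U : ℚ) * (U + B) = 2 * z ^ 2 := by rw [hB, ← hU]; push_cast; exact h3
  obtain ⟨t, ht⟩ := rat_int_of_pow (y := 2 * z) (n := 2) (z := 2 * (U * (U + B))) two_pos
    (by push_cast; rw [h3']; ring)
  have ht2 : t ^ 2 = 2 * (U * (U + B)) := by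
    have : (t : ℚ) ^ 2 = 2 * (U * (U + B)) := by rw [← ht, h3']; ring
    exact_mod_cast this
  obtain ⟨Z, rfl⟩ : (2 : ℤ) ∣ t := Int.prime_two.dvd_of_dvd_pow (n := 2) ⟨_, ht2⟩
  refine p2_gen U B (c ^ e) Z (pow_ne_zero _ hc) ?_ ?_ ?_ (by linarith)
  · exact (IsCoprime.pow_right_iff two_pos).mp hU3
  · exact (Int.odd_pow.mp hodd).resolve_right (by decide)
  · rw [hU2, he, mul_comm, pow_mul]
end PTwoB


section Bounds

theorem eight_le {d : ℕ} (hd : 6 ≤ d) : 8 * d ≤ 2 ^ d := by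
  induction d, hd using Nat.le_induction with
  | base => norm_num
  | succ n hn ih => rw [pow_succ]; omega

theorem one_add_pow_le_two {d : ℕ} (hd : 6 ≤ d) {x : ℝ} (hx0 : 0 ≤ x) (hx : x * 2 ^ d ≤ 4) : (1 + x) ^ d ≤ 2 := by
  have h8 : (8 : ℝ) * d ≤ 2 ^ d := by exact_mod_cast eight_le hd
  have hdpos : (0 : ℝ) < d := by exact_mod_cast (by omega : 0 < d)
  have hdx : d * x ≤ 1 / 2 := by nlinarith
  have hx1 : x ≤ 1 / 2 := by
    have : (1 : ℝ) ≤ d := by exact_mod_cast (by omega : 1 ≤ d)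
    nlinarith
  have hb := one_add_mul_le_pow (a := -x) (by linarith) d
  have hprod : (1 + x) ^ d * (1 + -x) ^ d ≤ 1 := by
    rw [← mul_pow]; apply pow_le_one₀ <;> nlinarith
  have hp : 0 < (1 + x) ^ d := by positivity
  nlinarith

theorem aS_bound {d : ℕ} (hd : 6 ≤ d) {c : ℤ} (hc : 2 ≤ |c|) (k : ℕ) :
    |aS d c k| ^ d * |c| ^ d ≤ 2 * |c| ^ (d ^ (k + 1)) := by
  induction k with
  | zero =>
    simp only [aS, zero_add, pow_one, abs_one, one_pow, one_mul]
    have : 0 ≤ |c| ^ d := by positivity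
    linarith
  | succ k ih =>
    set C : ℝ := ((|c| : ℤ) : ℝ) with hC
    have hC2 : (2 : ℝ) ≤ C := by rw [hC]; exact_mod_cast hc
    set M := d ^ (k + 1) with hM
    have hM1 : 1 ≤ M := Nat.one_le_pow _ _ (by omega)
    obtain ⟨M', hM'⟩ := Nat.exists_eq_add_of_le' hM1
    set α : ℝ := ((|aS d c k| : ℤ) : ℝ) ^ d with hα
    have hα0 : 0 ≤ α := by rw [hα]; positivity
    have ih' : α * C ^ d ≤ 2 * C ^ M := by rw [hα, hC]; exact_mod_cast ih
    have h1 : ((|aS d c (k + 1)| : ℤ) : ℝ) ≤ α + C ^ M' := by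
      have : |aS d c (k + 1)| ≤ |aS d c k| ^ d + |c| ^ M' := by
        rw [aS, ← hM, hM', Nat.add_sub_cancel]
        refine (abs_add_le _ _).trans ?_
        rw [abs_pow, abs_pow]
      rw [hα, hC]; exact_mod_cast this
    have hCM : 0 < C ^ M := by positivity
    have hx : (C * α / C ^ M) * 2 ^ d ≤ 4 := by
      rw [div_mul_eq_mul_div, div_le_iff₀ hCM]
      obtain ⟨e, he⟩ : ∃ e, d = e + 1 := ⟨d - 1, by omega⟩
      have h2 : (2 : ℝ) ^ d ≤ 2 * C ^ e := by
        rw [he, pow_succ, mul_comm]; gcongr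
      have h3 : C * α * (2 * C ^ e) = 2 * (α * C ^ d) := by rw [he, pow_succ]; ring
      calc C * α * 2 ^ d ≤ C * α * (2 * C ^ e) := by gcongr
        _ = 2 * (α * C ^ d) := h3
        _ ≤ 4 * C ^ M := by linarith
    have h4 := one_add_pow_le_two hd (by positivity) hx
    have h5 : ((|aS d c (k + 1)| : ℤ) : ℝ) * C ≤ C ^ M * (1 + C * α / C ^ M) := by
      have : C ^ M * (1 + C * α / C ^ M) = C ^ M + C * α := by field_simp
      rw [this]
      have : C ^ M = C * C ^ M' := by rw [hM', pow_succ]; ring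
      rw [this]; nlinarith
    have h6 : (((|aS d c (k + 1)| : ℤ) : ℝ) * C) ^ d ≤ 2 * C ^ (d ^ (k + 1 + 1)) := by
      calc (((|aS d c (k + 1)| : ℤ) : ℝ) * C) ^ d ≤ (C ^ M * (1 + C * α / C ^ M)) ^ d := by
            gcongr
        _ = (C ^ M) ^ d * (1 + C * α / C ^ M) ^ d := mul_pow _ _ _
        _ ≤ (C ^ M) ^ d * 2 := by gcongr
        _ = 2 * C ^ (d ^ (k + 1 + 1)) := by rw [← pow_mul, hM, ← pow_succ]; ring
    rw [mul_pow, hC] at h6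
    exact_mod_cast h6

/-- convexity estimate -/
theorem conv_est {p m d : ℕ} (hp : 1 ≤ p) (hd : p + 3 ≤ d) (hm : p ≤ m) {K b G : ℝ} (hK : 2 ≤ K) (hb : 0 ≤ b)
    (hG : 0 ≤ G) (hGp : G ^ p ≤ (K - 1) ^ m) (hbp : b ^ p * K ^ d ≤ 2 * K ^ (m + 1))
    (h : K ^ m ≤ (b + G) ^ p) : False := by
  have hK0 : 0 < K := by linarith
  have hK1 : 0 < K - 1 := by linarith
  have hcx : ConvexOn ℝ (Set.Ici 0) (fun x : ℝ => x ^ p) := convexOn_pow p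
  have hconv := hcx.2 (Set.mem_Ici.mpr (by positivity : (0 : ℝ) ≤ K * b))
    (Set.mem_Ici.mpr (by positivity : (0 : ℝ) ≤ K / (K - 1) * G)) (by positivity : (0 : ℝ) ≤ 1 / K)
    (by rw [sub_nonneg, div_le_iff₀ hK0]; linarith : (0 : ℝ) ≤ 1 - 1 / K) (by ring)
  simp only [smul_eq_mul] at hconv
  have e1 : 1 / K * (K * b) + (1 - 1 / K) * (K / (K - 1) * G) = b + G := by field_simp
  rw [e1] at hconv
  obtain ⟨q, rfl⟩ := Nat.exists_eq_add_of_le' hp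
  obtain ⟨n, rfl⟩ := Nat.exists_eq_add_of_le hm
  obtain ⟨s, rfl⟩ := Nat.exists_eq_add_of_le hd
  -- first term
  have t1 : 1 / K * (K * b) ^ (q + 1) = K ^ q * b ^ (q + 1) := by
    rw [mul_pow, pow_succ K]; field_simp
  have t1' : K ^ q * b ^ (q + 1) * K ^ 3 * K ^ s ≤ 2 * (K ^ (q + 1 + n)) := by
    have : K * (K ^ q * b ^ (q + 1) * K ^ 3 * K ^ s) ≤ K * (2 * (K ^ (q + 1 + n))) := by
      calc K * (K ^ q * b ^ (q + 1) * K ^ 3 * K ^ s) = b ^ (q + 1) * K ^ (q + 1 + 3 + s) := by ring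
        _ ≤ _ := hbp
        _ = _ := by ring
    exact le_of_mul_le_mul_left this hK0
  have t1'' : K ^ q * b ^ (q + 1) * K < K ^ (q + 1 + n) := by
    have hs : 1 ≤ K ^ s := one_le_pow₀ (by linarith)
    have hA : 0 ≤ K ^ q * b ^ (q + 1) * K := by positivity
    have hP : 0 < K ^ (q + 1 + n) := by positivity
    have h4 : 4 ≤ K ^ 2 := by nlinarith
    have : K ^ q * b ^ (q + 1) * K * 4 ≤ 2 * K ^ (q + 1 + n) := by
      calc K ^ q * b ^ (q + 1) * K * 4 ≤ K ^ q * b ^ (q + 1) * K * (K ^ 2 * K ^ s) := by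
            gcongr; nlinarith
        _ = K ^ q * b ^ (q + 1) * K ^ 3 * K ^ s := by ring
        _ ≤ _ := t1'
    linarith
  -- second term
  have t2 : (1 - 1 / K) * (K / (K - 1) * G) ^ (q + 1) * K ≤ K ^ (q + 1 + n) * (K - 1) := by
    have h5 : (1 - 1 / K) * (K / (K - 1) * G) ^ (q + 1) * K = (K - 1) * (K / (K - 1)) ^ (q + 1) * G ^ (q + 1) := by
      rw [mul_pow]; field_simp
    rw [h5]
    calc (K - 1) * (K / (K - 1)) ^ (q + 1) * G ^ (q + 1) ≤ (K - 1) * (K / (K - 1)) ^ (q + 1) * (K - 1) ^ (q + 1 + n) := by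
          gcongr
      _ = K ^ (q + 1) * (K - 1) ^ n * (K - 1) := by
          rw [div_pow, pow_add (K - 1)]; field_simp; ring
      _ ≤ K ^ (q + 1) * K ^ n * (K - 1) := by gcongr; linarith
      _ = _ := by ring
  rw [t1] at hconv
  have : K ^ (q + 1 + n) * K ≤ (K ^ q * b ^ (q + 1) + (1 - 1 / K) * (K / (K - 1) * G) ^ (q + 1)) * K := by
    gcongr; linarith
  nlinarith
end Bounds


section NotDvd

theorem my_pow_add {x y : ℤ} {n : ℕ} (hx : 0 ≤ x) (hy : 0 ≤ y) (hn : n ≠ 0) : x ^ n + y ^ n ≤ (x + y) ^ n := by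
  induction n with
  | zero => exact absurd rfl hn
  | succ n ih =>
    rcases Nat.eq_zero_or_pos n with h0 | h0
    · subst h0; simp
    · have h1 := ih (by omega)
      have h2 : 0 ≤ x ^ n := by positivity
      have h3 : 0 ≤ y ^ n := by positivity
      calc x ^ (n + 1) + y ^ (n + 1) ≤ (x ^ n + y ^ n) * (x + y) := by rw [pow_succ, pow_succ]; nlinarith [mul_nonneg h2 hy, mul_nonneg h3 hx]
        _ ≤ (x + y) ^ (n + 1) := by rw [pow_succ]; gcongr

theorem E_abs {p m d : ℕ} (hp : p.Prime) (hpo : Odd p) (hd : p + 3 ≤ d) (hm : p ≤ m) (hdm : d ≤ m + 1) (hmo : Odd m)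
    {y b c : ℤ} (hb : 0 ≤ b) (hbc : IsCoprime b c) (hpc : IsCoprime (p : ℤ) c) (hc : 2 ≤ |c|)
    (hbd : b ^ p * |c| ^ d ≤ 2 * |c| ^ (m + 1)) (h : y ^ p = b ^ p + c ^ m) : False := by
  have hp0 : p ≠ 0 := hp.ne_zero
  have hm0 : m ≠ 0 := by have := hp.two_le; omega
  set Φ : ℤ := ∑ i ∈ Finset.range p, y ^ i * b ^ (p - 1 - i) with hΦ
  have hprod : (y - b) * Φ = c ^ m := by
    have := (Commute.all y b).geom_sum₂_mul p
    rw [mul_comm, hΦ, this, h]; ring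
  have hcop : IsCoprime (y - b) Φ := by
    rw [← isRelPrime_iff_isCoprime]
    intro g h1 h2
    have h3 : g ∣ (p : ℤ) * b ^ (p - 1) := (dvd_geom_sum₂_iff_of_dvd_sub h1).mp h2
    have h4 : g ∣ c ^ m := h1.trans (Dvd.intro _ hprod)
    exact (((hpc.mul_left hbc.pow_left).pow_right (n := m))).isUnit_of_dvd' h3 h4
  obtain ⟨g, hg⟩ := int_pow_natAbs hcop hprod
  obtain ⟨e, he⟩ := int_pow_natAbs hcop.symm ((mul_comm _ _).trans hprod)
  have hge : |c| = (g : ℤ) * e := by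
    have : |c| ^ m = ((g : ℤ) * e) ^ m := by rw [← abs_pow, ← hprod, abs_mul, hg, he, mul_pow]
    exact (pow_left_inj₀ (abs_nonneg _) (by positivity) hm0).mp this
  have hgecop : IsCoprime (g : ℤ) e := by
    have : IsCoprime ((g : ℤ) ^ m) ((e : ℤ) ^ m) := by
      rw [← hg, ← he]; exact hcop.abs_abs
    exact (IsCoprime.pow_iff (Nat.pos_of_ne_zero hm0) (Nat.pos_of_ne_zero hm0)).mp this
  have hgc : (g : ℤ) ^ p = |c| := by
    rcases lt_or_ge 0 c with hc0 | hc0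
    · rw [abs_of_pos hc0] at *
      have hcm : 0 < c ^ m := by positivity
      have hby : b < y := by
        have : b ^ p < y ^ p := by linarith
        exact (hpo.strictMono_pow).lt_iff_lt.mp this
      rw [abs_of_pos (by linarith)] at hg
      have h1 : (y - b) ^ p + b ^ p ≤ y ^ p := by
        have := my_pow_add (x := y - b) (y := b) (by linarith) hb hp0
        simpa using this
      have h2 : (g : ℤ) ^ p ≤ c := by
        have : ((g : ℤ) ^ p) ^ m ≤ c ^ m := by
          rw [← pow_mul, mul_comm, pow_mul, ← hg]; linarith
        exact (pow_le_pow_iff_left₀ (by positivity) hc0.le hm0).mp this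
      by_contra hne
      have h3 : (g : ℤ) ^ p ≤ c - 1 := by omega
      refine conv_est (p := p) (m := m) (d := d) hp.one_le hd hm (K := (c : ℝ)) (b := b) (G := ((g : ℝ) ^ m))
        (by exact_mod_cast hc) (by exact_mod_cast hb) (by positivity) ?_ (by exact_mod_cast hbd) ?_
      · rw [← pow_mul, mul_comm, pow_mul]
        have : (g : ℝ) ^ p ≤ c - 1 := by exact_mod_cast h3
        gcongr
      · have e1 : ((g : ℝ) ^ m) = ((y : ℝ) - b) := by exact_mod_cast hg.symm
        have e2 : (y : ℝ) ^ p = (b : ℝ) ^ p + (c : ℝ) ^ m := by exact_mod_cast h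
        have : (0 : ℝ) ≤ (b : ℝ) ^ p := by positivity
        rw [e1, add_sub_cancel, e2]; linarith
    · obtain ⟨C, rfl⟩ : ∃ C, c = -C := ⟨-c, by ring⟩
      have hC0 : 0 ≤ C := by linarith
      rw [abs_neg, abs_of_nonneg hC0] at *
      rw [hmo.neg_pow] at *
      have hCm : 0 < C ^ m := by positivity
      have hbC : b ^ p < C ^ m := by
        by_contra hlt
        push Not at hlt
        have h1 : C ^ m * C ^ d ≤ 2 * C ^ (m + 1) := le_trans (by gcongr) hbd
        rw [pow_succ, ← mul_assoc, mul_comm 2, mul_assoc] at h1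
        have h2 := le_of_mul_le_mul_left h1 hCm
        have h3 : C ^ 3 ≤ C ^ d := pow_le_pow_right₀ (by linarith) (by omega)
        nlinarith [mul_le_mul hc hc (by norm_num) hC0]
      have hy : y < 0 := by
        have : y ^ p < 0 := by linarith
        exact hpo.pow_neg_iff.mp this
      obtain ⟨Y, rfl⟩ : ∃ Y, y = -Y := ⟨-y, by ring⟩
      have hY : 0 < Y := by linarith
      rw [hpo.neg_pow] at h
      have hg' : b + Y = (g : ℤ) ^ m := by
        rw [← hg, abs_of_neg (by linarith)]; ring
      have h1 : b ^ p + Y ^ p ≤ (b + Y) ^ p := my_pow_add hb hY.le hp0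
      have h2 : C ≤ (g : ℤ) ^ p := by
        have : C ^ m ≤ ((g : ℤ) ^ p) ^ m := by
          rw [← pow_mul, mul_comm, pow_mul, ← hg']; linarith
        exact (pow_le_pow_iff_left₀ hC0 (by positivity) hm0).mp this
      by_contra hne
      have h3 : C + 1 ≤ (g : ℤ) ^ p := by omega
      have hCr : (2 : ℝ) ≤ C := by exact_mod_cast hc
      refine conv_est (p := p) (m := m) (d := d) hp.one_le hd hm (K := (C : ℝ) + 1) (b := b) (G := Y)
        (by linarith) (by exact_mod_cast hb) (by exact_mod_cast hY.le) ?_ ?_ ?_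
      · rw [add_sub_cancel_right]
        have hbp : 0 ≤ b ^ p := by positivity
        have : Y ^ p ≤ C ^ m := by linarith
        exact_mod_cast this
      · have hbd' : (b : ℝ) ^ p * (C : ℝ) ^ d ≤ 2 * (C : ℝ) ^ (m + 1) := by exact_mod_cast hbd
        obtain ⟨s, hs⟩ := Nat.exists_eq_add_of_le hdm
        rw [hs, pow_add] at hbd' ⊢
        have hCd : (0 : ℝ) < (C : ℝ) ^ d := by positivity
        have h5 : (b : ℝ) ^ p ≤ 2 * (C : ℝ) ^ s := by
          refine le_of_mul_le_mul_right ?_ hCd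
          calc _ ≤ _ := hbd'
            _ = _ := by ring
        calc (b : ℝ) ^ p * (C + 1 : ℝ) ^ d ≤ (2 * (C : ℝ) ^ s) * (C + 1 : ℝ) ^ d := by gcongr
          _ ≤ (2 * (C + 1 : ℝ) ^ s) * (C + 1 : ℝ) ^ d := by gcongr; linarith
          _ = _ := by ring
      · have e1 : ((b : ℝ) + Y) = (g : ℝ) ^ m := by exact_mod_cast hg'
        have h6 : (C : ℝ) + 1 ≤ (g : ℝ) ^ p := by exact_mod_cast h3
        rw [e1, ← pow_mul, mul_comm, pow_mul]; gcongr
  have hg0 : (0 : ℤ) < g := by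
    rcases Nat.eq_zero_or_pos g with h0 | h0
    · rw [h0] at hge; simp at hge; rw [hge] at hc; simp at hc
    · exact_mod_cast h0
  have h7 : (e : ℤ) = (g : ℤ) ^ (p - 1) := by
    have : (g : ℤ) * e = g * (g : ℤ) ^ (p - 1) := by
      rw [← hge, ← hgc, mul_pow_sub_one hp0]
    exact mul_left_cancel₀ hg0.ne' this
  have h8 : (g : ℤ) ∣ e := by rw [h7]; exact dvd_pow_self _ (by have := hp.two_le; omega)
  have h9 := hgecop.isUnit_of_dvd' dvd_rfl h8
  rw [Int.isUnit_iff] at h9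
  have : (g : ℤ) = 1 := by omega
  rw [this, one_pow] at hgc
  omega

theorem E_one {p : ℕ} (hp : 2 ≤ p) (hpo : Odd p) {y b : ℤ} (hb : 1 ≤ b) (h : y ^ p = b ^ p + 1) : False := by
  have hby : b < y := by
    have : b ^ p < y ^ p := by linarith
    exact (hpo.strictMono_pow).lt_iff_lt.mp this
  have h1 : (b + 1) ^ p ≤ y ^ p := pow_le_pow_left₀ (by linarith) (by linarith) p
  obtain ⟨q, rfl⟩ : ∃ q, p = q + 1 := ⟨p - 1, by omega⟩
  have h2 := my_pow_add (x := b) (y := 1) (n := q) (by linarith) (by norm_num) (by omega)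
  rw [one_pow] at h2
  have h3 : (b + 1) * (b ^ q + 1) ≤ (b + 1) ^ (q + 1) := by
    rw [pow_succ, mul_comm]; gcongr
  have h4 : 0 < b ^ q := by positivity
  rw [pow_succ b] at h
  nlinarith

theorem aS_one_pos {d : ℕ} (hd : Even d) (k : ℕ) : 1 ≤ aS d 1 k := by
  cases k with
  | zero => simp [aS]
  | succ k => rw [aS, one_pow]; have := hd.pow_nonneg (aS d 1 k); linarith

theorem m_odd {d : ℕ} (hd : Even d) (hd0 : d ≠ 0) (k : ℕ) : Odd (d ^ (k + 1) - 1) := by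
  have : Even (d ^ (k + 1)) := (Nat.even_pow.mpr ⟨hd, by omega⟩)
  have h1 : 0 < d ^ (k + 1) := by positivity
  exact Nat.Even.sub_odd h1 this odd_one

theorem m_bound {d : ℕ} (hd0 : d ≠ 0) (k : ℕ) : d ≤ d ^ (k + 1) - 1 + 1 := by
  have h1 : d ^ 1 ≤ d ^ (k + 1) := Nat.pow_le_pow_right (by omega) (by omega)
  rw [pow_one] at h1; omega

theorem E_main {d : ℕ} {c : ℤ} {k p : ℕ} (hp : p.Prime) (hpo : Odd p) (hpd : p + 3 ≤ d) (hd2 : Even d) (hdvd : p ∣ d)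
    (hc0 : c ≠ 0) (hc1 : c ≠ -1) (hpc : ¬ (p : ℤ) ∣ c) (h : KeyP d c k p 1) : False := by
  obtain ⟨y, hy⟩ := conc_one h
  have hp2 := hp.two_le
  obtain ⟨Y, rfl⟩ := rat_int_of_pow (y := y) (n := p) (z := aS d c k ^ d + c ^ (d ^ (k + 1) - 1)) (by omega) (by push_cast; exact hy)
  obtain ⟨e, he⟩ := hdvd
  have hev : Even e := by
    rw [he, Nat.even_mul] at hd2
    rcases hd2 with h1 | h1
    · exact absurd hpo (Nat.not_odd_iff_even.mpr h1)
    · exact h1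
  have hy' : Y ^ p = (aS d c k ^ e) ^ p + c ^ (d ^ (k + 1) - 1) := by
    rw [← pow_mul, mul_comm e, ← he]; exact_mod_cast hy
  have hd0 : d ≠ 0 := by omega
  have hmb := m_bound hd0 k
  by_cases hcc : c = 1
  · subst hcc
    rw [one_pow] at hy'
    exact E_one hp2 hpo (one_le_pow₀ (aS_one_pos hd2 k)) hy'
  have hc2 : 2 ≤ |c| := by
    rcases abs_cases c with h1 | h1 <;> omega
  refine E_abs hp hpo hpd (by omega) hmb (m_odd hd2 hd0 k) (hev.pow_nonneg _)
    ((aS_cop (by omega) c k).pow_left) ?_ hc2 ?_ hy'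
  · exact (Nat.prime_iff_prime_int.mp hp).irreducible.coprime_iff_not_dvd.mpr hpc
  · rw [← pow_mul, mul_comm e, ← he]
    have := aS_bound (by have := hpo; rcases this with ⟨w, hw⟩; omega : 6 ≤ d) hc2 k
    rw [Nat.sub_add_cancel (Nat.one_le_pow _ _ (by omega))]
    rwa [← abs_pow, abs_of_nonneg (hd2.pow_nonneg _)] at this
end NotDvd


section Desc

theorem three_sq_sum {x y : ℤ} (h : (3 : ℤ) ∣ x ^ 2 + y ^ 2) : (3 : ℤ) ∣ x ∧ (3 : ℤ) ∣ y := by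
  have h1 : x % 3 = 0 ∨ x % 3 = 1 ∨ x % 3 = 2 := by omega
  have h2 : y % 3 = 0 ∨ y % 3 = 1 ∨ y % 3 = 2 := by omega
  have h3 := Int.emod_emod_of_dvd (x ^ 2 + y ^ 2) (dvd_refl 3)
  have h4 : (x ^ 2 + y ^ 2) % 3 = 0 := Int.emod_eq_zero_of_dvd h
  rcases h1 with h1 | h1 | h1 <;> rcases h2 with h2 | h2 | h2 <;>
    simp [pow_two, Int.add_emod, Int.mul_emod, h1, h2] at h4 <;> constructor <;> omega

theorem not_both_dvd {x y n : ℤ} (h : IsCoprime x y) (hn : ¬ IsUnit n) (h1 : n ∣ x) (h2 : n ∣ y) : False :=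
  hn (h.isUnit_of_dvd' h1 h2)

theorem not_unit_three : ¬ IsUnit (3 : ℤ) := by rw [Int.isUnit_iff]; omega

theorem pos_sq_split {A B w : ℤ} (hA : 0 < A) (hw : w ≠ 0) (hc : IsCoprime A B) (h : A * B = w ^ 2) :
    ∃ a b : ℤ, A = a ^ 2 ∧ B = b ^ 2 := by
  have hB : 0 < B := by
    have : 0 < A * B := by rw [h]; positivity
    exact (pos_iff_pos_of_mul_pos this).mp hA
  obtain ⟨a, -, ha⟩ := int_pow_nonneg hA.le hc h
  obtain ⟨b, -, hb⟩ := int_pow_nonneg hB.le hc.symm ((mul_comm _ _).trans h)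
  exact ⟨a, b, ha, hb⟩

/-- the core step -/
theorem kl_step {k l r : ℤ} (hl : 0 < l) (hkl : l < k) (hc : IsCoprime k l) (ho : Odd (k - l))
    (h : k * l * ((k - l) * (k + l)) = 3 * r ^ 2) (hr : r ≠ 0) :
    ∃ K L M N : ℤ, N ^ 2 = K ^ 2 + 3 * L ^ 2 ∧ M ^ 2 = K ^ 2 - 3 * L ^ 2 ∧ IsCoprime N M ∧ Odd N ∧ Odd M ∧ L ≠ 0 ∧ L ∣ r := by
  have hk : 0 < k := by linarith
  have c1 : IsCoprime k (k - l) := by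
    have := hc.neg_right.add_mul_left_right 1
    simpa [add_comm, sub_eq_add_neg] using this
  have c2 : IsCoprime k (k + l) := by simpa [add_comm] using hc.add_mul_left_right 1
  have c3 : IsCoprime l (k - l) := by simpa [sub_eq_add_neg] using hc.symm.add_mul_left_right (-1)
  have c4 : IsCoprime l (k + l) := by simpa using hc.symm.add_mul_left_right 1
  have c5 : IsCoprime (k - l) (k + l) := cop_odd hc ho
  have c6 : IsCoprime (k * l) ((k - l) * (k + l)) :=
    (c1.mul_right c2).mul_left (c3.mul_right c4)
  have p1 : 0 < k - l := by linarith
  have p2 : 0 < k + l := by linarith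
  have h3 : IsPrimePow 3 := Nat.prime_three.isPrimePow
  rcases int_split h3 c6 h with ⟨A, hA, hAB, hcA⟩ | ⟨B, hB, hAB, hcB⟩
  · push_cast at hA
    have hAp : 0 < A := by nlinarith [mul_pos hk hl]
    obtain ⟨a, b, rfl, hb⟩ := pos_sq_split hAp hr hcA hAB
    have ha0 : a ≠ 0 := by rintro rfl; simp at hAp
    have hb0 : b ≠ 0 := by rintro rfl; nlinarith [mul_pos p1 p2]
    obtain ⟨M, N, hM, hN⟩ := pos_sq_split p1 hb0 c5 hb
    rcases int_split h3 hc hA with ⟨k', hk', hkl', hck⟩ | ⟨l', hl', hkl', hcl⟩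
    · exfalso
      push_cast at hk'
      obtain ⟨K, L, hK, hL⟩ := pos_sq_split (by linarith) ha0 hck hkl'
      have : (3 : ℤ) ∣ M ^ 2 + L ^ 2 := ⟨k', by linarith⟩
      obtain ⟨-, h6⟩ := three_sq_sum this
      refine not_both_dvd hc not_unit_three ⟨k', hk'⟩ ?_
      rw [hL]; exact dvd_pow h6 two_ne_zero
    · push_cast at hl'
      obtain ⟨K, L, hK, hL⟩ := pos_sq_split hk ha0 hcl hkl'
      refine ⟨K, L, M, N, by linarith, by linarith, ?_, ?_, ?_, ?_, ?_⟩
      · rw [hM, hN] at c5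
        exact ((IsCoprime.pow_iff two_pos two_pos).mp c5).symm
      · have : Odd (k + l) := by obtain ⟨w, hw⟩ := ho; exact ⟨w + l, by linarith⟩
        rw [hN] at this; exact (Int.odd_pow.mp this).resolve_right two_ne_zero
      · rw [hM] at ho; exact (Int.odd_pow.mp ho).resolve_right two_ne_zero
      · rintro rfl; simp at hL; omega
      · have h7 : L ∣ a := (Int.pow_dvd_pow_iff two_ne_zero).mp ⟨k, by rw [← hkl', hL]; ring⟩
        have h8 : a ∣ r := (Int.pow_dvd_pow_iff two_ne_zero).mp ⟨_, hAB.symm⟩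
        exact h7.trans h8
  · exfalso
    push_cast at hB
    have hkl0 : 0 < k * l := mul_pos hk hl
    obtain ⟨a, b, ha, rfl⟩ := pos_sq_split hkl0 hr hcB hAB
    have ha0 : a ≠ 0 := by rintro rfl; simp at ha; omega
    have hb0 : b ≠ 0 := by rintro rfl; nlinarith [mul_pos p1 p2]
    obtain ⟨K, L, hK, hL⟩ := pos_sq_split hk ha0 hc ha
    rcases int_split h3 c5 hB with ⟨k', hk', hkl', hck⟩ | ⟨l', hl', hkl', hcl⟩
    · push_cast at hk'
      obtain ⟨M, N, hM, hN⟩ := pos_sq_split (by linarith) hb0 hck hkl'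
      have : (3 : ℤ) ∣ N ^ 2 + K ^ 2 := by
        have : N ^ 2 + K ^ 2 = 3 * (K ^ 2 - k') := by linarith
        exact ⟨_, this⟩
      obtain ⟨h5, h6⟩ := three_sq_sum this
      refine not_both_dvd c2 not_unit_three ?_ ?_
      · rw [hK]; exact dvd_pow h6 two_ne_zero
      · rw [hN]; exact dvd_pow h5 two_ne_zero
    · push_cast at hl'
      have : (3 : ℤ) ∣ K ^ 2 + L ^ 2 := ⟨l', by linarith⟩
      obtain ⟨h5, h6⟩ := three_sq_sum this
      refine not_both_dvd hc not_unit_three ?_ ?_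
      · rw [hK]; exact dvd_pow h5 two_ne_zero
      · rw [hL]; exact dvd_pow h6 two_ne_zero

theorem pyth_step {p q s r : ℤ} (hp : 0 < p) (hq : 0 < q) (hpo : Odd p) (hc : IsCoprime p q) (hs : p ^ 2 + q ^ 2 = s ^ 2)
    (h : p * q = 6 * r ^ 2) (hr : r ≠ 0) :
    ∃ K L M N : ℤ, N ^ 2 = K ^ 2 + 3 * L ^ 2 ∧ M ^ 2 = K ^ 2 - 3 * L ^ 2 ∧ IsCoprime N M ∧ Odd N ∧ Odd M ∧ L ≠ 0 ∧ L ∣ r := by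
  have hpt : PythagoreanTriple p q |s| := by
    unfold PythagoreanTriple; rw [abs_mul_abs_self]; linarith
  have hs0 : 0 < |s| := by
    rw [abs_pos]; rintro rfl; nlinarith [mul_pos hp hp, mul_pos hq hq]
  obtain ⟨k, l, h1, h2, -, h4, h5, h6⟩ := hpt.coprime_classification' (Int.isCoprime_iff_gcd_eq_one.mp hc)
    (Int.odd_iff.mp hpo) hs0
  have hkl : 0 < k * l := by nlinarith
  have hk : 0 < k := lt_of_le_of_ne h6 (by rintro rfl; simp at hkl)
  have hl : 0 < l := (pos_iff_pos_of_mul_pos hkl).mp hk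
  refine kl_step (k := k) (l := l) hl (by nlinarith) (Int.isCoprime_iff_gcd_eq_one.mpr h4) ?_ ?_ hr
  · rw [Int.odd_iff]; omega
  · rw [h1, h2] at h; nlinarith

theorem desc_step {x y s r : ℤ} (h1 : x ^ 2 = s ^ 2 + 3 * r ^ 2) (h2 : y ^ 2 = s ^ 2 - 3 * r ^ 2) (hc : IsCoprime x y)
    (hx : Odd x) (hy : Odd y) (hr : r ≠ 0) :
    ∃ K L M N : ℤ, N ^ 2 = K ^ 2 + 3 * L ^ 2 ∧ M ^ 2 = K ^ 2 - 3 * L ^ 2 ∧ IsCoprime N M ∧ Odd N ∧ Odd M ∧ L ≠ 0 ∧ L.natAbs < r.natAbs := by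
  wlog hx0 : 0 < x generalizing x with H1
  · have : x ≠ 0 := by rintro rfl; simp at hx
    exact H1 (x := -x) (by rw [← h1]; ring) hc.neg_left hx.neg (by omega)
  wlog hy0 : 0 < y generalizing y with H2
  · have : y ≠ 0 := by rintro rfl; simp at hy
    exact H2 (y := -y) (by rw [← h2]; ring) hy.neg hc.neg_right (by omega)
  have hr2 : 0 < r ^ 2 := by positivity
  have hxy : y < x := by nlinarith
  obtain ⟨p, hp⟩ := hx.add_odd hy
  set q := x - p with hq
  have ex : x = p + q := by omega
  have ey : y = p - q := by omega
  have hpq : IsCoprime p q := cop_half hc ex ey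
  have e1 : p ^ 2 + q ^ 2 = s ^ 2 := by rw [ex] at h1; rw [ey] at h2; nlinarith
  have e2 : 2 * (p * q) = 3 * r ^ 2 := by rw [ex] at h1; rw [ey] at h2; nlinarith
  have hre : Even r := by
    by_contra hre
    rw [Int.not_even_iff_odd] at hre
    have : Odd (3 * r ^ 2) := (by decide : Odd (3 : ℤ)).mul hre.pow
    rw [← e2] at this
    exact (Int.not_odd_iff_even.mpr (even_two_mul _)) this
  obtain ⟨r', hr'⟩ := hre
  have hr0' : r' ≠ 0 := by rintro rfl; simp at hr'; exact hr hr'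
  have e3 : p * q = 6 * r' ^ 2 := by rw [hr'] at e2; nlinarith
  have hp0 : 0 < p := by omega
  have hq0 : 0 < q := by omega
  have fin : ∀ L : ℤ, L ≠ 0 → L ∣ r' → L.natAbs < r.natAbs := by
    intro L hL hd
    have := Nat.le_of_dvd (by omega) (Int.natAbs_dvd_natAbs.mpr hd)
    omega
  have hxo : Odd (p + q) := by rw [← ex]; exact hx
  rcases Int.even_or_odd p with hpe | hpo
  · have hqo : Odd q := by rw [Int.odd_add'] at hxo; exact hxo.mpr hpe
    obtain ⟨K, L, M, N, a1, a2, a3, a4, a5, a6, a7⟩ := pyth_step hq0 hp0 hqo hpq.symm (by rw [← e1]; ring) (by rw [← e3]; ring) hr0'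
    exact ⟨K, L, M, N, a1, a2, a3, a4, a5, a6, fin L a6 a7⟩
  · obtain ⟨K, L, M, N, a1, a2, a3, a4, a5, a6, a7⟩ := pyth_step hp0 hq0 hpo hpq e1 e3 hr0'
    exact ⟨K, L, M, N, a1, a2, a3, a4, a5, a6, fin L a6 a7⟩

theorem desc_main (n : ℕ) : ∀ {x y s r : ℤ}, r.natAbs = n → x ^ 2 = s ^ 2 + 3 * r ^ 2 → y ^ 2 = s ^ 2 - 3 * r ^ 2 →
    IsCoprime x y → Odd x → Odd y → r ≠ 0 → False := by
  induction n using Nat.strong_induction_on with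
  | _ n ih =>
    intro x y s r hn h1 h2 hc hx hy hr
    obtain ⟨K, L, M, N, a1, a2, a3, a4, a5, a6, a7⟩ := desc_step h1 h2 hc hx hy hr
    exact ih L.natAbs (by omega) rfl a1 a2 a3 a4 a5 a6

theorem four_four {x y z : ℤ} (hx : Odd x) (hy : Odd y) (hc : IsCoprime x y) (hz : z ≠ 0)
    (h : x ^ 4 - y ^ 4 = 3 * z ^ 2) : False := by
  obtain ⟨A, hA⟩ := (hx.pow (n := 2)).add_odd (hy.pow (n := 2))
  set B := x ^ 2 - A with hB
  have ex : x ^ 2 = A + B := by omega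
  have ey : y ^ 2 = A - B := by omega
  have hAB : IsCoprime A B := cop_half (hc.pow (m := 2) (n := 2)) ex ey
  have e1 : 4 * (A * B) = 3 * z ^ 2 := by
    rw [← h]; linear_combination (-(x ^ 2) - A - B) * ex + (y ^ 2 + A - B) * ey
  have hze : Even z := by
    by_contra hre
    rw [Int.not_even_iff_odd] at hre
    have : Odd (3 * z ^ 2) := (by decide : Odd (3 : ℤ)).mul hre.pow
    rw [← e1] at this
    exact (Int.not_odd_iff_even.mpr ⟨2 * (A * B), by ring⟩) this
  obtain ⟨w, hw⟩ := hze
  have hw0 : w ≠ 0 := by rintro rfl; simp at hw; exact hz hw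
  have e2 : A * B = (3 : ℕ) * w ^ 2 := by rw [hw] at e1; push_cast; nlinarith
  have hA0 : 0 < A := by
    have hx0 : x ≠ 0 := by rintro rfl; simp at hx
    have : 0 < x ^ 2 := by positivity
    nlinarith [sq_nonneg y]
  rcases int_split Nat.prime_three.isPrimePow hAB e2 with ⟨A', h1, -, -⟩ | ⟨B', h1, h2, h3⟩
  · push_cast at h1
    have : (3 : ℤ) ∣ x ^ 2 + y ^ 2 := ⟨2 * A', by linarith⟩
    obtain ⟨h5, h6⟩ := three_sq_sum this
    exact not_both_dvd hc not_unit_three h5 h6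
  · push_cast at h1
    obtain ⟨s, r, hs, hr⟩ := pos_sq_split hA0 hw0 h3 h2
    refine desc_main _ (x := x) (y := y) (s := s) (r := r) rfl (by linarith) (by linarith) hc hx hy ?_
    rintro rfl
    rw [hr] at h2; simp at h2; exact hw0 (pow_eq_zero_iff two_ne_zero |>.mp h2.symm)
end Desc


section Chain

theorem six_mod_nine {b : ℤ} (h : ¬ (3 : ℤ) ∣ b) : b ^ 6 % 9 = 1 := by
  have h1 : b % 9 = 1 ∨ b % 9 = 2 ∨ b % 9 = 4 ∨ b % 9 = 5 ∨ b % 9 = 7 ∨ b % 9 = 8 := by omega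
  have h2 : b ^ 6 % 9 = (b % 9) ^ 6 % 9 := (Int.ModEq.pow 6 (Int.mod_modEq b 9)).symm
  rw [h2]
  rcases h1 with h1 | h1 | h1 | h1 | h1 | h1 <;> simp [h1]

theorem six_mod_nine' {b : ℤ} (h : ¬ (3 : ℤ) ∣ b) (n : ℕ) : b ^ (6 * n) % 9 = 1 := by
  rw [pow_mul]
  have h1 : b ^ 6 ≡ 1 [ZMOD 9] := six_mod_nine h
  have := h1.pow n
  rw [one_pow] at this
  exact this

theorem cube_mod_nine {b : ℤ} (h : ¬ (3 : ℤ) ∣ b) : b ^ 3 % 9 = 1 ∨ b ^ 3 % 9 = 8 := by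
  have h1 : b % 9 = 1 ∨ b % 9 = 2 ∨ b % 9 = 4 ∨ b % 9 = 5 ∨ b % 9 = 7 ∨ b % 9 = 8 := by omega
  have h2 : b ^ 3 % 9 = (b % 9) ^ 3 % 9 := (Int.ModEq.pow 3 (Int.mod_modEq b 9)).symm
  rw [h2]
  rcases h1 with h1 | h1 | h1 | h1 | h1 | h1 <;> simp [h1]

theorem pos_pow_split {A B w : ℤ} {n : ℕ} (hA : 0 < A) (hB : 0 < B) (hc : IsCoprime A B) (h : A * B = w ^ n) :
    ∃ a b : ℤ, A = a ^ n ∧ B = b ^ n := by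
  obtain ⟨a, -, ha⟩ := int_pow_nonneg hA.le hc h
  obtain ⟨b, -, hb⟩ := int_pow_nonneg hB.le hc.symm ((mul_comm _ _).trans h)
  exact ⟨a, b, ha, hb⟩

theorem pos_of_nat_mul {q : ℕ} {A A' : ℤ} (hA : 0 < A) (h : A = q * A') : 0 < A' := by
  rw [h] at hA
  exact pos_of_mul_pos_right hA (by positivity)

theorem split_two {α γ : ℕ} (hα : IsPrimePow α) (hγ : IsPrimePow γ) {A B r : ℤ} {n : ℕ} (hA : 0 < A) (hB : 0 < B)
    (hc : IsCoprime A B) (h : A * B = α * (γ * r ^ n)) :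
    ∃ a b : ℤ, (A = α * γ * a ^ n ∧ B = b ^ n) ∨ (A = α * a ^ n ∧ B = γ * b ^ n) ∨ (A = γ * a ^ n ∧ B = α * b ^ n) ∨
      (A = a ^ n ∧ B = α * γ * b ^ n) := by
  rcases int_split hα hc h with ⟨A1, h1, h2, h3⟩ | ⟨B1, h1, h2, h3⟩
  · have hA1 := pos_of_nat_mul hA h1
    rcases int_split hγ h3 h2 with ⟨A2, h4, h5, h6⟩ | ⟨B2, h4, h5, h6⟩
    · obtain ⟨a, b, rfl, rfl⟩ := pos_pow_split (pos_of_nat_mul hA1 h4) hB h6 h5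
      exact ⟨a, b, Or.inl ⟨by rw [h1, h4]; ring, rfl⟩⟩
    · obtain ⟨a, b, rfl, rfl⟩ := pos_pow_split hA1 (pos_of_nat_mul hB h4) h6 h5
      exact ⟨a, b, Or.inr (Or.inl ⟨h1, h4⟩)⟩
  · have hB1 := pos_of_nat_mul hB h1
    rcases int_split hγ h3 h2 with ⟨A2, h4, h5, h6⟩ | ⟨B2, h4, h5, h6⟩
    · obtain ⟨a, b, rfl, rfl⟩ := pos_pow_split (pos_of_nat_mul hA h4) hB1 h6 h5
      exact ⟨a, b, Or.inr (Or.inr (Or.inl ⟨h4, h1⟩))⟩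
    · obtain ⟨a, b, rfl, rfl⟩ := pos_pow_split hA (pos_of_nat_mul hB1 h4) h6 h5
      exact ⟨a, b, Or.inr (Or.inr (Or.inr ⟨rfl, by rw [h1, h4]; ring⟩))⟩

theorem split27 {α γ : ℕ} (hα : IsPrimePow α) (hγ : IsPrimePow γ) {A B r : ℤ} {n : ℕ} (hA : 0 < A) (hB : 0 < B)
    (hc : IsCoprime A B) (h : A * B = 27 * (α * (γ * r ^ n))) :
    ∃ A' B', A' + B' = A + B ∧ IsCoprime A' B' ∧ ((A' = A ∧ B' = B) ∨ (A' = B ∧ B' = A)) ∧ ¬ (3 : ℤ) ∣ B' ∧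
      ∃ a b : ℤ, (A' = 27 * (α * γ * a ^ n) ∧ B' = b ^ n) ∨ (A' = 27 * (α * a ^ n) ∧ B' = γ * b ^ n) ∨
        (A' = 27 * (γ * a ^ n) ∧ B' = α * b ^ n) ∨ (A' = 27 * a ^ n ∧ B' = α * γ * b ^ n) := by
  wlog H : ∃ A1, A = 27 * A1 ∧ A1 * B = α * (γ * r ^ n) ∧ IsCoprime A1 B generalizing A B with HH
  · have h27 : IsPrimePow 27 := by
      have := Nat.prime_three.isPrimePow.pow (three_ne_zero)
      simpa using this
    rcases int_split h27 hc (by push_cast; exact h) with ⟨A1, h1, h2, h3⟩ | ⟨B1, h1, h2, h3⟩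
    · exact absurd ⟨A1, by push_cast at h1; exact h1, h2, h3⟩ H
    · obtain ⟨A', B', e1, e2, e3, e4⟩ := HH hB hA hc.symm (by rw [mul_comm, h]) ⟨B1, by push_cast at h1; exact h1, by rw [mul_comm, h2], h3.symm⟩
      exact ⟨A', B', by rw [e1, add_comm], e2, e3.symm, e4⟩
  obtain ⟨A1, h1, h2, h3⟩ := H
  obtain ⟨a, b, hab⟩ := split_two hα hγ (by omega) hB h3 h2
  refine ⟨A, B, rfl, hc, Or.inl ⟨rfl, rfl⟩, ?_, a, b, ?_⟩
  · intro h4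
    exact not_both_dvd hc not_unit_three ⟨9 * A1, by rw [h1]; ring⟩ h4
  · rcases hab with ⟨e1, e2⟩ | ⟨e1, e2⟩ | ⟨e1, e2⟩ | ⟨e1, e2⟩
    · exact Or.inl ⟨by rw [h1, e1], e2⟩
    · exact Or.inr (Or.inl ⟨by rw [h1, e1], e2⟩)
    · exact Or.inr (Or.inr (Or.inl ⟨by rw [h1, e1], e2⟩))
    · exact Or.inr (Or.inr (Or.inr ⟨by rw [h1, e1], e2⟩))

theorem cop_of_add {A B : ℤ} (h : IsCoprime (A + B) (A * B)) : IsCoprime A B := by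
  have := h.of_mul_right_left
  obtain ⟨s, t, h⟩ := this
  exact ⟨s + t, s, by rw [← h]; ring⟩

theorem pos_of_add {A B : ℤ} (h : 0 < A + B) (h2 : 0 < A * B) : 0 < A ∧ 0 < B := by
  rcases pos_and_pos_or_neg_and_neg_of_mul_pos h2 with h3 | h3
  · exact h3
  · omega

theorem E_dvd_five {y δ : ℤ} (h : (5 : ℤ) ∣ y ^ 2 + 3 * δ * y + 3 * δ ^ 2) : (5 : ℤ) ∣ y ∧ (5 : ℤ) ∣ δ := by
  have h1 : y % 5 = 0 ∨ y % 5 = 1 ∨ y % 5 = 2 ∨ y % 5 = 3 ∨ y % 5 = 4 := by omega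
  have h2 : δ % 5 = 0 ∨ δ % 5 = 1 ∨ δ % 5 = 2 ∨ δ % 5 = 3 ∨ δ % 5 = 4 := by omega
  have h4 : (y ^ 2 + 3 * δ * y + 3 * δ ^ 2) % 5 = 0 := Int.emod_eq_zero_of_dvd h
  rcases h1 with h1 | h1 | h1 | h1 | h1 <;> rcases h2 with h2 | h2 | h2 | h2 | h2 <;>
    simp [pow_two, Int.add_emod, Int.mul_emod, h1, h2] at h4 <;> omega

theorem cube_split {γ e : ℕ} (hγ : γ = 5 ^ e) {x y w : ℤ} {n : ℕ} (hn : n ≠ 0) (hn2 : Even n) (hc : IsCoprime x y) (hy : ¬ (3 : ℤ) ∣ y) (hw : w ≠ 0)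
    (he : e ≠ 0)
    (h : x ^ 3 - y ^ 3 = 27 * (16 * (γ * w ^ n))) :
    ∃ r s : ℤ, x - y = 9 * 16 * γ * r ^ n ∧ x ^ 2 + x * y + y ^ 2 = 3 * s ^ n ∧ 0 < s ∧ ¬ (2 : ℤ) ∣ s ∧ ¬ (3 : ℤ) ∣ s ∧ ¬ (5 : ℤ) ∣ s ∧
      IsCoprime s r ∧ r ≠ 0 := by
  have hxy : (3 : ℤ) ∣ x - y := by
    have h1 : (x ^ 3 - y ^ 3) % 3 = 0 := by rw [h]; omega
    have h2 : x % 3 = 0 ∨ x % 3 = 1 ∨ x % 3 = 2 := by omega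
    have h3 : y % 3 = 0 ∨ y % 3 = 1 ∨ y % 3 = 2 := by omega
    rcases h2 with h2 | h2 | h2 <;> rcases h3 with h3 | h3 | h3 <;>
      simp [pow_succ, Int.sub_emod, Int.mul_emod, h2, h3] at h1 <;> omega
  obtain ⟨δ, hδ⟩ := hxy
  obtain rfl : x = y + 3 * δ := by linarith
  set E := y ^ 2 + 3 * δ * y + 3 * δ ^ 2 with hE
  have hδy : IsCoprime δ y := by
    obtain ⟨a, b, hab⟩ := hc
    exact ⟨3 * a, a + b, by rw [← hab]; ring⟩
  have hδE : IsCoprime δ E := by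
    have h1 := (hδy.pow_right (n := 2)).add_mul_left_right (3 * y + 3 * δ)
    have e1 : y ^ 2 + δ * (3 * y + 3 * δ) = E := by rw [hE]; ring
    rwa [e1] at h1
  have h1 : δ * E = (3 : ℕ) * ((16 : ℕ) * ((γ : ℕ) * w ^ n)) := by
    push_cast; rw [hE]; nlinarith
  have hE2 : ¬ (2 : ℤ) ∣ E := by
    intro h2
    have h3 := hδE.isUnit_of_dvd' (x := 2)
    rcases Int.even_or_odd δ with hd | hd
    · have := h3 hd.two_dvd h2
      rw [Int.isUnit_iff] at this; omega
    · obtain ⟨z, hz⟩ := hd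
      rcases Int.even_or_odd' y with ⟨z', hz' | hz'⟩ <;> rw [hE, hz, hz'] at h2 <;> ring_nf at h2 <;> omega
  have hE3 : ¬ (3 : ℤ) ∣ E := by
    intro h2
    refine hy (Int.prime_three.dvd_of_dvd_pow (n := 2) ?_)
    have : y ^ 2 = E - 3 * (δ * y + δ ^ 2) := by rw [hE]; ring
    rw [this]; exact dvd_sub h2 (Dvd.intro _ rfl)
  have hE5 : ¬ (5 : ℤ) ∣ E := by
    intro h2
    obtain ⟨h3, h4⟩ := E_dvd_five h2
    have := hδy.isUnit_of_dvd' h4 h3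
    rw [Int.isUnit_iff] at this; omega
  have hp16 : IsPrimePow 16 := by simpa using Nat.prime_two.isPrimePow.pow (four_ne_zero)
  have hpγ : IsPrimePow γ := by rw [hγ]; exact Nat.prime_five.isPrimePow.pow he
  obtain ⟨δ1, hd1, hd1', hd1''⟩ := (int_split Nat.prime_three.isPrimePow hδE h1).resolve_right (by
    rintro ⟨B', h2, -⟩; exact hE3 ⟨B', by exact_mod_cast h2⟩)
  obtain ⟨δ2, hd2, hd2', hd2''⟩ := (int_split hp16 hd1'' hd1').resolve_right (by
    rintro ⟨B', h2, -⟩; push_cast at h2; exact hE2 ⟨8 * B', by rw [h2]; ring⟩)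
  obtain ⟨δ3, hd3, hd3', hd3''⟩ := (int_split hpγ hd2'' hd2').resolve_right (by
    rintro ⟨B', h2, -⟩
    apply hE5; rw [h2, hγ]; push_cast
    exact Dvd.dvd.mul_right (dvd_pow_self _ he) _)
  have hE0 : 0 ≤ E := by rw [hE]; nlinarith [sq_nonneg (2 * y + 3 * δ), sq_nonneg δ]
  have hwn : 0 < w ^ n := hn2.pow_pos hw
  have hEp : 0 < E := lt_of_le_of_ne hE0 (by intro h0; rw [← h0] at hd3'; simp at hd3'; omega)
  have hδp : 0 < δ3 := by
    rw [← hd3'] at hwn; exact pos_of_mul_pos_left hwn hE0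
  obtain ⟨r, hr0, hr⟩ := int_pow_nonneg hδp.le hd3'' hd3'
  obtain ⟨s, hs0, hs⟩ := int_pow_nonneg hE0 hd3''.symm ((mul_comm _ _).trans hd3')
  refine ⟨r, s, ?_, ?_, ?_, ?_, ?_, ?_, ?_, ?_⟩
  · rw [← hr]; push_cast at hd1 hd2; rw [hd1, hd2, hd3]; ring
  · rw [← hs, hE]; ring
  · refine lt_of_le_of_ne hs0 ?_
    rintro rfl; rw [zero_pow hn] at hs; omega
  · intro h2; apply hE2; rw [hs]; exact dvd_pow h2 hn
  · intro h2; apply hE3; rw [hs]; exact dvd_pow h2 hn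
  · intro h2; apply hE5; rw [hs]; exact dvd_pow h2 hn
  · rw [hr, hs] at hd3''
    exact ((IsCoprime.pow_iff (Nat.pos_of_ne_zero hn) (Nat.pos_of_ne_zero hn)).mp hd3'').symm
  · rintro rfl; rw [zero_pow hn] at hr; omega

theorem cop_of_prime_not_dvd {p : ℕ} (hp : p.Prime) {s : ℤ} (h : ¬ (p : ℤ) ∣ s) : IsCoprime s (p : ℤ) :=
  ((Nat.prime_iff_prime_int.mp hp).irreducible.coprime_iff_not_dvd.mpr h).symm

theorem cop_thirty {s : ℤ} (h2 : ¬ (2 : ℤ) ∣ s) (h3 : ¬ (3 : ℤ) ∣ s) (h5 : ¬ (5 : ℤ) ∣ s) {a b c : ℕ} {z : ℤ} (hz : IsCoprime s z) :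
    IsCoprime s (2 ^ a * 3 ^ b * 5 ^ c * z) := by
  have e2 : IsCoprime s 2 := cop_of_prime_not_dvd Nat.prime_two (by exact_mod_cast h2)
  have e3 : IsCoprime s 3 := cop_of_prime_not_dvd Nat.prime_three (by exact_mod_cast h3)
  have e5 : IsCoprime s 5 := cop_of_prime_not_dvd Nat.prime_five (by exact_mod_cast h5)
  exact ((e2.pow_right.mul_right e3.pow_right).mul_right e5.pow_right).mul_right hz

/-- from a cube split to a product relation -/
theorem cube_split2 {e : ℕ} (he : e ≠ 0) {x y w : ℤ} {n : ℕ} (hn : n ≠ 0) (hc : IsCoprime x y) (hy : ¬ (3 : ℤ) ∣ y) (hw : w ≠ 0)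
    (h : x ^ 3 - y ^ 3 = 27 * (16 * ((5 ^ e : ℕ) * w ^ (2 * n)))) :
    ∃ A B r s : ℤ, 0 < A ∧ 0 < B ∧ IsCoprime A B ∧ A + B = s ^ n ∧ A * B = 27 * ((16 : ℕ) * ((5 ^ (2 * e) : ℕ) * r ^ (4 * n))) ∧
      0 < s ∧ ¬ (2 : ℤ) ∣ s ∧ ¬ (3 : ℤ) ∣ s ∧ ¬ (5 : ℤ) ∣ s ∧ IsCoprime s r ∧ r ≠ 0 := by
  obtain ⟨r, s, h1, h2, h3, h4, h5, h6, h7, h8⟩ := cube_split (γ := 5 ^ e) rfl (n := 2 * n) (by omega) (even_two_mul n) hc hy hw he h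
  set R : ℤ := 5 ^ e * r ^ (2 * n) with hR
  have h1' : x - y = 144 * R := by rw [h1, hR]; push_cast; ring
  obtain ⟨Y, hY⟩ : ∃ Y, x + y = 2 * Y := ⟨72 * R + y, by linarith⟩
  have h9 : (s ^ n) ^ 2 = Y ^ 2 + 4 * (432 * R ^ 2) := by
    rw [← pow_mul, mul_comm n]
    have : 4 * (x ^ 2 + x * y + y ^ 2) = 3 * (x + y) ^ 2 + (x - y) ^ 2 := by ring
    rw [h1', hY, h2] at this
    linarith
  have hso : Odd (s ^ n) := by
    apply Odd.pow; rw [← Int.not_even_iff_odd]; intro h; exact h4 h.two_dvd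
  have hYo : Odd Y := by
    have : Odd (Y ^ 2) := by
      have e1 : Y ^ 2 = (s ^ n) ^ 2 - 2 * (864 * R ^ 2) := by linarith
      rw [e1]; exact (hso.pow).sub_even (even_two_mul _)
    exact (Int.odd_pow.mp this).resolve_right two_ne_zero
  obtain ⟨A, hA⟩ := hso.sub_odd hYo
  set B := s ^ n - A with hB
  have e1 : A + B = s ^ n := by omega
  have e2 : B - A = Y := by omega
  have e3 : A * B = 432 * R ^ 2 := by
    have : 4 * (A * B) = (A + B) ^ 2 - (B - A) ^ 2 := by ring
    rw [e1, e2, h9] at this; linarith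
  have e4 : A * B = 27 * ((16 : ℕ) * ((5 ^ (2 * e) : ℕ) * r ^ (4 * n))) := by
    rw [e3, hR]; push_cast; ring
  have hcop : IsCoprime A B := by
    apply cop_of_add
    rw [e1, e4]
    have := (cop_thirty h4 h5 h6 (h7.pow_right (n := 4 * n)) (a := 4) (b := 3) (c := 2 * e)).pow_left (m := n)
    convert this using 1
    push_cast; ring
  have hR0 : R ≠ 0 := by rw [hR]; positivity
  obtain ⟨hA0, hB0⟩ := pos_of_add (A := A) (B := B) (by rw [e1]; positivity) (by rw [e3]; positivity)
  exact ⟨A, B, r, s, hA0, hB0, hcop, e1, e4, h3, h4, h5, h6, h7, h8⟩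
end Chain


section Chain2

theorem pp16 : IsPrimePow 16 := by simpa using Nat.prime_two.isPrimePow.pow (four_ne_zero)
theorem pp4 : IsPrimePow 4 := by simpa using Nat.prime_two.isPrimePow.pow (two_ne_zero)
theorem pp5 {e : ℕ} (he : e ≠ 0) : IsPrimePow (5 ^ e) := Nat.prime_five.isPrimePow.pow he

theorem not_dvd_pow {b q : ℤ} {n : ℕ} (hn : n ≠ 0) (h : ¬ q ∣ b ^ n) : ¬ q ∣ b := fun h1 => h (dvd_pow h1 hn)
theorem not_dvd_mul {b q z : ℤ} (h : ¬ q ∣ z * b) : ¬ q ∣ b := fun h1 => h (Dvd.dvd.mul_left h1 z)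

theorem chain1 {x y w : ℤ} (hc : IsCoprime x y) (hy : ¬ (3 : ℤ) ∣ y) (hw : w ≠ 0)
    (h : x ^ 3 - y ^ 3 = 2160 * w ^ 6) :
    ∃ s b a : ℤ, s ^ 3 - (b ^ 4) ^ 3 = 27 * (16 * ((5 ^ 2 : ℕ) * a ^ (2 * 6))) ∧ IsCoprime s (b ^ 4) ∧ ¬ (3 : ℤ) ∣ b ^ 4 ∧ a ≠ 0 := by
  obtain ⟨A, B, r, s, hA, hB, hAB, hs, hm, hs0, h2, h3, h5, hsr, hr⟩ :=
    cube_split2 (e := 1) one_ne_zero (n := 3) three_ne_zero hc hy hw (by rw [h]; push_cast; ring)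
  obtain ⟨A', B', e1, e2, e3, e4, a, b, hab⟩ := split27 pp16 (pp5 (e := 2 * 1) (by norm_num)) hA hB hAB hm
  have e5 := cube_mod_nine h3
  rw [← hs, ← e1] at e5
  have hab0 : A' ≠ 0 := by rcases e3 with ⟨h, -⟩ | ⟨h, -⟩ <;> rw [h] <;> omega
  norm_num at hab
  rcases hab with ⟨ha, hb⟩ | ⟨ha, hb⟩ | ⟨ha, hb⟩ | ⟨ha, hb⟩
  · refine ⟨s, b, a, ?_, ?_, ?_, ?_⟩
    · rw [← hs, ← e1, ha, hb]; push_cast; ring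
    · have h7 : IsCoprime (s ^ 3) (b ^ 12) := by
        rw [← hs, ← e1, ← hb]
        simpa using e2.add_mul_right_left 1
      exact ((IsCoprime.pow_iff (by norm_num) (by norm_num)).mp h7).pow_right
    · intro h7
      apply e4; rw [hb]
      exact dvd_pow (Int.prime_three.dvd_of_dvd_pow h7) (by norm_num)
    · rintro rfl; apply hab0; rw [ha]; simp
  · exfalso
    have h6 := six_mod_nine' (not_dvd_pow (by norm_num) (not_dvd_mul (hb ▸ e4))) 2
    norm_num at h6; omega
  · exfalso
    have h6 := six_mod_nine' (not_dvd_pow (by norm_num) (not_dvd_mul (hb ▸ e4))) 2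
    norm_num at h6; omega
  · exfalso
    have h6 := six_mod_nine' (not_dvd_pow (by norm_num) (not_dvd_mul (hb ▸ e4))) 2
    norm_num at h6; omega

theorem sq_mod_five {s : ℤ} (h : ¬ (5 : ℤ) ∣ s) : s ^ 6 % 5 = 1 ∨ s ^ 6 % 5 = 4 := by
  have h1 : s % 5 = 1 ∨ s % 5 = 2 ∨ s % 5 = 3 ∨ s % 5 = 4 := by omega
  have h2 : s ^ 6 % 5 = (s % 5) ^ 6 % 5 := (Int.ModEq.pow 6 (Int.mod_modEq s 5)).symm
  rw [h2]
  rcases h1 with h1 | h1 | h1 | h1 <;> simp [h1]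

theorem pow24_mod_five (s : ℤ) : s ^ 24 % 5 = 0 ∨ s ^ 24 % 5 = 1 := by
  have h1 : s % 5 = 0 ∨ s % 5 = 1 ∨ s % 5 = 2 ∨ s % 5 = 3 ∨ s % 5 = 4 := by omega
  have h2 : s ^ 24 % 5 = (s % 5) ^ 24 % 5 := (Int.ModEq.pow 24 (Int.mod_modEq s 5)).symm
  rw [h2]
  rcases h1 with h1 | h1 | h1 | h1 | h1 <;> simp [h1]

theorem chain2 {x y w : ℤ} (hc : IsCoprime x y) (hy : ¬ (3 : ℤ) ∣ y) (hw : w ≠ 0)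
    (h : x ^ 3 - y ^ 3 = 27 * (16 * ((5 ^ 2 : ℕ) * w ^ (2 * 6)))) :
    ∃ s b a : ℤ, s ^ 6 - b ^ 24 = 270000 * a ^ 24 ∧ IsCoprime s b ∧ ¬ (3 : ℤ) ∣ s ∧ Odd s ∧ 0 < s ∧ a ≠ 0 := by
  obtain ⟨A, B, r, s, hA, hB, hAB, hs, hm, hs0, h2, h3, h5, hsr, hr⟩ :=
    cube_split2 (e := 2) two_ne_zero (n := 6) (by norm_num) hc hy hw h
  obtain ⟨A', B', e1, e2, e3, e4, a, b, hab⟩ := split27 pp16 (pp5 (e := 2 * 2) (by norm_num)) hA hB hAB hm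
  have e5 := six_mod_nine h3
  have e6 := sq_mod_five h5
  rw [← hs, ← e1] at e5 e6
  have hab0 : A' ≠ 0 := by rcases e3 with ⟨h, -⟩ | ⟨h, -⟩ <;> rw [h] <;> omega
  norm_num at hab
  rcases hab with ⟨ha, hb⟩ | ⟨ha, hb⟩ | ⟨ha, hb⟩ | ⟨ha, hb⟩
  · refine ⟨s, b, a, ?_, ?_, h3, ?_, hs0, ?_⟩
    · rw [← hs, ← e1, ha, hb]; ring
    · have h7 : IsCoprime (s ^ 6) (b ^ 24) := by
        rw [← hs, ← e1, ← hb]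
        simpa using e2.add_mul_right_left 1
      exact ((IsCoprime.pow_iff (by norm_num) (by norm_num)).mp h7)
    · rw [← Int.not_even_iff_odd]; intro h; exact h2 h.two_dvd
    · rintro rfl; apply hab0; rw [ha]; simp
  · exfalso
    have h6 := six_mod_nine' (not_dvd_pow (by norm_num) (not_dvd_mul (hb ▸ e4))) 4
    norm_num at h6; omega
  · exfalso
    have h6 := six_mod_nine' (not_dvd_pow (by norm_num) (not_dvd_mul (hb ▸ e4))) 4
    norm_num at h6; omega
  · exfalso
    have := pow24_mod_five a
    omega

theorem pow24_mod_four {b : ℤ} (hb : Odd b) (n : ℕ) : b ^ (2 * n) % 4 = 1 := by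
  have h2 : b ^ 2 ≡ 1 [ZMOD 4] := by
    obtain ⟨k, rfl⟩ := hb
    apply Int.ModEq.symm
    rw [Int.modEq_iff_dvd]; exact ⟨k ^ 2 + k, by ring⟩
  have := h2.pow n
  rw [one_pow, ← pow_mul] at this
  exact this

theorem chain3 {s b a : ℤ} (h : s ^ 6 - b ^ 24 = 270000 * a ^ 24) (hc : IsCoprime s b) (h3 : ¬ (3 : ℤ) ∣ s) (hso : Odd s)
    (hs0 : 0 < s) (ha : a ≠ 0) : False := by
  have hbo : Odd b := by
    have : Odd (b ^ 24) := by
      have e1 : b ^ 24 = s ^ 6 - 2 * (135000 * a ^ 24) := by linarith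
      rw [e1]; exact (hso.pow).sub_even (even_two_mul _)
    exact (Int.odd_pow.mp this).resolve_right (by norm_num)
  obtain ⟨B, hB⟩ := (hso.pow (n := 3)).add_odd (hbo.pow (n := 12))
  set A := s ^ 3 - B with hA
  have e1 : B + A = s ^ 3 := by omega
  have e2 : B - A = b ^ 12 := by omega
  have e3 : A * B = 27 * ((4 : ℕ) * ((5 ^ 4 : ℕ) * a ^ 24)) := by
    have : 4 * (A * B) = (B + A) ^ 2 - (B - A) ^ 2 := by ring
    rw [e1, e2] at this; push_cast; linarith
  have hcop : IsCoprime B A := cop_half (hc.pow (m := 3) (n := 12)) e1.symm e2.symm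
  have hab0 : 0 < A * B := by rw [e3]; positivity
  obtain ⟨hA0, hB0⟩ := pos_of_add (A := A) (B := B) (by rw [add_comm, e1]; positivity) hab0
  obtain ⟨A', B', f1, f2, f3, f4, α, β, hab⟩ := split27 pp4 (pp5 (e := 4) (by norm_num)) hA0 hB0 hcop.symm e3
  have e5 := cube_mod_nine h3
  have hab0 : A' ≠ 0 := by rcases f3 with ⟨h, -⟩ | ⟨h, -⟩ <;> rw [h] <;> omega
  rw [← e1, add_comm, ← f1] at e5
  norm_num at hab
  rcases hab with ⟨ha, hb⟩ | ⟨ha, hb⟩ | ⟨ha, hb⟩ | ⟨ha, hb⟩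
  · rcases f3 with ⟨g1, g2⟩ | ⟨g1, g2⟩
    · have hα : α ≠ 0 := by rintro rfl; apply hab0; rw [ha]; simp
      have hco : IsCoprime (β ^ 24) (b ^ 12) := by
        rw [← hb, g2, ← e2]
        have := hcop.neg_right.add_mul_left_right 1
        simpa [add_comm, sub_eq_add_neg] using this
      have hβo : Odd β := by
        have : Odd (β ^ 24) := by
          have e8 : β ^ 24 = b ^ 12 + 2 * (33750 * α ^ 24) := by
            rw [← e2, ← hb, g2, ← g1, ha]; ring
          rw [e8]; exact (hbo.pow).add_even (even_two_mul _)
        exact (Int.odd_pow.mp this).resolve_right (by norm_num)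
      refine four_four (x := β ^ 6) (y := b ^ 3) (z := 150 * α ^ 12) hβo.pow hbo.pow
        (((IsCoprime.pow_iff (by norm_num) (by norm_num)).mp hco).pow) (by positivity) ?_
      have : β ^ 24 - 67500 * α ^ 24 = b ^ 12 := by rw [← e2, ← hb, g2, ← g1, ha]; ring
      linear_combination this
    · have hβo : Odd β := by
        have : Odd (β ^ 24) := by
          have e8 : β ^ 24 = 2 * (33750 * α ^ 24) - b ^ 12 := by
            rw [← e2, ← hb, g2, ← g1, ha]; ring
          rw [e8]; exact (even_two_mul _).sub_odd (hbo.pow)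
        exact (Int.odd_pow.mp this).resolve_right (by norm_num)
      have m1 := pow24_mod_four hβo 12
      have m2 := pow24_mod_four hbo 6
      norm_num at m1 m2
      omega
  all_goals
    have h6 := six_mod_nine' (not_dvd_pow (by norm_num) (not_dvd_mul (hb ▸ f4))) 4
    norm_num at h6
    omega

theorem chain_all {x y w : ℤ} (hc : IsCoprime x y) (hy : ¬ (3 : ℤ) ∣ y) (hw : w ≠ 0)
    (h : x ^ 3 - y ^ 3 = 2160 * w ^ 6) : False := by
  obtain ⟨s, b, a, h1, h2, h3, h4⟩ := chain1 hc hy hw h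
  obtain ⟨s', b', a', h5, h6, h7, h8, h9, h10⟩ := chain2 h2 h3 h4 h1
  exact chain3 h5 h6 h7 h8 h9 h10
end Chain2


section GoldenRing

abbrev ZP := QuadraticAlgebra ℤ 1 1

theorem ZP_norm (z : ZP) : z.norm = z.re ^ 2 + z.re * z.im - z.im ^ 2 := by
  rw [QuadraticAlgebra.norm_def]; ring

theorem norm_form_zero {a b : ℤ} (h : a ^ 2 + a * b - b ^ 2 = 0) : a = 0 ∧ b = 0 := by
  have h1 : (2 * a + b) ^ 2 = 5 * b ^ 2 := by linarith
  by_cases hb : b = 0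
  · subst hb; simp at h; exact ⟨h, rfl⟩
  · exfalso
    have h2 : (((2 * a + b : ℤ) : ℚ) / b) ^ 2 = (5 : ℤ) := by
      have hb' : (b : ℚ) ≠ 0 := by exact_mod_cast hb
      rw [div_pow, div_eq_iff (pow_ne_zero 2 hb')]
      exact_mod_cast h1
    obtain ⟨Y, hY⟩ := rat_int_of_pow two_pos h2
    rw [hY] at h2
    have h3 : Y ^ 2 = 5 := by exact_mod_cast h2
    have h4 : Y ≤ 2 := by nlinarith
    have h5 : -2 ≤ Y := by nlinarith
    interval_cases Y <;> omega

theorem ZP_norm_zero {z : ZP} (h : z.norm = 0) : z = 0 := by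
  rw [ZP_norm] at h
  obtain ⟨h1, h2⟩ := norm_form_zero h
  exact QuadraticAlgebra.ext h1 h2

instance ZP_domain : IsDomain ZP := by
  have : NoZeroDivisors ZP := ⟨by
    intro x y h
    have h1 : x.norm * y.norm = 0 := by rw [← map_mul, h, QuadraticAlgebra.norm_zero]
    rcases mul_eq_zero.mp h1 with h2 | h2
    · exact Or.inl (ZP_norm_zero h2)
    · exact Or.inr (ZP_norm_zero h2)⟩
  exact NoZeroDivisors.to_isDomain ZP

theorem centered_div (A n : ℤ) (hn : n ≠ 0) : ∃ q, 2 * |A - q * n| ≤ |n| := by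
  refine ⟨round ((A : ℚ) / n), ?_⟩
  have h1 := abs_sub_round ((A : ℚ) / n)
  have hn' : (n : ℚ) ≠ 0 := by exact_mod_cast hn
  have h2 : |(A : ℚ) - round ((A : ℚ) / n) * n| = |(A : ℚ) / n - round ((A : ℚ) / n)| * |(n : ℚ)| := by
    rw [← abs_mul]; congr 1; field_simp
  have h3 : 2 * |(A : ℚ) - round ((A : ℚ) / n) * n| ≤ |(n : ℚ)| := by
    rw [h2]; nlinarith [abs_nonneg (n : ℚ)]
  exact_mod_cast h3

theorem ZP_div (x y : ZP) (hy : y ≠ 0) : ∃ q : ZP, |(x - q * y).norm| < |y.norm| := by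
  set n := y.norm with hn
  have hn0 : n ≠ 0 := fun h => hy (ZP_norm_zero h)
  obtain ⟨q1, h1⟩ := centered_div (x * star y).re n hn0
  obtain ⟨q2, h2⟩ := centered_div (x * star y).im n hn0
  refine ⟨⟨q1, q2⟩, ?_⟩
  set r1 := (x * star y).re - q1 * n with hr1
  set r2 := (x * star y).im - q2 * n with hr2
  have e1 : ((x - ⟨q1, q2⟩ * y) * star y) = ⟨r1, r2⟩ := by
    have := QuadraticAlgebra.algebraMap_norm_eq_mul_star y
    rw [sub_mul, mul_assoc, ← this, ← hn]
    ext <;> simp [hr1, hr2]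
  have e2 : (x - ⟨q1, q2⟩ * y).norm * n = r1 ^ 2 + r1 * r2 - r2 ^ 2 := by
    have := congrArg QuadraticAlgebra.norm e1
    rw [map_mul, QuadraticAlgebra.norm_star, ZP_norm ⟨r1, r2⟩] at this
    exact this
  have h3 : 2 * |r1 ^ 2 + r1 * r2 - r2 ^ 2| ≤ |n| ^ 2 := by
    have a1 : r1 * r2 ≤ |r1| * |r2| := by rw [← abs_mul]; exact le_abs_self _
    have a2 : -(|r1| * |r2|) ≤ r1 * r2 := by rw [← abs_mul]; exact neg_abs_le _
    have a3 : r1 ^ 2 = |r1| ^ 2 := (sq_abs r1).symm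
    have a4 : r2 ^ 2 = |r2| ^ 2 := (sq_abs r2).symm
    rw [a3, a4]
    have p1 := abs_nonneg r1
    have p2 := abs_nonneg r2
    have b1 : (2 * |r1|) * (2 * |r1|) ≤ |n| * |n| := by gcongr
    have b2 : (2 * |r2|) * (2 * |r2|) ≤ |n| * |n| := by gcongr
    have b3 : (2 * |r1|) * (2 * |r2|) ≤ |n| * |n| := by gcongr
    have : |(|r1| ^ 2 + r1 * r2 - |r2| ^ 2)| * 2 ≤ |n| ^ 2 := by
      rcases abs_cases (|r1| ^ 2 + r1 * r2 - |r2| ^ 2) with ⟨h, -⟩ | ⟨h, -⟩ <;> rw [h] <;> nlinarith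
    linarith
  rw [← e2, abs_mul] at h3
  have hnp : 0 < |n| := abs_pos.mpr hn0
  nlinarith

instance ZP_pid : IsPrincipalIdealRing ZP := ⟨by
  intro I
  by_cases hI : I = ⊥
  · rw [hI]; exact bot_isPrincipal
  obtain ⟨z0, hz0, hz0'⟩ := Submodule.exists_mem_ne_zero_of_ne_bot hI
  have hex : ∃ n : ℕ, ∃ z ∈ I, z ≠ 0 ∧ z.norm.natAbs = n := ⟨_, z0, hz0, hz0', rfl⟩
  classical
  obtain ⟨y, hyI, hy0, hyn⟩ := Nat.find_spec hex
  refine ⟨y, le_antisymm ?_ ?_⟩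
  · intro x hx
    obtain ⟨q, hq⟩ := ZP_div x y hy0
    have hr : x - q * y ∈ I := I.sub_mem hx (I.mul_mem_left q hyI)
    have hz : x - q * y = 0 := by
      by_contra hne
      refine Nat.find_min hex (m := (x - q * y).norm.natAbs) ?_ ⟨_, hr, hne, rfl⟩
      rw [← hyn]; zify; exact hq
    rw [sub_eq_zero] at hz
    exact Submodule.mem_span_singleton.mpr ⟨q, hz.symm⟩
  · rw [Submodule.span_singleton_le_iff_mem]; exact hyI⟩

def gφ : ZP := ⟨0, 1⟩
def gψ : ZP := ⟨-1, 1⟩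

theorem gφψ : gφ * gψ = 1 := by ext <;> simp [gφ, gψ, QuadraticAlgebra.re_one, QuadraticAlgebra.im_one]

/-- being a ninth power times a small power of the golden ratio -/
def NineP (z : ZP) : Prop := ∃ i : ℕ, ∃ v : ZP, z = gφ ^ i * v ^ 9

theorem NineP_mulφ {z : ZP} (h : NineP z) : NineP (gφ * z) := by
  obtain ⟨i, v, rfl⟩ := h
  exact ⟨i + 1, v, by ring⟩

theorem NineP_mulψ {z : ZP} (h : NineP z) : NineP (gψ * z) := by
  obtain ⟨i, v, rfl⟩ := h
  refine ⟨i + 8, gψ * v, ?_⟩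
  have : gφ ^ 8 * gψ ^ 9 = gψ := by
    calc gφ ^ 8 * gψ ^ 9 = (gφ * gψ) ^ 8 * gψ := by ring
      _ = gψ := by rw [gφψ]; ring
  calc gψ * (gφ ^ i * v ^ 9) = (gφ ^ 8 * gψ ^ 9) * (gφ ^ i * v ^ 9) := by rw [this]
    _ = _ := by ring

theorem NineP_of_φ {z : ZP} (h : NineP (gφ * z)) : NineP z := by
  have := NineP_mulψ h
  rwa [← mul_assoc, mul_comm gψ, gφψ, one_mul] at this

theorem NineP_of_ψ {z : ZP} (h : NineP (gψ * z)) : NineP z := by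
  have := NineP_mulφ h
  rwa [← mul_assoc, gφψ, one_mul] at this

theorem NineP_neg {z : ZP} (h : NineP z) : NineP (-z) := by
  obtain ⟨i, v, rfl⟩ := h
  exact ⟨i, -v, by ring⟩

theorem unit_NineP_aux (n : ℕ) : ∀ a b : ℤ, a.natAbs + b.natAbs = n → (a ^ 2 + a * b - b ^ 2 = 1 ∨ a ^ 2 + a * b - b ^ 2 = -1) →
    NineP ⟨a, b⟩ := by
  induction n using Nat.strong_induction_on with
  | _ n ih =>
    intro a b hn h
    wlog ha : 0 ≤ a generalizing a b with H
    · have := H (-a) (-b) (by omega) (by rcases h with h | h <;> [left; right] <;> linarith) (by omega)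
      have h2 := NineP_neg this
      simpa [QuadraticAlgebra.neg_mk] using h2
    rcases ha.lt_or_eq with ha | ha
    · rcases lt_trichotomy b 0 with hb | hb | hb
      · apply NineP_of_φ
        have e1 : gφ * (⟨a, b⟩ : ZP) = ⟨b, a + b⟩ := by ext <;> simp [gφ]
        rw [e1]
        have hab : 0 ≤ a + b := by
          by_contra hlt
          push Not at hlt
          rcases h with h | h <;> nlinarith
        exact ih _ (by omega) b (a + b) rfl (by rcases h with h | h <;> [right; left] <;> linarith)
      · subst hb
        have : a = 1 := by rcases h with h | h <;> nlinarith
        subst this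
        exact ⟨0, 1, by ext <;> simp [QuadraticAlgebra.re_one, QuadraticAlgebra.im_one]⟩
      · apply NineP_of_ψ
        have e1 : gψ * (⟨a, b⟩ : ZP) = ⟨b - a, a⟩ := by ext <;> simp [gψ] <;> ring
        rw [e1]
        have hab : 0 ≤ b - a := by
          by_contra hlt
          push Not at hlt
          rcases h with h | h <;> nlinarith
        exact ih _ (by omega) (b - a) a rfl (by rcases h with h | h <;> [right; left] <;> linarith)
    · subst ha
      have : b = 1 ∨ b = -1 := by
        rcases h with h | h
        · nlinarith
        · have : (b - 1) * (b + 1) = 0 := by linarith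
          rcases mul_eq_zero.mp this with h | h <;> omega
      rcases this with rfl | rfl
      · exact ⟨1, 1, by ext <;> simp [gφ]⟩
      · exact ⟨1, -1, by rw [Odd.neg_one_pow (by decide)]; ext <;> simp [gφ, QuadraticAlgebra.re_one, QuadraticAlgebra.im_one]⟩

theorem unit_NineP {u : ZP} (hu : IsUnit u) : NineP u := by
  have h1 := QuadraticAlgebra.isUnit_iff_norm_isUnit.mp hu
  rw [Int.isUnit_iff, ZP_norm] at h1
  exact unit_NineP_aux _ u.re u.im rfl h1

theorem cop_of_add' {R : Type*} [CommRing R] {A B : R} (h : IsCoprime (A + B) (A * B)) : IsCoprime A B := by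
  have := h.of_mul_right_left
  obtain ⟨s, t, h⟩ := this
  exact ⟨s + t, s, by rw [← h]; ring⟩

theorem ZP_nine {x y e : ℤ} (h : x ^ 2 + x * y - y ^ 2 = e ^ 9) (hc : IsCoprime (2 * x + y) (e ^ 9)) :
    ∃ i < 9, ∃ v : ZP, (⟨x, y⟩ : ZP) = gφ ^ i * v ^ 9 := by
  set z : ZP := ⟨x, y⟩ with hz
  have hn : z * star z = (e : ZP) ^ 9 := by
    rw [← QuadraticAlgebra.algebraMap_norm_eq_mul_star, ZP_norm]
    simp only [hz, h]
    simp
  have ht : z + star z = ((2 * x + y : ℤ) : ZP) := by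
    ext
    · rw [QuadraticAlgebra.re_intCast, QuadraticAlgebra.re_add, QuadraticAlgebra.re_star]
      simp only [hz, Int.cast_id]; ring
    · rw [QuadraticAlgebra.im_intCast, QuadraticAlgebra.im_add, QuadraticAlgebra.im_star]
      simp only [hz]; ring
  have hcop : IsCoprime z (star z) := by
    apply cop_of_add'
    rw [ht, hn]
    have := hc.map (Int.castRingHom ZP)
    simpa using this
  obtain ⟨w, u, hu⟩ := exists_associated_pow_of_mul_eq_pow' hcop hn
  obtain ⟨i, v, hv⟩ := unit_NineP u.isUnit
  refine ⟨i % 9, Nat.mod_lt _ (by norm_num), gφ ^ (i / 9) * v * w, ?_⟩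
  rw [← hu, hv]
  conv_lhs => rw [← Nat.mod_add_div i 9]
  rw [pow_add, pow_mul]
  ring
end GoldenRing


section Nonic

theorem cop_lin {x y l n : ℤ} (h : IsCoprime x y) (hx : ∃ s t, x = s * l + t * n) (hy : ∃ s t, y = s * l + t * n) : IsCoprime l n := by
  obtain ⟨u, v, h⟩ := h
  obtain ⟨s, t, rfl⟩ := hx
  obtain ⟨s', t', rfl⟩ := hy
  exact ⟨u * s + v * s', u * t + v * t', by linear_combination h⟩

theorem cop_eq_r {a b b' : ℤ} (h : IsCoprime a b) (e : b' = b) : IsCoprime a b' := e ▸ h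
theorem cop_eq_l {a b a' : ℤ} (h : IsCoprime a b) (e : a' = a) : IsCoprime a' b := e ▸ h

theorem ZP_cube (a b : ℤ) : (⟨a, b⟩ : ZP) ^ 3 = ⟨a ^ 3 + 3 * a * b ^ 2 + b ^ 3, 3 * a ^ 2 * b + 3 * a * b ^ 2 + 2 * b ^ 3⟩ := by
  rw [pow_succ, pow_two]
  ext <;> simp <;> ring

theorem gφ_mul (a b : ℤ) : gφ * (⟨a, b⟩ : ZP) = ⟨b, a + b⟩ := by ext <;> simp [gφ]

theorem im_even (a b : ℤ) : (3 * a ^ 2 * b + 3 * a * b ^ 2 + 2 * b ^ 3) % 2 = 0 := by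
  have h1 : a % 2 = 0 ∨ a % 2 = 1 := by omega
  have h2 : b % 2 = 0 ∨ b % 2 = 1 := by omega
  rcases h1 with h1 | h1 <;> rcases h2 with h2 | h2 <;> simp [Int.add_emod, Int.mul_emod, pow_succ, h1, h2]

/-- The exponent of the golden ratio is a multiple of three. -/
theorem exp_three {x y : ℤ} (hx : x % 2 = 1) (hy : y % 2 = 0) {i : ℕ} (hi : i < 9) {v : ZP}
    (h : (⟨x, y⟩ : ZP) = gφ ^ i * v ^ 9) : ∃ i' < 3, i = 3 * i' := by
  obtain ⟨a, b⟩ := v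
  rw [show (9 : ℕ) = 3 * 3 from rfl, pow_mul, ZP_cube, ZP_cube] at h
  have he := im_even (a ^ 3 + 3 * a * b ^ 2 + b ^ 3) (3 * a ^ 2 * b + 3 * a * b ^ 2 + 2 * b ^ 3)
  generalize 3 * (a ^ 3 + 3 * a * b ^ 2 + b ^ 3) ^ 2 * (3 * a ^ 2 * b + 3 * a * b ^ 2 + 2 * b ^ 3) + 3 * (a ^ 3 + 3 * a * b ^ 2 + b ^ 3) * (3 * a ^ 2 * b + 3 * a * b ^ 2 + 2 * b ^ 3) ^ 2 + 2 * (3 * a ^ 2 * b + 3 * a * b ^ 2 + 2 * b ^ 3) ^ 3 = D at h he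
  generalize (a ^ 3 + 3 * a * b ^ 2 + b ^ 3) ^ 3 + 3 * (a ^ 3 + 3 * a * b ^ 2 + b ^ 3) * (3 * a ^ 2 * b + 3 * a * b ^ 2 + 2 * b ^ 3) ^ 2 + (3 * a ^ 2 * b + 3 * a * b ^ 2 + 2 * b ^ 3) ^ 3 = C at h
  interval_cases i
  · exact ⟨0, by norm_num, rfl⟩
  · simp only [pow_succ, pow_zero, one_mul, mul_assoc, gφ_mul, QuadraticAlgebra.mk.injEq] at h; omega
  · simp only [pow_succ, pow_zero, one_mul, mul_assoc, gφ_mul, QuadraticAlgebra.mk.injEq] at h; omega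
  · exact ⟨1, by norm_num, rfl⟩
  · simp only [pow_succ, pow_zero, one_mul, mul_assoc, gφ_mul, QuadraticAlgebra.mk.injEq] at h; omega
  · simp only [pow_succ, pow_zero, one_mul, mul_assoc, gφ_mul, QuadraticAlgebra.mk.injEq] at h; omega
  · exact ⟨2, by norm_num, rfl⟩
  · simp only [pow_succ, pow_zero, one_mul, mul_assoc, gφ_mul, QuadraticAlgebra.mk.injEq] at h; omega
  · simp only [pow_succ, pow_zero, one_mul, mul_assoc, gφ_mul, QuadraticAlgebra.mk.injEq] at h; omega

theorem cube_case {l n Z : ℤ} (hc : IsCoprime l n) (hZ : ¬ (3 : ℤ) ∣ Z)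
    (h : 3 * l ^ 2 * n + 3 * l * n ^ 2 + 2 * n ^ 3 = 4 * Z ^ 3) : False := by
  have h1 : n * (3 * l ^ 2 + 3 * l * n + 2 * n ^ 2) = ((4 : ℕ) : ℤ) * Z ^ 3 := by push_cast; linarith
  have hp3 : Prime (3 : ℤ) := Int.prime_three
  have hZ3 : ¬ (3 : ℤ) ∣ n * (3 * l ^ 2 + 3 * l * n + 2 * n ^ 2) := by
    rw [h1]; intro h2
    rcases hp3.dvd_or_dvd h2 with h3 | h3
    · norm_num at h3
    · exact hZ (hp3.dvd_of_dvd_pow h3)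
  have hn3 : ¬ (3 : ℤ) ∣ n := fun h2 => hZ3 (Dvd.dvd.mul_right h2 _)
  have hcop : IsCoprime n (3 * l ^ 2 + 3 * l * n + 2 * n ^ 2) := by
    have h3 : IsCoprime n 3 := cop_of_prime_not_dvd Nat.prime_three (by exact_mod_cast hn3)
    have h4 : IsCoprime n (3 * l ^ 2) := h3.mul_right hc.symm.pow_right
    have h5 := h4.add_mul_left_right (3 * l + 2 * n)
    exact cop_eq_r h5 (by ring)
  have hkey : ∀ l' n' : ℤ, l' % 3 = l % 3 → n' % 9 = n % 9 → (3 * l ^ 2 + 3 * l * n + 2 * n ^ 2) % 9 = (3 * l' ^ 2 + 3 * l' * n' + 2 * n' ^ 2) % 9 := by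
    intro l' n' e1 e2
    obtain ⟨s, hs⟩ : ∃ s, l = l' + 3 * s := ⟨(l - l') / 3, by omega⟩
    obtain ⟨t, ht⟩ : ∃ t, n = n' + 9 * t := ⟨(n - n') / 9, by omega⟩
    apply Int.ModEq.symm
    rw [Int.modEq_iff_dvd, hs, ht]
    exact ⟨2 * l' * s + 3 * s ^ 2 + 3 * l' * t + n' * s + 9 * s * t + 4 * n' * t + 18 * t ^ 2, by ring⟩
  have hl3 : l % 3 = 0 ∨ l % 3 = 1 ∨ l % 3 = 2 := by omega
  rcases int_split pp4 hcop h1 with ⟨A', hA, hm, hcA⟩ | ⟨B', hB, hm, hcB⟩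
  · obtain ⟨τ, hτ⟩ := int_pow_odd (by decide) hcA hm
    obtain ⟨σ, hσ⟩ := int_pow_odd (by decide) hcA.symm ((mul_comm _ _).trans hm)
    have t3 : ¬ (3 : ℤ) ∣ τ := by
      rintro ⟨w, rfl⟩; exact hn3 ⟨36 * w ^ 3, by rw [hA, hτ]; push_cast; ring⟩
    have s3 : ¬ (3 : ℤ) ∣ σ := by
      rintro ⟨w, rfl⟩; apply hZ3; rw [hσ]; exact ⟨n * (9 * w ^ 3), by ring⟩
    have e1 := cube_mod_nine t3
    have e2 := cube_mod_nine s3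
    have e3 : n % 9 = 4 ∨ n % 9 = 5 := by rw [hA, hτ]; push_cast; omega
    rcases e3 with e3 | e3 <;> rcases hl3 with e4 | e4 | e4 <;>
    · have := hkey (l % 3) (n % 9) (by omega) (by omega)
      rw [e3, e4] at this
      omega
  · push_cast at hB
    obtain ⟨τ, hτ⟩ := int_pow_odd (by decide) hcB hm
    obtain ⟨σ, hσ⟩ := int_pow_odd (by decide) hcB.symm ((mul_comm _ _).trans hm)
    have t3 : ¬ (3 : ℤ) ∣ τ := by
      rintro ⟨w, rfl⟩; exact hn3 ⟨9 * w ^ 3, by rw [hτ]; ring⟩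
    have s3 : ¬ (3 : ℤ) ∣ σ := by
      rintro ⟨w, rfl⟩; apply hZ3; rw [hB, hσ]; exact ⟨n * 4 * (9 * w ^ 3), by ring⟩
    have e1 := cube_mod_nine t3
    have e2 := cube_mod_nine s3
    have e3 : n % 9 = 1 ∨ n % 9 = 8 := by rw [hτ]; omega
    rcases e3 with e3 | e3 <;> rcases hl3 with e4 | e4 | e4 <;>
    · have := hkey (l % 3) (n % 9) (by omega) (by omega)
      rw [e3, e4] at this
      omega

theorem nine_dvd {l n Z : ℤ} (hc : IsCoprime l n) (hZ : (3 : ℤ) ∣ Z)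
    (h : 3 * l ^ 2 * n + 3 * l * n ^ 2 + 2 * n ^ 3 = 4 * Z ^ 3) : (9 : ℤ) ∣ n := by
  obtain ⟨z, rfl⟩ := hZ
  have hp3 : Prime (3 : ℤ) := Int.prime_three
  have h1 : (3 : ℤ) ∣ n := by
    have : (3 : ℤ) ∣ 2 * n ^ 3 := ⟨36 * z ^ 3 - l ^ 2 * n - l * n ^ 2, by linarith⟩
    rcases hp3.dvd_or_dvd this with h | h
    · norm_num at h
    · exact hp3.dvd_of_dvd_pow h
  obtain ⟨n1, rfl⟩ := h1
  have h2 : ¬ (3 : ℤ) ∣ l := fun h2 => not_both_dvd hc not_unit_three h2 (dvd_mul_right _ _)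
  have h3 : (3 : ℤ) ∣ l ^ 2 * n1 := ⟨4 * z ^ 3 - l * n1 ^ 2 - 2 * n1 ^ 3, by linarith⟩
  rcases hp3.dvd_or_dvd h3 with h | h
  · exact absurd (hp3.dvd_of_dvd_pow h) h2
  · obtain ⟨w, rfl⟩ := h; exact ⟨w, by ring⟩

theorem final_case {a b x Z : ℤ} (hZ0 : Z ≠ 0) (hc : IsCoprime x (4 * Z ^ 3)) (hZ : (3 : ℤ) ∣ Z)
    (h : (⟨x, 4 * Z ^ 3⟩ : ZP) = ((⟨a, b⟩ : ZP) ^ 3) ^ 3) : False := by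
  rw [ZP_cube, ZP_cube, QuadraticAlgebra.mk.injEq] at h
  have hBe := im_even a b
  set A := a ^ 3 + 3 * a * b ^ 2 + b ^ 3 with hA
  set B := 3 * a ^ 2 * b + 3 * a * b ^ 2 + 2 * b ^ 3 with hB
  obtain ⟨hx, hy⟩ := h
  have hAB : IsCoprime A B := cop_lin hc ⟨A ^ 2 + 3 * B ^ 2, B ^ 2, by rw [hx]; ring⟩
    ⟨0, 3 * A ^ 2 + 3 * A * B + 2 * B ^ 2, by rw [hy]; ring⟩
  have hab : IsCoprime a b := cop_lin hAB ⟨a ^ 2 + 3 * b ^ 2, b ^ 2, by rw [hA]; ring⟩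
    ⟨0, 3 * a ^ 2 + 3 * a * b + 2 * b ^ 2, by rw [hB]; ring⟩
  have hp3 : Prime (3 : ℤ) := Int.prime_three
  have hp5 : Prime (5 : ℤ) := Nat.prime_iff_prime_int.mp Nat.prime_five
  obtain ⟨Z1, rfl⟩ := hZ
  have hB9 : (9 : ℤ) ∣ B := nine_dvd hAB (dvd_mul_right 3 Z1) hy.symm
  have hb3 : (3 : ℤ) ∣ b := by
    have h1 : (3 : ℤ) ∣ 2 * b ^ 3 := by
      obtain ⟨w, hw⟩ := hB9
      exact ⟨3 * w - a ^ 2 * b - a * b ^ 2, by rw [hB] at hw; linarith⟩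
    rcases hp3.dvd_or_dvd h1 with h | h
    · norm_num at h
    · exact hp3.dvd_of_dvd_pow h
  obtain ⟨b1, rfl⟩ := hb3
  have ha3 : ¬ (3 : ℤ) ∣ a := fun h2 => not_both_dvd hab not_unit_three h2 (dvd_mul_right _ _)
  set Q := a ^ 2 + 3 * a * b1 + 6 * b1 ^ 2 with hQ
  have hBQ : B = 9 * (b1 * Q) := by rw [hB, hQ]; ring
  set P := A ^ 2 + 3 * A * (3 * (b1 * Q)) + 6 * (3 * (b1 * Q)) ^ 2 with hP
  have h27 : P * (b1 * Q) = ((4 : ℕ) : ℤ) * Z1 ^ 3 := by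
    have : 27 * (P * (b1 * Q)) = 27 * (4 * Z1 ^ 3) := by
      calc 27 * (P * (b1 * Q)) = 3 * A ^ 2 * B + 3 * A * B ^ 2 + 2 * B ^ 3 := by rw [hP, hBQ]; ring
        _ = 4 * (3 * Z1) ^ 3 := hy.symm
        _ = _ := by ring
    push_cast; linarith
  have hcA : IsCoprime A (3 * (3 * (b1 * Q))) := by
    have : 3 * (3 * (b1 * Q)) = B := by rw [hBQ]; ring
    rw [this]; exact hAB
  have hcA1 : IsCoprime A (3 * (b1 * Q)) := hcA.of_mul_right_right
  have hcP3 : IsCoprime P (3 * (b1 * Q)) := by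
    have h1 : IsCoprime (A ^ 2) (3 * (b1 * Q)) := hcA1.pow_left
    have h2 := h1.add_mul_left_left (3 * A + 6 * (3 * (b1 * Q)))
    exact cop_eq_l h2 (by rw [hP]; ring)
  have hcP : IsCoprime P (b1 * Q) := hcP3.of_mul_right_right
  have hc3 : IsCoprime P 3 := hcP3.of_mul_right_left
  have hPodd : P % 2 = 1 := by
    have hA2 : A % 2 = 1 := by
      by_contra hA2
      have u2 : ¬ IsUnit (2 : ℤ) := by rw [Int.isUnit_iff]; omega
      exact not_both_dvd hAB u2 (by omega) (by omega)
    have hq2 : (b1 * Q) % 2 = 0 := by omega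
    obtain ⟨w, hw⟩ : ∃ w, b1 * Q = 2 * w := ⟨b1 * Q / 2, by omega⟩
    obtain ⟨w', hw'⟩ : ∃ w, A = 2 * w + 1 := ⟨A / 2, by omega⟩
    have : P = 2 * (2 * w' ^ 2 + 2 * w' + 9 * A * w + 108 * w ^ 2) + 1 := by
      rw [hP, hw]; nth_rewrite 1 [hw']; ring
    omega
  rcases int_split pp4 hcP h27 with ⟨A', hA', -, -⟩ | ⟨B', hB', hm, hcB⟩
  · push_cast at hA'; omega
  push_cast at hB'
  obtain ⟨σ, hσ⟩ := int_pow_odd (by decide) hcB hm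
  obtain ⟨ω, hω⟩ := int_pow_odd (by decide) hcB.symm ((mul_comm _ _).trans hm)
  have hid : P = (Q - 15 * b1 ^ 2) ^ 3 + 135 * (b1 * Q) ^ 2 := by
    rw [hP, hQ, hA]; ring
  have hid2 : σ ^ 3 - (Q - 15 * b1 ^ 2) ^ 3 = 2160 * ω ^ 6 := by
    rw [← hσ, hid, hB', hω]; ring
  have hc5 : IsCoprime P 5 := by
    apply cop_of_prime_not_dvd Nat.prime_five
    intro h5
    push_cast at h5
    have h6 : (5 : ℤ) ∣ (Q - 15 * b1 ^ 2) ^ 3 := by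
      have : (Q - 15 * b1 ^ 2) ^ 3 = P - 5 * (27 * (b1 * Q) ^ 2) := by rw [hid]; ring
      rw [this]; exact dvd_sub h5 (dvd_mul_right _ _)
    have h7 := hp5.dvd_of_dvd_pow h6
    have h8 : (5 : ℤ) ∣ Q := by
      have : Q = (Q - 15 * b1 ^ 2) + 5 * (3 * b1 ^ 2) := by ring
      rw [this]; exact dvd_add h7 (dvd_mul_right _ _)
    exact not_both_dvd hcP hp5.not_isUnit h5 (Dvd.dvd.mul_left h8 _)
  have hcy : IsCoprime P ((Q - 15 * b1 ^ 2) ^ 3) := by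
    have h1 : IsCoprime P (3 * 3 * 3 * 5 * (b1 * Q) ^ 2) :=
      ((((hc3.mul_right hc3).mul_right hc3).mul_right hc5).mul_right hcP.pow_right)
    have h2 := (h1.neg_right).add_mul_left_right 1
    exact cop_eq_r h2 (by rw [hid]; ring)
  have hcσ : IsCoprime σ (Q - 15 * b1 ^ 2) := by
    rw [hσ] at hcy
    exact (IsCoprime.pow_iff (by norm_num) (by norm_num)).mp hcy
  have hω0 : ω ≠ 0 := by
    rintro rfl
    rw [hω] at hm
    apply hZ0
    have : Z1 ^ 3 = 0 := by rw [← hm]; ring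
    have := pow_eq_zero_iff (by norm_num) |>.mp this
    rw [this]; ring
  have hy3 : ¬ (3 : ℤ) ∣ Q - 15 * b1 ^ 2 := by
    intro h3
    apply ha3
    have : a ^ 2 = (Q - 15 * b1 ^ 2) + 3 * (3 * b1 ^ 2 - a * b1) := by rw [hQ]; ring
    exact hp3.dvd_of_dvd_pow (n := 2) (by rw [this]; exact dvd_add h3 (dvd_mul_right _ _))
  exact chain_all hcσ hy3 hω0 hid2

theorem nonic_main {W e Z : ℤ} (hW : Odd W) (hWZ : IsCoprime W Z) (hW5 : ¬ (5 : ℤ) ∣ W) (hZ : Z ≠ 0)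
    (h : W ^ 2 = e ^ 9 + 20 * Z ^ 6) : False := by
  have hW2 : IsCoprime W 2 := cop_of_prime_not_dvd Nat.prime_two (by rcases hW with ⟨k, rfl⟩; push_cast; omega)
  have hW5' : IsCoprime W 5 := cop_of_prime_not_dvd Nat.prime_five (by exact_mod_cast hW5)
  have h1 : (W - 2 * Z ^ 3) ^ 2 + (W - 2 * Z ^ 3) * (4 * Z ^ 3) - (4 * Z ^ 3) ^ 2 = e ^ 9 := by linear_combination h
  have hWe : IsCoprime W (e ^ 9) := by
    have h2 : IsCoprime W (2 * 2 * 5 * Z ^ 6) := (((hW2.mul_right hW2).mul_right hW5').mul_right hWZ.pow_right)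
    have h3 := h2.neg_right.add_mul_left_right W
    exact cop_eq_r h3 (by linear_combination -h)
  have h2e : IsCoprime 2 (e ^ 9) := by
    have : IsCoprime (W ^ 2) 2 := hW2.pow_left
    have := this.add_mul_left_left (-10 * Z ^ 6)
    have e1 : W ^ 2 + 2 * (-10 * Z ^ 6) = e ^ 9 := by linear_combination h
    rw [e1] at this; exact this.symm
  have hc : IsCoprime (2 * (W - 2 * Z ^ 3) + 4 * Z ^ 3) (e ^ 9) := by
    have : 2 * (W - 2 * Z ^ 3) + 4 * Z ^ 3 = 2 * W := by ring
    rw [this]; exact h2e.mul_left hWe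
  obtain ⟨i, hi, v, hv⟩ := ZP_nine h1 hc
  have hxy : IsCoprime (W - 2 * Z ^ 3) (4 * Z ^ 3) := by
    have hw4 : IsCoprime (W - 2 * Z ^ 3) 2 := by
      have := hW2.add_mul_left_left (- Z ^ 3)
      exact cop_eq_l this (by ring)
    have hwz : IsCoprime (W - 2 * Z ^ 3) Z := by
      have := hWZ.add_mul_left_left (- 2 * Z ^ 2)
      exact cop_eq_l this (by ring)
    have : IsCoprime (W - 2 * Z ^ 3) (2 * 2 * Z ^ 3) := (hw4.mul_right hw4).mul_right hwz.pow_right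
    exact cop_eq_r this (by ring)
  obtain ⟨i', hi', rfl⟩ := exp_three (by rcases hW with ⟨k, rfl⟩; omega) (by omega) hi hv
  have hv2 : (⟨W - 2 * Z ^ 3, 4 * Z ^ 3⟩ : ZP) = (gφ ^ i' * v ^ 3) ^ 3 := by rw [hv]; ring
  have gen : ∀ l n : ℤ, gφ ^ i' * v ^ 3 = (⟨l, n⟩ : ZP) → IsCoprime l n ∧ (3 : ℤ) ∣ Z ∧ (9 : ℤ) ∣ n := by
    intro l n hln
    rw [hln, ZP_cube, QuadraticAlgebra.mk.injEq] at hv2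
    have hcl : IsCoprime l n := cop_lin hxy ⟨l ^ 2 + 3 * n ^ 2, n ^ 2, by rw [hv2.1]; ring⟩
      ⟨0, 3 * l ^ 2 + 3 * l * n + 2 * n ^ 2, by rw [hv2.2]; ring⟩
    have h3 : (3 : ℤ) ∣ Z := by
      by_contra h3
      exact cube_case hcl h3 hv2.2.symm
    exact ⟨hcl, h3, nine_dvd hcl h3 hv2.2.symm⟩
  obtain ⟨a, b⟩ := v
  have hp3 : Prime (3 : ℤ) := Int.prime_three
  interval_cases i'
  · rw [pow_zero, one_mul] at hv2
    obtain ⟨-, h3, -⟩ := gen _ _ (by rw [pow_zero, one_mul, ZP_cube])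
    exact final_case hZ hxy h3 hv2
  · obtain ⟨hcl, -, k, hk⟩ := gen _ _ (by rw [pow_one, ZP_cube, gφ_mul])
    have ha : (3 : ℤ) ∣ a := hp3.dvd_of_dvd_pow (n := 3) ⟨3 * k - a ^ 2 * b - 2 * a * b ^ 2 - b ^ 3, by linarith⟩
    obtain ⟨a', rfl⟩ := ha
    have hb : (3 : ℤ) ∣ b := hp3.dvd_of_dvd_pow (n := 3) ⟨k - 3 * a' ^ 3 - 3 * a' ^ 2 * b - 2 * a' * b ^ 2, by linarith⟩
    obtain ⟨b', rfl⟩ := hb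
    exact not_both_dvd hcl not_unit_three ⟨27 * a' ^ 2 * b' + 27 * a' * b' ^ 2 + 18 * b' ^ 3, by ring⟩ (by rw [hk]; exact ⟨3 * k, by ring⟩)
  · obtain ⟨hcl, -, k, hk⟩ := gen _ _ (by rw [pow_two, mul_assoc, ZP_cube, gφ_mul, gφ_mul])
    have ha : (3 : ℤ) ∣ b - a := by
      have h3 : (3 : ℤ) ∣ (b - a) ^ 3 := ⟨-3 * k + 2 * b ^ 3 + 2 * a * b ^ 2 + 3 * a ^ 2 * b, by linarith⟩
      exact hp3.dvd_of_dvd_pow h3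
    obtain ⟨t, ht⟩ := ha
    obtain rfl : a = b - 3 * t := by linarith
    have hb : (3 : ℤ) ∣ b := by
      have h3 : (3 : ℤ) ∣ b ^ 3 := ⟨k + 8 * b ^ 2 * t - 9 * b * t ^ 2 + 3 * t ^ 3 - 2 * b ^ 3, by linarith⟩
      exact hp3.dvd_of_dvd_pow h3
    obtain ⟨b', rfl⟩ := hb
    exact not_both_dvd hcl not_unit_three ⟨(9 * (b' - t) ^ 3 + 27 * (b' - t) * b' ^ 2 + 9 * b' ^ 3) + (27 * (b' - t) ^ 2 * b' + 27 * (b' - t) * b' ^ 2 + 18 * b' ^ 3), by ring⟩ (by rw [hk]; exact ⟨3 * k, by ring⟩)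

end Nonic


section TenFive

theorem rat_int_quintic {t : ℚ} {y b : ℤ} (h : t ^ 5 - 5 * y * t ^ 3 + 5 * (y : ℚ) ^ 2 * t = 2 * b) : ∃ T : ℤ, t = T := by
  have h2 : IsIntegral ℤ t := by
    refine ⟨Polynomial.X ^ 5 + (- 5 * Polynomial.C y * Polynomial.X ^ 3 + 5 * Polynomial.C y ^ 2 * Polynomial.X - Polynomial.C (2 * b)), ?_, ?_⟩
    · apply Polynomial.monic_X_pow_add
      refine lt_of_le_of_lt (b := (3 : WithBot ℕ)) ?_ (by norm_cast)
      rw [← Polynomial.C_ofNat]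
      simp only [← Polynomial.C_neg, ← Polynomial.C_mul, ← Polynomial.C_pow]
      compute_degree
    · simp [-eq_intCast, Polynomial.eval₂_add, Polynomial.eval₂_sub, Polynomial.eval₂_mul, Polynomial.eval₂_pow]
      linear_combination h
  obtain ⟨Y, hY⟩ := IsIntegrallyClosed.isIntegral_iff.mp h2
  exact ⟨Y, by rw [← hY]; simp⟩

theorem ten_five {c : ℤ} {k : ℕ} (hc0 : c ≠ 0) (hc5 : (5 : ℤ) ∣ c) (h : KeyP 10 c k 5 2) : False := by
  obtain ⟨u, v, h1, h2⟩ := conc_two_five h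
  have hβc := aS_cop (show 2 ≤ 10 by norm_num) c k
  set β := aS 10 c k
  obtain ⟨n, hn⟩ : 9 ∣ 10 ^ (k + 1) - 1 := by
    have : (1 : ℕ) ≡ 10 ^ (k + 1) [MOD 9] := by
      have : 10 ≡ 1 [MOD 9] := rfl
      simpa using (this.pow (k + 1)).symm
    exact (Nat.modEq_iff_dvd' (Nat.one_le_pow _ _ (by norm_num))).mp this
  have hn0 : n ≠ 0 := by
    rintro rfl
    have : 10 ^ 1 ≤ 10 ^ (k + 1) := Nat.pow_le_pow_right (by norm_num) (by omega)
    omega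
  rw [hn] at h1 h2
  norm_num at h1
  set D := (c : ℚ) ^ (9 * n) with hD
  set q := D * v ^ 2 with hq
  have h3 : q * (5 * u ^ 4 - 10 * u ^ 2 * q + q ^ 2) ^ 2 = D := by
    have : q * (5 * u ^ 4 - 10 * u ^ 2 * q + q ^ 2) ^ 2 = D * (v * (5 * u ^ 4 - 10 * u ^ 2 * q + q ^ 2)) ^ 2 := by
      rw [hq]; ring
    rw [this, h2]; ring
  have h4 : (u ^ 2 + q) ^ 5 = ((β ^ 10 + c ^ (9 * n) : ℤ) : ℚ) := by
    push_cast
    rw [← hD]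
    linear_combination h3 + (u * (u ^ 4 - 10 * u ^ 2 * q + 5 * q ^ 2) + (β : ℚ) ^ 5) * h1
  obtain ⟨y, hy⟩ := rat_int_of_pow (by norm_num) h4
  have h5 : (2 * u) ^ 5 - 5 * y * (2 * u) ^ 3 + 5 * (y : ℚ) ^ 2 * (2 * u) = 2 * (β ^ 5 : ℤ) := by
    push_cast
    rw [← hy, ← h1]; ring
  obtain ⟨t, ht⟩ := rat_int_quintic h5
  have h6 : t ^ 5 - 5 * y * t ^ 3 + 5 * y ^ 2 * t = 2 * β ^ 5 := by
    rw [ht] at h5; exact_mod_cast h5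
  obtain ⟨U, hU⟩ : ∃ U, t = 2 * U := by
    refine ⟨t / 2, ?_⟩
    by_contra hne
    have e1 : t % 2 = 1 := by omega
    have e3 : (t ^ 5 - 5 * y * t ^ 3 + 5 * y ^ 2 * t) % 2 = 0 := by rw [h6]; omega
    have e2 : y % 2 = 0 ∨ y % 2 = 1 := by omega
    rcases e2 with e2 | e2 <;> simp [Int.add_emod, Int.sub_emod, Int.mul_emod, pow_succ, e1, e2] at e3
  have hu : u = U := by
    rw [hU] at ht; push_cast at ht; linarith
  set Q := y - U ^ 2 with hQ
  have hqQ : q = Q := by rw [hQ]; push_cast; rw [← hy, hu]; ring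
  rw [hqQ, hu] at h1 h3
  rw [hD] at h3
  have i1 : U * (U ^ 4 - 10 * U ^ 2 * Q + 5 * Q ^ 2) = β ^ 5 := by exact_mod_cast h1
  have i3 : Q * (5 * U ^ 4 - 10 * U ^ 2 * Q + Q ^ 2) ^ 2 = c ^ (9 * n) := by exact_mod_cast h3
  have hcop : IsCoprime (β ^ 5) (c ^ (9 * n)) := hβc.pow
  have hUQ : IsCoprime U Q := cop_lin hcop ⟨U ^ 4 - 10 * U ^ 2 * Q + 5 * Q ^ 2, 0, by rw [← i1]; ring⟩
    ⟨0, (5 * U ^ 4 - 10 * U ^ 2 * Q + Q ^ 2) ^ 2, by rw [← i3]; ring⟩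
  have hp5 : Prime (5 : ℤ) := Nat.prime_iff_prime_int.mp Nat.prime_five
  have hD5 : (5 : ℤ) ∣ c ^ (9 * n) := dvd_pow hc5 (by omega)
  have hQ5 : (5 : ℤ) ∣ Q := by
    have : (5 : ℤ) ∣ Q ^ 5 := by
      have e : Q ^ 5 = c ^ (9 * n) + 5 * (- (Q * ((U ^ 4 - 2 * U ^ 2 * Q) * (5 * U ^ 4 - 10 * U ^ 2 * Q + 2 * Q ^ 2)))) := by
        rw [← i3]; ring
      rw [e]; exact dvd_add hD5 (dvd_mul_right _ _)
    exact hp5.dvd_of_dvd_pow this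
  obtain ⟨q1, hq1⟩ := hQ5
  rw [hq1] at hUQ i1 i3
  have hU5 : IsCoprime U 5 := hUQ.of_mul_right_left
  have hUq : IsCoprime U q1 := hUQ.of_mul_right_right
  set F := U ^ 4 - 10 * U ^ 2 * q1 + 5 * q1 ^ 2 with hF
  have i4 : (125 * q1) * F ^ 2 = (c ^ n) ^ 9 := by
    rw [← pow_mul, mul_comm n 9, ← i3, hF]; ring
  have hF5 : IsCoprime 5 F := by
    have : IsCoprime (U ^ 4) 5 := hU5.pow_left
    exact (cop_eq_l (this.add_mul_left_left (- 2 * U ^ 2 * q1 + q1 ^ 2)) (by rw [hF]; ring)).symm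
  have hFq : IsCoprime q1 F := by
    have : IsCoprime (U ^ 4) q1 := hUq.pow_left
    exact (cop_eq_l (this.add_mul_left_left (- 10 * U ^ 2 + 5 * q1)) (by rw [hF]; ring)).symm
  have hcF : IsCoprime (125 * q1) (F ^ 2) := by
    have : IsCoprime (5 ^ 3 * q1) (F ^ 2) := (hF5.pow_left.mul_left hFq).pow_right
    exact cop_eq_l this (by ring)
  obtain ⟨z, hz⟩ := int_pow_odd (by decide) hcF i4
  obtain ⟨e', he'⟩ := int_pow_odd (by decide) hcF.symm ((mul_comm _ _).trans i4)
  obtain ⟨e, he, -⟩ := int_pow_cop (by norm_num) (by norm_num) (by decide) he'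
  have hz5 : (5 : ℤ) ∣ z := hp5.dvd_of_dvd_pow (n := 9) (by rw [← hz]; exact ⟨25 * q1, by ring⟩)
  obtain ⟨Z', rfl⟩ := hz5
  set Z := 25 * Z' ^ 3 with hZ
  have hqZ : q1 = Z ^ 3 := by
    have : 125 * q1 = 125 * Z ^ 3 := by rw [hz, hZ]; ring
    linarith
  have hW : (U ^ 2 - 5 * Z ^ 3) ^ 2 = e ^ 9 + 20 * Z ^ 6 := by
    rw [← he, hF, hqZ]; ring
  have hUZ : IsCoprime U Z := by
    rw [hqZ] at hUq
    exact (IsCoprime.pow_right_iff (by norm_num)).mp hUq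
  refine nonic_main ?_ ?_ ?_ ?_ hW
  · rw [← hqZ]
    have u2 : ¬ IsUnit (2 : ℤ) := by rw [Int.isUnit_iff]; omega
    have eU : U % 2 = 0 ∨ U % 2 = 1 := by omega
    have eq : q1 % 2 = 0 ∨ q1 % 2 = 1 := by omega
    rw [Int.odd_iff]
    rcases eU with eU | eU <;> rcases eq with eq | eq
    · exact (not_both_dvd hUq u2 (by omega) (by omega)).elim
    · simp [Int.sub_emod, Int.mul_emod, pow_succ, eU, eq]
    · simp [Int.sub_emod, Int.mul_emod, pow_succ, eU, eq]
    · exfalso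
      have e1 : (2 : ℤ) ∣ F := by
        apply Int.dvd_of_emod_eq_zero
        simp [hF, Int.sub_emod, Int.add_emod, Int.mul_emod, pow_succ, eU, eq]
      have e2 : (2 : ℤ) ∣ c := by
        have : (2 : ℤ) ∣ (c ^ n) ^ 9 := by rw [← i4]; exact Dvd.dvd.mul_left (dvd_pow e1 (by norm_num)) _
        exact Int.prime_two.dvd_of_dvd_pow (Int.prime_two.dvd_of_dvd_pow this)
      have e3 : (2 : ℤ) ∣ y := by
        have : y = U ^ 2 + 5 * q1 := by linarith
        rw [this]
        apply Int.dvd_of_emod_eq_zero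
        simp [Int.add_emod, Int.mul_emod, pow_succ, eU, eq]
      have e4 : y ^ 5 = β ^ 10 + c ^ (9 * n) := by rw [hy] at h4; exact_mod_cast h4
      have e5 : (2 : ℤ) ∣ β := by
        have : (2 : ℤ) ∣ β ^ 10 := by
          have e6 : β ^ 10 = y ^ 5 - c ^ (9 * n) := by linarith
          rw [e6]
          exact dvd_sub (dvd_pow e3 (by norm_num)) (dvd_pow e2 (by omega))
        exact Int.prime_two.dvd_of_dvd_pow this
      exact not_both_dvd hβc u2 e5 e2
  · have : IsCoprime (U ^ 2) Z := hUZ.pow_left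
    exact cop_eq_l (this.add_mul_left_left (- 5 * Z ^ 2)) (by ring)
  · intro h5
    have : (5 : ℤ) ∣ U ^ 2 := by
      have e : U ^ 2 = (U ^ 2 - 5 * Z ^ 3) + 5 * Z ^ 3 := by ring
      rw [e]; exact dvd_add h5 (dvd_mul_right _ _)
    exact not_both_dvd hU5 hp5.not_isUnit (hp5.dvd_of_dvd_pow this) (dvd_refl _)
  · intro h0
    rw [hqZ, h0] at i4
    have : (c ^ n) ^ 9 = 0 := by rw [← i4]; ring
    exact hc0 (pow_eq_zero_iff hn0 |>.mp (pow_eq_zero_iff (by norm_num) |>.mp this))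

end TenFive


section Ultra

variable {K : Type*} [NormedField K] [IsUltrametricDist K]

theorem u_add_le (a b : K) {r : ℝ} (ha : ‖a‖ ≤ r) (hb : ‖b‖ ≤ r) : ‖a + b‖ ≤ r :=
  (IsUltrametricDist.norm_add_le_max a b).trans (max_le ha hb)

theorem u_add_lt (a b : K) {r : ℝ} (ha : ‖a‖ < r) (hb : ‖b‖ < r) : ‖a + b‖ < r :=
  (IsUltrametricDist.norm_add_le_max a b).trans_lt (max_lt ha hb)

theorem u_add_eq {a b : K} (h : ‖b‖ < ‖a‖) : ‖a + b‖ = ‖a‖ := by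
  rw [IsUltrametricDist.norm_add_eq_max_of_norm_ne_norm h.ne']
  exact max_eq_left h.le

theorem u_nat (n : ℕ) : ‖(n : K)‖ ≤ 1 := IsUltrametricDist.norm_natCast_le_one K n

theorem u_mul {a b : K} (ha : ‖a‖ ≤ 1) (hb : ‖b‖ ≤ 1) : ‖a * b‖ ≤ 1 := by
  rw [norm_mul]; exact mul_le_one₀ ha (norm_nonneg _) hb

theorem u_pow {a : K} (ha : ‖a‖ ≤ 1) (n : ℕ) : ‖a ^ n‖ ≤ 1 := by
  rw [norm_pow]; exact pow_le_one₀ (norm_nonneg _) ha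

/-- binomial expansion for the primes five and seven -/
theorem u_exp {p : ℕ} (hp : p = 5 ∨ p = 7) {δ β : K} (hδ : ‖δ‖ ≤ 1) (hβ : ‖β‖ ≤ 1) :
    ∃ s : K, ‖s‖ ≤ 1 ∧ (δ + β) ^ p - β ^ p = δ ^ p + p * δ * (β ^ (p - 1) + δ * s) := by
  have n2 : ‖(2 : K)‖ ≤ 1 := by exact_mod_cast u_nat (K := K) 2
  have n3 : ‖(3 : K)‖ ≤ 1 := by exact_mod_cast u_nat (K := K) 3
  have n5 : ‖(5 : K)‖ ≤ 1 := by exact_mod_cast u_nat (K := K) 5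
  rcases hp with rfl | rfl
  · refine ⟨2 * β ^ 3 + 2 * (β ^ 2 * δ) + β * δ ^ 2, ?_, by push_cast; ring⟩
    exact u_add_le _ _ (u_add_le _ _ (u_mul n2 (u_pow hβ 3)) (u_mul n2 (u_mul (u_pow hβ 2) hδ))) (u_mul hβ (u_pow hδ 2))
  · refine ⟨3 * β ^ 5 + 5 * (β ^ 4 * δ) + 5 * (β ^ 3 * δ ^ 2) + 3 * (β ^ 2 * δ ^ 3) + β * δ ^ 4, ?_, by push_cast; ring⟩
    exact u_add_le _ _ (u_add_le _ _ (u_add_le _ _ (u_add_le _ _ (u_mul n3 (u_pow hβ 5)) (u_mul n5 (u_mul (u_pow hβ 4) hδ)))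
      (u_mul n5 (u_mul (u_pow hβ 3) (u_pow hδ 2)))) (u_mul n3 (u_mul (u_pow hβ 2) (u_pow hδ 3)))) (u_mul hβ (u_pow hδ 4))

theorem u_int {p : ℕ} (hp : p = 5 ∨ p = 7) {δ β ρ : K} (hβ : ‖β‖ ≤ 1) (hρ : ‖ρ‖ ≤ 1) (h : (δ + β) ^ p = β ^ p - ρ) : ‖δ‖ ≤ 1 := by
  have hp0 : p ≠ 0 := by omega
  have h1 : ‖δ + β‖ ≤ 1 := by
    have : ‖δ + β‖ ^ p ≤ 1 := by
      rw [← norm_pow, h, sub_eq_add_neg]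
      exact u_add_le _ _ (u_pow hβ p) (by rwa [norm_neg])
    exact (pow_le_one_iff_of_nonneg (norm_nonneg _) hp0).mp this
  have : δ = (δ + β) + (-β) := by ring
  rw [this]; exact u_add_le _ _ h1 (by rwa [norm_neg])

theorem u_fac {p : ℕ} (hp : p = 5 ∨ p = 7) {δ β ρ : K} (hβ : ‖β‖ ≤ 1) (hρ : ‖ρ‖ ≤ 1) (h : (δ + β) ^ p = β ^ p - ρ) :
    ‖δ‖ ≤ 1 ∧ ∃ s : K, ‖s‖ ≤ 1 ∧ -ρ = δ * (δ ^ (p - 1) + p * (β ^ (p - 1) + δ * s)) := by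
  have hδ := u_int hp hβ hρ h
  obtain ⟨s, hs, e⟩ := u_exp hp hδ hβ
  refine ⟨hδ, s, hs, ?_⟩
  rw [h] at e
  have : δ ^ p = δ * δ ^ (p - 1) := by rw [← pow_succ']; congr 1; omega
  rw [this] at e
  linear_combination e

theorem u_B {p : ℕ} (hp : p = 5 ∨ p = 7) {δ β ρ : K} (hβ : ‖β‖ ≤ 1) (hρ : ‖ρ‖ = 1) (h : (δ + β) ^ p = β ^ p - ρ) : ‖δ‖ = 1 := by
  obtain ⟨hδ, s, hs, e⟩ := u_fac hp hβ hρ.le h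
  have h1 : ‖δ ^ (p - 1) + p * (β ^ (p - 1) + δ * s)‖ ≤ 1 :=
    u_add_le _ _ (u_pow hδ _) (u_mul (u_nat p) (u_add_le _ _ (u_pow hβ _) (u_mul hδ hs)))
  have h2 := congrArg norm e
  rw [norm_neg, hρ, norm_mul] at h2
  nlinarith [norm_nonneg δ]

theorem u_A {p : ℕ} (hp : p = 5 ∨ p = 7) {δ β ρ : K} (hβ : ‖β‖ = 1) (hρ : ‖ρ‖ ≤ 1) (hpK : ‖(p : K)‖ = 1) (h : (δ + β) ^ p = β ^ p - ρ) :
    ‖δ‖ = 1 ∨ ‖δ‖ = ‖ρ‖ := by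
  obtain ⟨hδ, s, hs, e⟩ := u_fac hp hβ.le hρ h
  rcases hδ.eq_or_lt with h1 | h1
  · exact Or.inl h1
  right
  have h3 : ‖β ^ (p - 1) + δ * s‖ = 1 := by
    have : ‖δ * s‖ < ‖β ^ (p - 1)‖ := by
      rw [norm_pow, hβ, one_pow, norm_mul]; nlinarith [norm_nonneg δ, norm_nonneg s]
    rw [u_add_eq this, norm_pow, hβ, one_pow]
  have h4 : ‖(p : K) * (β ^ (p - 1) + δ * s) + δ ^ (p - 1)‖ = 1 := by
    have e1 : ‖(p : K) * (β ^ (p - 1) + δ * s)‖ = 1 := by rw [norm_mul, hpK, h3, one_mul]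
    rw [u_add_eq, e1]
    rw [e1, norm_pow]; exact pow_lt_one₀ (norm_nonneg _) h1 (by omega)
  have h2 := congrArg norm e
  rw [norm_neg, norm_mul, add_comm, h4, mul_one] at h2
  exact h2.symm

theorem u_C {p : ℕ} (hp : p = 5 ∨ p = 7) {δ β ρ : K} (hβ : ‖β‖ = 1) (hpK : ‖(p : K)‖ < 1) (hρ : ‖ρ‖ ≤ ‖(p : K)‖ ^ 2) (h : (δ + β) ^ p = β ^ p - ρ) :
    ‖ρ‖ = ‖(p : K)‖ * ‖δ‖ ∨ ‖δ‖ ^ (p - 1) = ‖(p : K)‖ := by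
  have hpp := norm_nonneg (p : K)
  have hρ1 : ‖ρ‖ < 1 := lt_of_le_of_lt hρ (pow_lt_one₀ hpp hpK (by norm_num))
  obtain ⟨hδ, s, hs, e⟩ := u_fac hp hβ.le hρ1.le h
  have h0 : ‖β ^ (p - 1) + δ * s‖ ≤ 1 := u_add_le _ _ (u_pow hβ.le _) (u_mul hδ hs)
  have h1 : ‖δ‖ < 1 := by
    have e1 : δ ^ p = -ρ + -(p * (δ * (β ^ (p - 1) + δ * s))) := by
      rw [e, show δ ^ p = δ * δ ^ (p - 1) by rw [← pow_succ']; congr 1; omega]; ring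
    have : ‖δ‖ ^ p < 1 := by
      rw [← norm_pow, e1]
      apply u_add_lt
      · rwa [norm_neg]
      · rw [norm_neg, norm_mul]
        have := u_mul hδ h0
        nlinarith [norm_nonneg (δ * (β ^ (p - 1) + δ * s))]
    by_contra hcon
    exact absurd this (not_lt.mpr (one_le_pow₀ (not_lt.mp hcon)))
  have h3 : ‖β ^ (p - 1) + δ * s‖ = 1 := by
    have : ‖δ * s‖ < ‖β ^ (p - 1)‖ := by
      rw [norm_pow, hβ, one_pow, norm_mul]; nlinarith [norm_nonneg δ, norm_nonneg s]
    rw [u_add_eq this, norm_pow, hβ, one_pow]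
  have e1 : ‖(p : K) * (β ^ (p - 1) + δ * s)‖ = ‖(p : K)‖ := by rw [norm_mul, h3, mul_one]
  have h2 := congrArg norm e
  rw [norm_neg, norm_mul] at h2
  rcases lt_trichotomy (‖δ‖ ^ (p - 1)) ‖(p : K)‖ with h4 | h4 | h4
  · left
    rw [h2, add_comm, u_add_eq, e1, mul_comm]
    rw [e1, norm_pow]; exact h4
  · exact Or.inr h4
  · exfalso
    rw [u_add_eq (by rw [e1, norm_pow]; exact h4), norm_pow] at h2
    have h5 : ‖(p : K)‖ ^ 2 < ‖δ‖ * ‖δ‖ ^ (p - 1) := by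
      have h6 : ‖δ‖ ^ (p - 1) ≤ ‖δ‖ := pow_le_of_le_one (norm_nonneg _) hδ (by omega)
      nlinarith
    linarith

end Ultra


section Bridge

theorem nat_is_pow {m : ℕ} {N : ℕ} (hN : N ≠ 0) (h : ∀ l : ℕ, l.Prime → m ∣ N.factorization l) :
    ∃ T : ℕ, N = T ^ m := by
  refine ⟨N.factorization.prod (fun p e => p ^ (e / m)), ?_⟩
  conv_lhs => rw [← Nat.factorization_prod_pow_eq_self hN]
  rw [Finsupp.prod, Finsupp.prod, ← Finset.prod_pow]
  apply Finset.prod_congr rfl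
  intro l hl
  rw [← pow_mul, Nat.div_mul_cancel]
  exact h l (Nat.prime_of_mem_primeFactors (by simpa using hl))

theorem rat_is_pow {m : ℕ} {r : ℚ} (hr : r ≠ 0) (h : ∀ l : ℕ, l.Prime → ∃ n : ℕ, padicValRat l r = m * n) :
    ∃ T : ℕ, |r| = (T : ℚ) ^ m := by
  have hden : r.den = 1 := by
    by_contra hd
    obtain ⟨l, hl, hld⟩ := Nat.exists_prime_and_dvd hd
    haveI := Fact.mk hl
    obtain ⟨n, hn⟩ := h l hl
    have h1 : ¬ (l : ℤ) ∣ r.num := by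
      intro h2
      have h3 : l ∣ r.num.natAbs := Int.natCast_dvd.mp h2
      exact hl.one_lt.ne' (Nat.dvd_one.mp (r.reduced ▸ Nat.dvd_gcd h3 hld))
    rw [padicValRat_def, padicValInt.eq_zero_of_not_dvd h1] at hn
    have h4 : 1 ≤ padicValNat l r.den := one_le_padicValNat_of_dvd r.den_nz hld
    have : (0 : ℤ) ≤ m * n := by positivity
    omega
  have hri : r = (r.num : ℚ) := (Rat.coe_int_num_of_den_eq_one hden).symm
  obtain ⟨T, hT⟩ := nat_is_pow (m := m) (N := r.num.natAbs) (by simpa using hr) (by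
    intro l hl
    obtain ⟨n, hn⟩ := h l hl
    rw [hri, padicValRat.of_int] at hn
    rw [Nat.factorization_def _ hl]
    exact ⟨n, by rw [padicValInt] at hn; exact_mod_cast hn⟩)
  refine ⟨T, ?_⟩
  rw [hri, ← Int.cast_abs, Int.abs_eq_natAbs, hT]
  push_cast; rfl

variable (l : ℕ) [hl : Fact l.Prime]

theorem pa_norm {r : ℚ} (hr : r ≠ 0) : ‖(r : PadicAlgCl l)‖ = (l : ℝ) ^ (-padicValRat l r) := by
  have h1 : (r : PadicAlgCl l) = ((r : ℚ_[l]) : PadicAlgCl l) := by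
    rw [map_ratCast]
  rw [h1, PadicAlgCl.norm_extends, Padic.eq_padicNorm, padicNorm.eq_zpow_of_nonzero hr]
  push_cast; rfl

theorem pa_inj {a b : ℤ} (h : (l : ℝ) ^ a = (l : ℝ) ^ b) : a = b := by
  have h0 : (0 : ℝ) < l := by exact_mod_cast hl.out.pos
  have h1 : (l : ℝ) ≠ 1 := by exact_mod_cast hl.out.one_lt.ne'
  exact zpow_right_injective₀ h0 h1 h

theorem pa_int_le (z : ℤ) : ‖(z : PadicAlgCl l)‖ ≤ 1 := IsUltrametricDist.norm_intCast_le_one _ z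

theorem pa_int_one {z : ℤ} (h : ¬ (l : ℤ) ∣ z) : ‖(z : PadicAlgCl l)‖ = 1 := by
  have hz : z ≠ 0 := by rintro rfl; simp at h
  have := pa_norm l (r := (z : ℚ)) (by exact_mod_cast hz)
  rw [padicValRat.of_int, padicValInt.eq_zero_of_not_dvd h] at this
  simpa using this

theorem pa_cop_one {a c : ℤ} (hac : IsCoprime a c) (h : (l : ℤ) ∣ c) : ‖(a : PadicAlgCl l)‖ = 1 := by
  apply pa_int_one
  intro h2
  exact not_both_dvd hac (Nat.prime_iff_prime_int.mp hl.out).not_isUnit h2 h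

theorem pa_other {p : ℕ} (hp : p.Prime) (h : p ≠ l) : ‖(p : PadicAlgCl l)‖ = 1 := by
  have := pa_int_one l (z := (p : ℤ)) (by
    intro h2
    exact h.symm ((Nat.prime_dvd_prime_iff_eq hl.out hp).mp (by exact_mod_cast h2)))
  simpa using this

theorem pa_self : ‖(l : PadicAlgCl l)‖ = (l : ℝ) ^ (-1 : ℤ) := by
  have := pa_norm l (r := (l : ℚ)) (by exact_mod_cast hl.out.ne_zero)
  rw [padicValRat.self hl.out.one_lt] at this
  simpa using this

end Bridge


section Vals

theorem two_sq_roots {K : Type*} [Field K] [CharZero K] {p : ℕ} {D u v B : ℚ}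
    (h : X ^ 2 + C D ∣ (C u + C v * X) ^ p - C B + X) {ρ : K} (hρ : ρ ^ 2 = -(D : K)) :
    ((u : K) + v * ρ) ^ p = B - ρ := by
  obtain ⟨g, hg⟩ := h
  have := congrArg (eval₂ (Rat.castHom K) ρ) hg
  simp only [eval₂_add, eval₂_sub, eval₂_mul, eval₂_pow, eval₂_C, eval₂_X, Rat.coe_castHom, hρ] at this
  linear_combination this

theorem vals_two {p : ℕ} (hp : p = 5 ∨ p = 7) {c β : ℤ} {m : ℕ} (hm : Odd m) (hm4 : 4 ≤ m) (hc0 : c ≠ 0) (hpc : (p : ℤ) ∣ c)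
    (hβc : IsCoprime β c) {u v : ℚ}
    (h : X ^ 2 + C ((c : ℚ) ^ m) ∣ (C u + C v * X) ^ p - C ((β : ℚ) ^ p) + X) :
    (p : ℚ) ^ 2 * ((u - β) ^ 2 + (c : ℚ) ^ m * v ^ 2) ≠ 0 ∧
    padicValRat p ((p : ℚ) ^ 2 * ((u - β) ^ 2 + (c : ℚ) ^ m * v ^ 2)) = m * padicValInt p c ∧
    ∀ l : ℕ, l.Prime → ∃ n : ℕ, padicValRat l ((p : ℚ) ^ 2 * ((u - β) ^ 2 + (c : ℚ) ^ m * v ^ 2)) = m * n := by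
  set R := (u - β) ^ 2 + (c : ℚ) ^ m * v ^ 2 with hR
  have hpp : p.Prime := by rcases hp with rfl | rfl <;> norm_num
  have hp0 : (p : ℚ) ≠ 0 := by exact_mod_cast hpp.ne_zero
  have hc0' : (c : ℚ) ≠ 0 := by exact_mod_cast hc0
  have main : ∀ (l : ℕ) [Fact l.Prime], ∃ ρ δ δ' : PadicAlgCl l, ρ ≠ 0 ∧ δ * δ' = (R : ℚ) ∧ ‖ρ‖ ^ 2 = ‖(c : PadicAlgCl l)‖ ^ m ∧
      (δ + β) ^ p = (β : PadicAlgCl l) ^ p - ρ ∧ (δ' + β) ^ p = (β : PadicAlgCl l) ^ p - (-ρ) := by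
    intro l hl
    obtain ⟨ρ, hρ⟩ := IsAlgClosed.exists_pow_nat_eq (-(((c : ℚ) ^ m : ℚ) : PadicAlgCl l)) (n := 2) (by norm_num)
    have h1 := two_sq_roots h hρ
    have h2 := two_sq_roots h (ρ := -ρ) (by rw [neg_sq]; exact hρ)
    have e : ‖ρ‖ ^ 2 = ‖(c : PadicAlgCl l)‖ ^ m := by
      rw [← norm_pow, hρ, norm_neg]; push_cast; rw [norm_pow]
    refine ⟨ρ, u + v * ρ - β, u + v * (-ρ) - β, ?_, ?_, e, ?_, ?_⟩
    · rintro rfl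
      simp only [ne_eq, OfNat.ofNat_ne_zero, not_false_eq_true, zero_pow, zero_eq_neg, Rat.cast_eq_zero] at hρ
      exact pow_ne_zero m hc0' hρ
    · rw [hR]; push_cast at hρ ⊢
      linear_combination -v ^ 2 * hρ
    · rw [sub_add_cancel, h1]; push_cast; ring
    · rw [sub_add_cancel, h2]; push_cast; ring
  have hR0 : R ≠ 0 := by
    intro h0
    haveI := Fact.mk hpp
    obtain ⟨ρ, δ, δ', hρ, hδ, -, h1, h2⟩ := main p
    rw [h0] at hδ
    push_cast at hδ
    rcases mul_eq_zero.mp hδ with h3 | h3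
    · rw [h3, zero_add] at h1; apply hρ; linear_combination h1
    · rw [h3, zero_add] at h2; apply hρ; linear_combination -h2
  have hmul : ∀ (l : ℕ) [Fact l.Prime], padicValRat l ((p : ℚ) ^ 2 * R) = 2 * padicValRat l p + padicValRat l R := by
    intro l hl
    rw [padicValRat.mul (pow_ne_zero 2 hp0) hR0, padicValRat.pow]; push_cast; rfl
  have hcn : ∀ (l : ℕ) [Fact l.Prime], ‖(c : PadicAlgCl l)‖ ^ m = (l : ℝ) ^ (-((m : ℤ) * padicValInt l c)) := by
    intro l hl
    have := pa_norm l (r := (c : ℚ)) hc0'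
    rw [padicValRat.of_int] at this
    push_cast at this
    rw [this, ← zpow_natCast, ← zpow_mul]; congr 1; ring
  have self : padicValRat p ((p : ℚ) ^ 2 * R) = m * padicValInt p c := by
    haveI := Fact.mk hpp
    rw [hmul p, padicValRat.self hpp.one_lt]
    obtain ⟨ρ, δ, δ', hρ, hδ, hρc, h1, h2⟩ := main p
    have hβ := pa_cop_one p hβc hpc
    have hps := pa_self p
    have hp1 : (1 : ℝ) < p := by exact_mod_cast hpp.one_lt
    have hp00 : (p : ℝ) ≠ 0 := by positivity
    have hpl : ‖(p : PadicAlgCl p)‖ < 1 := by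
      rw [hps, zpow_neg_one]; exact inv_lt_one_of_one_lt₀ hp1
    have ha1 : 1 ≤ padicValInt p c := by
      rw [padicValInt]
      exact one_le_padicValNat_of_dvd (by simpa using hc0) (Int.natCast_dvd.mp hpc)
    have hρl : ‖ρ‖ ≤ ‖(p : PadicAlgCl p)‖ ^ 2 := by
      have : ‖ρ‖ ^ 2 ≤ (‖(p : PadicAlgCl p)‖ ^ 2) ^ 2 := by
        rw [hρc, hcn, hps, ← zpow_natCast, ← zpow_natCast, ← zpow_mul, ← zpow_mul]
        apply zpow_le_zpow_right₀ hp1.le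
        push_cast
        have : (4 : ℤ) ≤ m * padicValInt p c := by
          have : 4 * 1 ≤ m * padicValInt p c := Nat.mul_le_mul hm4 ha1
          exact_mod_cast this
        linarith
      exact le_of_sq_le_sq this (by positivity)
    have hRn : ‖δ‖ * ‖δ'‖ = (p : ℝ) ^ (-padicValRat p R) := by
      rw [← norm_mul, hδ, pa_norm p hR0]
    rw [hcn p] at hρc
    rw [hps] at hpl hρl
    have k1 := u_C hp hβ (by rw [hps]; exact hpl) (by rw [hps]; exact hρl) h1
    have k2 := u_C hp hβ (by rw [hps]; exact hpl) (by rw [hps, norm_neg]; exact hρl) h2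
    rw [norm_neg] at k2
    rw [hps] at k1 k2
    set a := padicValInt p c
    set w := padicValRat p R
    have mixed : ∀ x y : ℝ, x * y = (p : ℝ) ^ (-w) → ‖ρ‖ = (p : ℝ) ^ (-1 : ℤ) * x → y ^ (p - 1) = (p : ℝ) ^ (-1 : ℤ) → False := by
      intro x y hxy hx hy
      have e1 : (x * y) ^ (2 * (p - 1)) * ((p : ℝ) ^ (-1 : ℤ)) ^ (2 * (p - 1)) = (‖ρ‖ ^ 2) ^ (p - 1) * (y ^ (p - 1)) ^ 2 := by
        rw [hx]; ring
      rw [hxy, hρc, hy] at e1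
      simp only [← zpow_natCast, ← zpow_mul] at e1
      rw [← zpow_add₀ hp00, ← zpow_add₀ hp00] at e1
      have e2 := pa_inj p e1
      rcases hp with rfl | rfl <;> push_cast at e2 <;> omega
    have hpb : ∀ x y : ℝ, x = (p : ℝ) ^ (-1 : ℤ) * y → y = p * x := by
      intro x y h; rw [h, zpow_neg_one]; field_simp
    rcases k1 with k1 | k1 <;> rcases k2 with k2 | k2
    · have e1 : (‖δ‖ * ‖δ'‖) * ((p : ℝ) ^ (-1 : ℤ)) ^ 2 = ‖ρ‖ ^ 2 := by
        calc _ = ((p : ℝ) ^ (-1 : ℤ) * ‖δ‖) * ((p : ℝ) ^ (-1 : ℤ) * ‖δ'‖) := by ring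
          _ = _ := by rw [← k1, ← k2]; ring
      rw [hRn, hρc] at e1
      simp only [← zpow_natCast, ← zpow_mul] at e1
      rw [← zpow_add₀ hp00] at e1
      have e2 := pa_inj p e1
      push_cast at e2 ⊢
      linarith
    · exact (mixed _ _ hRn k1 k2).elim
    · exact (mixed _ _ ((mul_comm _ _).trans hRn) k2 k1).elim
    · exfalso
      have e1 : (‖δ‖ * ‖δ'‖) ^ (p - 1) = ((p : ℝ) ^ (-1 : ℤ)) ^ 2 := by
        rw [mul_pow, k1, k2]; ring
      rw [hRn] at e1
      simp only [← zpow_natCast, ← zpow_mul] at e1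
      have e2 := pa_inj p e1
      rcases hp with rfl | rfl <;> push_cast at e2 <;> omega
  refine ⟨mul_ne_zero (pow_ne_zero 2 hp0) hR0, self, ?_⟩
  intro l hl
  haveI := Fact.mk hl
  by_cases hlp : l = p
  · subst hlp; exact ⟨_, self⟩
  have hpl : padicValRat l p = 0 := by
    have h1 := pa_other l hpp (fun h => hlp h.symm)
    have h2 := pa_norm l hp0
    push_cast at h2
    rw [h2] at h1
    have := pa_inj l (h1.trans (zpow_zero _).symm)
    omega
  rw [hmul l, hpl]
  obtain ⟨ρ, δ, δ', hρ, hδ, hρc, h1, h2⟩ := main l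
  have hRn : ‖δ‖ * ‖δ'‖ = (l : ℝ) ^ (-padicValRat l R) := by
    rw [← norm_mul, hδ, pa_norm l hR0]
  have hl0 : (l : ℝ) ≠ 0 := by exact_mod_cast hl.ne_zero
  by_cases hlc : (l : ℤ) ∣ c
  · have hβ := pa_cop_one l hβc hlc
    have hρ1 : ‖ρ‖ ≤ 1 := by
      have : ‖ρ‖ ^ 2 ≤ 1 := by rw [hρc]; exact pow_le_one₀ (norm_nonneg _) (pa_int_le l c)
      exact (pow_le_one_iff_of_nonneg (norm_nonneg _) (by norm_num)).mp this
    have k1 := u_A hp hβ hρ1 (pa_other l hpp (fun h => hlp h.symm)) h1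
    have k2 := u_A hp hβ (by rwa [norm_neg]) (pa_other l hpp (fun h => hlp h.symm)) h2
    rw [norm_neg] at k2
    rw [hcn l] at hρc
    have one : ‖ρ‖ = (l : ℝ) ^ (-padicValRat l R) → ∃ n : ℕ, 2 * 0 + padicValRat l R = m * n := by
      intro e
      rw [e, ← zpow_natCast, ← zpow_mul] at hρc
      have e2 := pa_inj l hρc
      push_cast at e2
      have e3 : (2 : ℤ) ∣ m * padicValInt l c := ⟨padicValRat l R, by linarith⟩
      have e4 : 2 ∣ m * padicValInt l c := by exact_mod_cast e3
      have e5 : 2 ∣ padicValInt l c := (Nat.Coprime.dvd_mul_left (Nat.coprime_two_left.mpr hm)).mp e4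
      obtain ⟨n, hn⟩ := e5
      refine ⟨n, ?_⟩
      rw [hn] at e2; push_cast at e2; linarith
    rcases k1 with k1 | k1 <;> rcases k2 with k2 | k2 <;> rw [k1, k2] at hRn
    · refine ⟨0, ?_⟩
      rw [mul_one] at hRn
      have := pa_inj l ((zpow_zero _).trans hRn)
      push_cast; omega
    · exact one (by rw [← hRn, one_mul])
    · exact one (by rw [← hRn, mul_one])
    · refine ⟨padicValInt l c, ?_⟩
      rw [← pow_two, hρc] at hRn
      have := pa_inj l hRn
      linarith
  · have hρ1 : ‖ρ‖ = 1 := by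
      have : ‖ρ‖ ^ 2 = 1 := by rw [hρc, pa_int_one l hlc, one_pow]
      exact (pow_eq_one_iff_of_nonneg (norm_nonneg _) (by norm_num)).mp this
    rw [u_B hp (pa_int_le l β) hρ1 h1, u_B hp (pa_int_le l β) (by rwa [norm_neg]) h2, mul_one] at hRn
    refine ⟨0, ?_⟩
    have := pa_inj l ((zpow_zero _).trans hRn)
    push_cast; omega

end Vals


section ValsOne

theorem vals_one {p : ℕ} (hp : p = 5 ∨ p = 7) {c b : ℤ} {m : ℕ} (hm4 : 4 ≤ m) (hc0 : c ≠ 0) (hpc : (p : ℤ) ∣ c)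
    (hbc : IsCoprime b c) {y : ℚ} (h : y ^ p = (b : ℚ) ^ p + (c : ℚ) ^ m) :
    (p : ℚ) * (y - b) ≠ 0 ∧
    padicValRat p ((p : ℚ) * (y - b)) = m * padicValInt p c ∧
    ∀ l : ℕ, l.Prime → (padicValRat l ((p : ℚ) * (y - b)) = 0 ∨ padicValRat l ((p : ℚ) * (y - b)) = m * padicValInt l c) := by
  set R := y - b with hR
  have hpp : p.Prime := by rcases hp with rfl | rfl <;> norm_num
  have hp0 : (p : ℚ) ≠ 0 := by exact_mod_cast hpp.ne_zero
  have hc0' : (c : ℚ) ≠ 0 := by exact_mod_cast hc0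
  have main : ∀ (l : ℕ) [Fact l.Prime],
      ((R : PadicAlgCl l) + b) ^ p = (b : PadicAlgCl l) ^ p - (-((c : PadicAlgCl l) ^ m)) := by
    intro l hl
    have := congrArg (Rat.cast : ℚ → PadicAlgCl l) h
    push_cast at this
    rw [hR]; push_cast
    rw [sub_add_cancel, this]; ring
  have hR0 : R ≠ 0 := by
    intro h0
    rw [hR, sub_eq_zero] at h0
    rw [h0] at h
    exact pow_ne_zero m hc0' (by linarith)
  have hmul : ∀ (l : ℕ) [Fact l.Prime], padicValRat l ((p : ℚ) * R) = padicValRat l p + padicValRat l R := by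
    intro l hl
    rw [padicValRat.mul hp0 hR0]
  have hcn : ∀ (l : ℕ) [Fact l.Prime], ‖-((c : PadicAlgCl l) ^ m)‖ = (l : ℝ) ^ (-((m : ℤ) * padicValInt l c)) := by
    intro l hl
    have := pa_norm l (r := (c : ℚ)) hc0'
    rw [padicValRat.of_int] at this
    push_cast at this
    rw [norm_neg, norm_pow, this, ← zpow_natCast, ← zpow_mul]; congr 1; ring
  have hRn : ∀ (l : ℕ) [Fact l.Prime], ‖(R : PadicAlgCl l)‖ = (l : ℝ) ^ (-padicValRat l R) := fun l hl => pa_norm l hR0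
  have self : padicValRat p ((p : ℚ) * R) = m * padicValInt p c := by
    haveI := Fact.mk hpp
    rw [hmul p, padicValRat.self hpp.one_lt]
    have hβ := pa_cop_one p hbc hpc
    have hps := pa_self p
    have hp1 : (1 : ℝ) < p := by exact_mod_cast hpp.one_lt
    have hp00 : (p : ℝ) ≠ 0 := by positivity
    have hpl : ‖(p : PadicAlgCl p)‖ < 1 := by
      rw [hps, zpow_neg_one]; exact inv_lt_one_of_one_lt₀ hp1
    have ha1 : 1 ≤ padicValInt p c := by
      rw [padicValInt]
      exact one_le_padicValNat_of_dvd (by simpa using hc0) (Int.natCast_dvd.mp hpc)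
    have hρl : ‖-((c : PadicAlgCl p) ^ m)‖ ≤ ‖(p : PadicAlgCl p)‖ ^ 2 := by
      rw [hcn, hps, ← zpow_natCast, ← zpow_mul]
      apply zpow_le_zpow_right₀ hp1.le
      push_cast
      have : (4 : ℤ) ≤ m * padicValInt p c := by
        have : 4 * 1 ≤ m * padicValInt p c := Nat.mul_le_mul hm4 ha1
        exact_mod_cast this
      linarith
    have k1 := u_C hp hβ hpl hρl (main p)
    rw [hcn, hps, hRn] at k1
    rcases k1 with k1 | k1
    · rw [← zpow_add₀ hp00] at k1
      have e2 := pa_inj p k1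
      linarith
    · exfalso
      rw [← zpow_natCast, ← zpow_mul] at k1
      have e2 := pa_inj p k1
      rcases hp with rfl | rfl <;> push_cast at e2 <;> omega
  refine ⟨mul_ne_zero hp0 hR0, self, ?_⟩
  intro l hl
  haveI := Fact.mk hl
  by_cases hlp : l = p
  · subst hlp; exact Or.inr self
  have hpl : padicValRat l p = 0 := by
    have h1 := pa_other l hpp (fun h => hlp h.symm)
    have h2 := pa_norm l hp0
    push_cast at h2
    rw [h2] at h1
    have := pa_inj l (h1.trans (zpow_zero _).symm)
    omega
  rw [hmul l, hpl, zero_add]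
  have hl0 : (l : ℝ) ≠ 0 := by exact_mod_cast hl.ne_zero
  by_cases hlc : (l : ℤ) ∣ c
  · have hβ := pa_cop_one l hbc hlc
    have hρ1 : ‖-((c : PadicAlgCl l) ^ m)‖ ≤ 1 := by
      rw [norm_neg, norm_pow]; exact pow_le_one₀ (norm_nonneg _) (pa_int_le l c)
    have k1 := u_A hp hβ hρ1 (pa_other l hpp (fun h => hlp h.symm)) (main l)
    rw [hcn, hRn] at k1
    rcases k1 with k1 | k1
    · left
      have := pa_inj l (k1.trans (zpow_zero _).symm)
      omega
    · right
      have := pa_inj l k1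
      omega
  · left
    have hρ1 : ‖-((c : PadicAlgCl l) ^ m)‖ = 1 := by
      rw [norm_neg, norm_pow, pa_int_one l hlc, one_pow]
    have k := u_B hp (pa_int_le l b) hρ1 (main l)
    rw [hRn] at k
    have := pa_inj l (k.trans (zpow_zero _).symm)
    omega

end ValsOne


section PQ

theorem PQ_aux {W Z N Q m n : ℕ} {x : ℝ} (hW : 0 < W) (hZW : W + N ≤ Z) (hWQ : W ≤ Q)
    (hx0 : 0 ≤ x) (hx1 : x ≤ 1) (h1 : 2 * n * x ≤ 1) (h2 : 2 * n * x * Q < m * N)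
    (h : (Z : ℝ) ^ m * (1 - x) ^ n ≤ (W : ℝ) ^ m) : False := by
  have hW' : (0 : ℝ) < W := by exact_mod_cast hW
  have hWQ' : (W : ℝ) ≤ Q := by exact_mod_cast hWQ
  have hb : 1 - n * x ≤ (1 - x) ^ n := by
    have := one_add_mul_le_pow (a := -x) (by linarith) n
    calc 1 - n * x = 1 + n * -x := by ring
      _ ≤ _ := this
      _ = _ := by ring
  have hZ : (W : ℝ) ^ m * (1 + m * (N / W)) ≤ (Z : ℝ) ^ m := by
    have hN : (0 : ℝ) ≤ N / W := by positivity
    calc (W : ℝ) ^ m * (1 + m * (N / W)) ≤ (W : ℝ) ^ m * (1 + N / W) ^ m := by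
          gcongr; exact one_add_mul_le_pow (by linarith) m
      _ = (W + N : ℝ) ^ m := by rw [← mul_pow]; congr 1; field_simp
      _ ≤ _ := by gcongr; exact_mod_cast hZW
  have hnx : (1 : ℝ) / 2 ≤ 1 - n * x := by linarith
  have h3 : (W : ℝ) ^ m * ((1 + m * (N / W)) * (1 - n * x)) ≤ (W : ℝ) ^ m * 1 := by
    calc (W : ℝ) ^ m * ((1 + m * (N / W)) * (1 - n * x)) = ((W : ℝ) ^ m * (1 + m * (N / W))) * (1 - n * x) := by ring
      _ ≤ (Z : ℝ) ^ m * (1 - x) ^ n := by gcongr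
      _ ≤ _ := by rw [mul_one]; exact h
  have h4 : (1 + m * (N / W : ℝ)) * (1 - n * x) ≤ 1 := le_of_mul_le_mul_left h3 (by positivity)
  have h5 : (m * N : ℝ) * (1 - n * x) ≤ n * x * W := by
    have : W * ((1 + m * (N / W : ℝ)) * (1 - n * x)) ≤ W * 1 := by gcongr
    have e : W * ((1 + m * (N / W : ℝ)) * (1 - n * x)) = (W + m * N) * (1 - n * x) := by field_simp
    rw [e] at this; nlinarith
  have h6 : n * x * W ≤ n * x * Q := by gcongr
  have h7 : (m * N : ℝ) * (1 / 2) ≤ (m * N : ℝ) * (1 - n * x) := by gcongr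
  linarith

theorem PQ_eq {P Q N m n : ℕ} {x : ℝ} (hP : 0 < P) (hQ : 0 < Q) (hNP : N ∣ P) (hNQ : N ∣ Q)
    (hx0 : 0 ≤ x) (hx1 : x ≤ 1) (h1 : 2 * n * x ≤ 1) (h2 : 2 * n * x * Q < m * N)
    (h : (P : ℝ) ^ m * (1 - x) ^ n ≤ (Q : ℝ) ^ m) (h' : (Q : ℝ) ^ m * (1 - x) ^ n ≤ (P : ℝ) ^ m) : P = Q := by
  have step : ∀ {A B : ℕ}, N ∣ A → N ∣ B → A < B → A + N ≤ B := by
    intro A B hA hB hAB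
    have : N ∣ B - A := Nat.dvd_sub hB hA
    have := Nat.le_of_dvd (by omega) this
    omega
  rcases lt_trichotomy P Q with hl | hl | hl
  · exact (PQ_aux hP (step hNP hNQ hl) hl.le hx0 hx1 h1 h2 h').elim
  · exact hl
  · exact (PQ_aux hQ (step hNQ hNP hl) le_rfl hx0 hx1 h1 h2 h).elim

theorem arch_root {p : ℕ} (hp : p ≠ 0) {x L B : ℝ} (hx : 0 ≤ x) (hB : 0 ≤ B) (hBL : B ≤ L)
    (h1 : x ^ p ≤ L ^ p + B ^ p) (h2 : L ^ p ≤ x ^ p + B ^ p) : L - B ≤ x ∧ x ≤ L + B := by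
  have hL : 0 ≤ L := hB.trans hBL
  constructor
  · have h3 := pow_add_pow_le (sub_nonneg.mpr hBL) hB hp
    rw [sub_add_cancel] at h3
    exact le_of_pow_le_pow_left₀ hp hx (by linarith)
  · have h3 := pow_add_pow_le hL hB hp
    exact le_of_pow_le_pow_left₀ hp (by positivity) (by linarith)

end PQ


section FCore

theorem arch_one {p : ℕ} (hp : p ≠ 0) {y β : ℚ} {c : ℤ} {m : ℕ} (h : y ^ p = (β ^ 2) ^ p + (c : ℚ) ^ m) {L : ℝ} (hL : 0 < L)
    (hLC : L ^ (2 * p) = |(c : ℝ)| ^ m) (hBL : |(β : ℝ)| ≤ L) :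
    L ^ 2 - 2 * |(β : ℝ)| ^ 2 ≤ |(y : ℝ) - (β : ℝ) ^ 2| ∧ |(y : ℝ) - (β : ℝ) ^ 2| ≤ L ^ 2 + 2 * |(β : ℝ)| ^ 2 := by
  have h' : (y : ℝ) ^ p = ((β : ℝ) ^ 2) ^ p + (c : ℝ) ^ m := by exact_mod_cast h
  have e1 : |(y : ℝ)| ^ p = |((β : ℝ) ^ 2) ^ p + (c : ℝ) ^ m| := by rw [← abs_pow, h']
  have e2 : |(c : ℝ) ^ m| = (L ^ 2) ^ p := by rw [abs_pow, ← hLC, pow_mul]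
  have e3 : |((β : ℝ) ^ 2) ^ p| = (|(β : ℝ)| ^ 2) ^ p := by rw [abs_pow, abs_pow]
  obtain ⟨k1, k2⟩ := arch_root hp (abs_nonneg (y : ℝ)) (by positivity : 0 ≤ |(β : ℝ)| ^ 2)
    (by gcongr : |(β : ℝ)| ^ 2 ≤ L ^ 2)
    (by
      rw [e1, ← e2, ← e3]
      linarith [abs_add_le (((β : ℝ) ^ 2) ^ p) ((c : ℝ) ^ m)])
    (by
      rw [e1, ← e2, ← e3]
      have := abs_add_le (((β : ℝ) ^ 2) ^ p + (c : ℝ) ^ m) (-((β : ℝ) ^ 2) ^ p)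
      rw [abs_neg] at this
      have e4 : ((β : ℝ) ^ 2) ^ p + (c : ℝ) ^ m + -((β : ℝ) ^ 2) ^ p = (c : ℝ) ^ m := by ring
      rwa [e4] at this)
  have e5 : |(β : ℝ) ^ 2| = |(β : ℝ)| ^ 2 := abs_pow _ _
  have k3 := abs_sub_abs_le_abs_sub (y : ℝ) ((β : ℝ) ^ 2)
  have k4 := abs_sub (y : ℝ) ((β : ℝ) ^ 2)
  constructor <;> linarith

theorem arch_two {p : ℕ} (hp : p ≠ 0) {u v : ℚ} {β c : ℤ} {m : ℕ}
    (h : X ^ 2 + C ((c : ℚ) ^ m) ∣ (C u + C v * X) ^ p - C ((β : ℚ) ^ p) + X) {L : ℝ} (hL : 0 < L)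
    (hLC : L ^ (2 * p) = |(c : ℝ)| ^ m) (hBL : 2 * |(β : ℝ)| ≤ L) :
    (L - 2 * |(β : ℝ)|) ^ 2 ≤ |((((u - β) ^ 2 + (c : ℚ) ^ m * v ^ 2 : ℚ)) : ℝ)| ∧
    |((((u - β) ^ 2 + (c : ℚ) ^ m * v ^ 2 : ℚ)) : ℝ)| ≤ (L + 2 * |(β : ℝ)|) ^ 2 := by
  obtain ⟨ρ, hρ⟩ := IsAlgClosed.exists_pow_nat_eq (-(((c : ℚ) ^ m : ℚ) : ℂ)) (n := 2) (by norm_num)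
  have hB0 := abs_nonneg (β : ℝ)
  have hρn : ‖ρ‖ = L ^ p := by
    have : ‖ρ‖ ^ 2 = (L ^ p) ^ 2 := by
      rw [← norm_pow, hρ, norm_neg, ← pow_mul, mul_comm p 2, hLC]
      push_cast
      rw [norm_pow]; congr 1
      exact Complex.norm_intCast c
    exact (pow_left_inj₀ (norm_nonneg _) (by positivity) (by norm_num)).mp this
  have hβn : ‖(β : ℂ)‖ = |(β : ℝ)| := Complex.norm_intCast β
  have one : ∀ σ : ℂ, σ ^ 2 = -(((c : ℚ) ^ m : ℚ) : ℂ) → ‖σ‖ = L ^ p →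
      L - 2 * |(β : ℝ)| ≤ ‖(u : ℂ) + v * σ - β‖ ∧ ‖(u : ℂ) + v * σ - β‖ ≤ L + 2 * |(β : ℝ)| := by
    intro σ hσ hσn
    have h1 := two_sq_roots h hσ
    set z := (u : ℂ) + v * σ
    push_cast at h1
    have e1 : ‖z‖ ^ p = ‖(β : ℂ) ^ p - σ‖ := by rw [← norm_pow, h1]
    have e2 : ‖(β : ℂ) ^ p‖ = |(β : ℝ)| ^ p := by rw [norm_pow, hβn]
    obtain ⟨k1, k2⟩ := arch_root (L := L) hp (norm_nonneg z) hB0 (by linarith)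
      (by rw [e1, ← e2, ← hσn]; linarith [norm_sub_le ((β : ℂ) ^ p) σ])
      (by
        rw [e1, ← e2, ← hσn]
        have := norm_sub_norm_le σ ((β : ℂ) ^ p)
        rw [norm_sub_rev] at this; linarith)
    have k3 := norm_sub_norm_le z (β : ℂ)
    have k4 := norm_sub_le z (β : ℂ)
    rw [hβn] at k3 k4
    constructor <;> linarith
  obtain ⟨a1, a2⟩ := one ρ hρ hρn
  obtain ⟨b1, b2⟩ := one (-ρ) (by rw [neg_sq]; exact hρ) (by rw [norm_neg]; exact hρn)
  have e : |((((u - β) ^ 2 + (c : ℚ) ^ m * v ^ 2 : ℚ)) : ℝ)| = ‖(u : ℂ) + v * ρ - β‖ * ‖(u : ℂ) + v * (-ρ) - β‖ := by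
    rw [← norm_mul, ← Complex.norm_ratCast]
    congr 1
    push_cast at hρ ⊢
    linear_combination v ^ 2 * hρ
  rw [e]
  have : 0 ≤ L - 2 * |(β : ℝ)| := by linarith
  constructor
  · rw [pow_two]; gcongr
  · rw [pow_two]; gcongr

set_option maxHeartbeats 1000000 in
theorem F_arith {p g h T C m : ℕ} (hp : p = 5 ∨ p = 7) (hm : 4 * p - 1 ≤ m) (hC : p ≤ C) (hgh : C = g * h) {L B r R : ℝ} (hL : 0 < L) (hB : 0 ≤ B)
    (hLC : L ^ (2 * p) = (C : ℝ) ^ m) (hBC : B ^ (2 * p) * (C : ℝ) ^ (4 * p) ≤ 2 * (C : ℝ) ^ (m + 1))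
    (hBL : 2 * B ≤ L)
    (hg : (g : ℝ) ^ m = p * r) (hT : (T : ℝ) ^ m = p ^ 2 * R)
    (hr1 : L ^ 2 - 2 * B ^ 2 ≤ r) (hr2 : r ≤ L ^ 2 + 2 * B ^ 2)
    (hR1 : (L - 2 * B) ^ 2 ≤ R) (hR2 : R ≤ (L + 2 * B) ^ 2)
    (hT0 : 0 < T) (hpT : p ∣ T) (hpg : p ∣ g) : T ^ p * h = g ^ (2 * p - 1) := by
  have hp0 : 0 < p := by omega
  have hC0 : 0 < C := by omega
  have hC0' : (0 : ℝ) < C := by exact_mod_cast hC0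
  have hg0 : 0 < g := Nat.pos_of_ne_zero (by rintro rfl; omega)
  have hh0 : 0 < h := Nat.pos_of_ne_zero (by rintro rfl; omega)
  have hNP : p ^ p ∣ T ^ p * h := (pow_dvd_pow_of_dvd hpT p).mul_right h
  have hNQ : p ^ p ∣ g ^ (2 * p - 1) :=
    (pow_dvd_pow_of_dvd hpg p).trans (pow_dvd_pow g (by omega))
  have hr0 : 0 ≤ r := by
    have : (2 * B) ^ 2 ≤ L ^ 2 := by gcongr
    linarith [sq_nonneg B]
  have hR0 : 0 ≤ R := (sq_nonneg _).trans hR1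
  -- bound for g
  have hgp : g ^ p ≤ 2 * C := by
    have h1 : (g : ℝ) ^ m ≤ p * (2 * L ^ 2) := by
      rw [hg]; gcongr
      have : (2 * B) ^ 2 ≤ L ^ 2 := by gcongr
      linarith [sq_nonneg B]
    have h2 : ((g : ℝ) ^ p) ^ m ≤ (2 * C : ℝ) ^ m := by
      calc ((g : ℝ) ^ p) ^ m = ((g : ℝ) ^ m) ^ p := by rw [← pow_mul, ← pow_mul, mul_comm]
        _ ≤ (p * (2 * L ^ 2)) ^ p := by gcongr
        _ = (2 * p : ℝ) ^ p * (L ^ (2 * p)) := by rw [pow_mul]; rw [← mul_pow]; ring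
        _ ≤ 2 ^ m * (C : ℝ) ^ m := by
          rw [hLC]; gcongr
          calc (2 * p : ℝ) ^ p ≤ 2 ^ (4 * p - 1) := by rcases hp with rfl | rfl <;> norm_num
            _ ≤ 2 ^ m := by gcongr; norm_num
        _ = _ := by rw [mul_pow]
    have h3 := le_of_pow_le_pow_left₀ (by omega) (by positivity) h2
    exact_mod_cast h3
  set x : ℝ := 2 * (B / L) with hx
  have hx0 : 0 ≤ x := by positivity
  have hx1 : x ≤ 1 := by rw [hx, ← mul_div_assoc, div_le_one hL]; exact hBL
  have hBx : 2 * B = x * L := by rw [hx]; field_simp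
  have hgm : 0 < (g : ℝ) ^ m := by positivity
  -- comparison
  have eP : ((T ^ p * h : ℕ) : ℝ) ^ m * (g : ℝ) ^ m = (p : ℝ) ^ (2 * p) * (R * L ^ 2) ^ p := by
    calc ((T ^ p * h : ℕ) : ℝ) ^ m * (g : ℝ) ^ m = ((T : ℝ) ^ m) ^ p * ((C : ℕ) : ℝ) ^ m := by
          rw [hgh]; push_cast; rw [mul_pow, mul_pow, ← pow_mul, ← pow_mul, mul_comm p m]; ring
      _ = _ := by rw [hT, ← hLC, mul_pow, mul_pow, ← pow_mul, ← pow_mul]; ring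
  have eQ : ((g ^ (2 * p - 1) : ℕ) : ℝ) ^ m * (g : ℝ) ^ m = (p : ℝ) ^ (2 * p) * (r ^ 2) ^ p := by
    calc ((g ^ (2 * p - 1) : ℕ) : ℝ) ^ m * (g : ℝ) ^ m = ((g : ℝ) ^ m) ^ (2 * p) := by
          push_cast; rw [← mul_pow, ← pow_succ, ← pow_mul, ← pow_mul, mul_comm]; congr 2; omega
      _ = _ := by rw [hg, mul_pow, ← pow_mul]
  have hxL : r ≥ L ^ 2 * (1 - x ^ 2 / 2) := by
    have hB' : B = x * L / 2 := by linarith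
    calc r ≥ L ^ 2 - 2 * B ^ 2 := hr1
      _ = _ := by rw [hB']; ring
  have hxL2 : r ≤ L ^ 2 * (1 + x ^ 2 / 2) := by
    have hB' : B = x * L / 2 := by linarith
    calc r ≤ L ^ 2 + 2 * B ^ 2 := hr2
      _ = _ := by rw [hB']; ring
  have hxR1 : L ^ 2 * (1 - x) ^ 2 ≤ R := by
    calc L ^ 2 * (1 - x) ^ 2 = (L - 2 * B) ^ 2 := by rw [hBx]; ring
      _ ≤ R := hR1
  have hxR2 : R ≤ L ^ 2 * (1 + x) ^ 2 := by
    calc R ≤ (L + 2 * B) ^ 2 := hR2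
      _ = _ := by rw [hBx]; ring
  have hx1' : 0 ≤ 1 - x := by linarith
  have c1 : R * L ^ 2 * (1 - x) ^ 4 ≤ r ^ 2 := by
    have a1 : (1 + x) * (1 - x) ^ 2 ≤ 1 - x ^ 2 / 2 := by nlinarith [mul_nonneg hx0 hx1', mul_nonneg hx0 (mul_nonneg hx0 hx1')]
    have a0 : 0 ≤ (1 + x) * (1 - x) ^ 2 := by positivity
    calc R * L ^ 2 * (1 - x) ^ 4 ≤ (L ^ 2 * (1 + x) ^ 2) * L ^ 2 * (1 - x) ^ 4 := by gcongr
      _ = (L ^ 2 * ((1 + x) * (1 - x) ^ 2)) ^ 2 := by ring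
      _ ≤ (L ^ 2 * (1 - x ^ 2 / 2)) ^ 2 := by gcongr
      _ ≤ r ^ 2 := by
        have : 0 ≤ L ^ 2 * (1 - x ^ 2 / 2) := by
          have : 0 ≤ 1 - x ^ 2 / 2 := a0.trans a1
          positivity
        gcongr
  have c2 : r ^ 2 * (1 - x) ^ 4 ≤ R * L ^ 2 := by
    have a1 : (1 + x ^ 2 / 2) * (1 - x) ≤ 1 := by nlinarith [mul_nonneg hx0 hx1', mul_nonneg hx0 (mul_nonneg hx0 hx1')]
    have a0 : 0 ≤ (1 + x ^ 2 / 2) * (1 - x) := by positivity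
    calc r ^ 2 * (1 - x) ^ 4 ≤ (L ^ 2 * (1 + x ^ 2 / 2)) ^ 2 * (1 - x) ^ 4 := by gcongr
      _ = L ^ 2 * (1 - x) ^ 2 * L ^ 2 * ((1 + x ^ 2 / 2) * (1 - x)) ^ 2 := by ring
      _ ≤ L ^ 2 * (1 - x) ^ 2 * L ^ 2 * 1 ^ 2 := by gcongr
      _ ≤ R * L ^ 2 := by rw [one_pow, mul_one]; gcongr
  have f1 : ((T ^ p * h : ℕ) : ℝ) ^ m * (1 - x) ^ (4 * p) ≤ ((g ^ (2 * p - 1) : ℕ) : ℝ) ^ m := by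
    refine le_of_mul_le_mul_right ?_ hgm
    calc ((T ^ p * h : ℕ) : ℝ) ^ m * (1 - x) ^ (4 * p) * (g : ℝ) ^ m
        = (((T ^ p * h : ℕ) : ℝ) ^ m * (g : ℝ) ^ m) * (1 - x) ^ (4 * p) := by ring
      _ = (p : ℝ) ^ (2 * p) * (R * L ^ 2 * (1 - x) ^ 4) ^ p := by rw [eP, pow_mul (1 - x), mul_pow (R * L ^ 2)]; ring
      _ ≤ (p : ℝ) ^ (2 * p) * (r ^ 2) ^ p := by gcongr
      _ = _ := eQ.symm
  have f2 : ((g ^ (2 * p - 1) : ℕ) : ℝ) ^ m * (1 - x) ^ (4 * p) ≤ ((T ^ p * h : ℕ) : ℝ) ^ m := by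
    refine le_of_mul_le_mul_right ?_ hgm
    calc ((g ^ (2 * p - 1) : ℕ) : ℝ) ^ m * (1 - x) ^ (4 * p) * (g : ℝ) ^ m
        = (((g ^ (2 * p - 1) : ℕ) : ℝ) ^ m * (g : ℝ) ^ m) * (1 - x) ^ (4 * p) := by ring
      _ = (p : ℝ) ^ (2 * p) * (r ^ 2 * (1 - x) ^ 4) ^ p := by rw [eQ, pow_mul (1 - x), mul_pow (r ^ 2)]; ring
      _ ≤ (p : ℝ) ^ (2 * p) * (R * L ^ 2) ^ p := by gcongr
      _ = _ := eP.symm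
  -- size
  set Q := g ^ (2 * p - 1) with hQ
  have hQ0 : 0 < Q := by positivity
  have hQN : p ^ p ≤ Q := Nat.le_of_dvd hQ0 hNQ
  have hQp : (Q : ℝ) ^ (2 * p) ≤ (2 * C : ℝ) ^ (4 * p - 2) := by
    calc (Q : ℝ) ^ (2 * p) = ((g : ℝ) ^ p) ^ (4 * p - 2) := by
          rw [hQ]; push_cast; rw [← pow_mul, ← pow_mul]; congr 1
          rcases hp with rfl | rfl <;> norm_num
      _ ≤ _ := by gcongr; exact_mod_cast hgp
  have hxQ : B / L * Q ≤ 4 := by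
    have : (B / L * Q) ^ (2 * p) ≤ 4 ^ (2 * p) := by
      have e1 : (B / L) ^ (2 * p) * (C : ℝ) ^ (4 * p) ≤ 2 * C := by
        rw [div_pow, hLC, div_mul_eq_mul_div, div_le_iff₀ (by positivity)]
        calc _ ≤ _ := hBC
          _ = _ := by ring
      have e2 : (2 * C : ℝ) ^ (4 * p - 2) * C ^ 2 ≤ 2 ^ (4 * p - 2) * C ^ (4 * p) := by
        rw [mul_pow, mul_assoc, ← pow_add]; apply le_of_eq; congr 2; omega
      have hC1 : (1 : ℝ) ≤ C := by exact_mod_cast hC0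
      have e3 : (B / L * Q) ^ (2 * p) * C ^ 2 ≤ 2 ^ (4 * p) * C ^ 2 := by
        calc (B / L * Q) ^ (2 * p) * C ^ 2 = (B / L) ^ (2 * p) * ((Q : ℝ) ^ (2 * p) * C ^ 2) := by rw [mul_pow]; ring
          _ ≤ (B / L) ^ (2 * p) * ((2 * C : ℝ) ^ (4 * p - 2) * C ^ 2) := by gcongr
          _ ≤ (B / L) ^ (2 * p) * (2 ^ (4 * p - 2) * C ^ (4 * p)) := by gcongr
          _ = 2 ^ (4 * p - 2) * ((B / L) ^ (2 * p) * C ^ (4 * p)) := by ring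
          _ ≤ 2 ^ (4 * p - 2) * (2 * C) := by gcongr
          _ ≤ 2 ^ (4 * p - 2) * (4 * C ^ 2) := mul_le_mul_of_nonneg_left (by nlinarith) (by positivity)
          _ = 2 ^ (4 * p) * C ^ 2 := by
            have : (2 : ℝ) ^ (4 * p) = 2 ^ (4 * p - 2) * 2 ^ 2 := by rw [← pow_add]; congr 1; omega
            rw [this]; ring
      have e4 := le_of_mul_le_mul_right e3 (by positivity)
      calc _ ≤ _ := e4
        _ = ((2 : ℝ) ^ 2) ^ (2 * p) := by rw [← pow_mul]; congr 1; ring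
        _ = _ := by norm_num
    exact le_of_pow_le_pow_left₀ (by omega) (by norm_num) this
  have hQN' : (p : ℝ) ^ p ≤ Q := by exact_mod_cast hQN
  have hε0 : 0 ≤ B / L := by positivity
  have hεN : B / L * p ^ p ≤ 4 := (mul_le_mul_of_nonneg_left hQN' hε0).trans hxQ
  have hm' : (1 : ℝ) ≤ m := by exact_mod_cast (by omega : 1 ≤ m)
  refine PQ_eq (N := p ^ p) (n := 4 * p) (x := x) (by positivity) hQ0 hNP hNQ hx0 hx1 ?_ ?_ f1 f2
  · rw [hx]; clear_value x
    generalize B / L = ε at *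
    rcases hp with rfl | rfl <;> push_cast at hεN ⊢ <;> linarith
  · rw [hx]
    have h64 : 2 * ((4 * p : ℕ) : ℝ) * (2 * (B / L)) * Q ≤ 64 * p := by
      calc 2 * ((4 * p : ℕ) : ℝ) * (2 * (B / L)) * Q = 16 * p * (B / L * Q) := by push_cast; ring
        _ ≤ 16 * p * 4 := by gcongr
        _ = _ := by ring
    refine lt_of_le_of_lt h64 ?_
    calc (64 * p : ℝ) < 1 * ((p ^ p : ℕ) : ℝ) := by rcases hp with rfl | rfl <;> norm_num
      _ ≤ _ := by gcongr

end FCore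


section FMain

theorem F_core {p : ℕ} (hp : p = 5 ∨ p = 7) {c β : ℤ} {m : ℕ} (hm : Odd m) (hm4 : 4 * p - 1 ≤ m) (hc0 : c ≠ 0)
    (hpc : (p : ℤ) ∣ c) (hβc : IsCoprime β c) (hbd : |β| ^ (2 * p) * |c| ^ (4 * p) ≤ 2 * |c| ^ (m + 1))
    {y u v : ℚ} (hy : y ^ p = ((β : ℚ) ^ 2) ^ p + (c : ℚ) ^ m)
    (h : X ^ 2 + C ((c : ℚ) ^ m) ∣ (C u + C v * X) ^ p - C ((β : ℚ) ^ p) + X) : False := by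
  have hpp : p.Prime := by rcases hp with rfl | rfl <;> norm_num
  have hFp := Fact.mk hpp
  have hp0 : p ≠ 0 := hpp.ne_zero
  obtain ⟨r0, rself, rall⟩ := vals_one hp (b := β ^ 2) (m := m) (by omega) hc0 hpc (hβc.pow_left) (y := y) (by push_cast; exact hy)
  obtain ⟨R0, Rself, Rall⟩ := vals_two hp hm (by omega) hc0 hpc hβc h
  obtain ⟨g, hg⟩ := rat_is_pow (m := m) r0 (by
    intro l hl
    rcases rall l hl with h1 | h1
    · exact ⟨0, by rw [h1]; simp⟩
    · exact ⟨_, h1⟩)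
  obtain ⟨T, hT⟩ := rat_is_pow R0 Rall
  have hm0 : m ≠ 0 := by omega
  have hg0 : g ≠ 0 := by
    rintro rfl
    rw [Nat.cast_zero, zero_pow hm0, abs_eq_zero] at hg
    exact r0 hg
  have hT0 : T ≠ 0 := by
    rintro rfl
    rw [Nat.cast_zero, zero_pow hm0, abs_eq_zero] at hT
    exact R0 hT
  have vabs : ∀ (l : ℕ) (q : ℚ), padicValRat l |q| = padicValRat l q := by
    intro l q
    rcases abs_choice q with h1 | h1 <;> rw [h1]
    exact padicValRat.neg q
  have vpow : ∀ (l : ℕ) [Fact l.Prime] (G : ℕ) (q : ℚ), |q| = (G : ℚ) ^ m → padicValRat l q = m * padicValNat l G := by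
    intro l hl G q hq
    rw [← vabs l q, hq, padicValRat.pow, padicValRat.of_nat]
  have hm0' : (m : ℤ) ≠ 0 := by exact_mod_cast hm0
  have vg : padicValNat p g = padicValInt p c := by
    rw [vpow p g _ hg] at rself
    exact_mod_cast mul_left_cancel₀ hm0' rself
  have vT : padicValNat p T = padicValInt p c := by
    rw [vpow p T _ hT] at Rself
    exact_mod_cast mul_left_cancel₀ hm0' Rself
  have hcn0 : c.natAbs ≠ 0 := by simpa using hc0
  have hgc : g ∣ c.natAbs := by
    rw [← Nat.factorization_prime_le_iff_dvd hg0 hcn0]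
    intro l hl
    have hFl := Fact.mk hl
    rw [Nat.factorization_def _ hl, Nat.factorization_def _ hl]
    rcases rall l hl with h1 | h1 <;> rw [vpow l g _ hg] at h1
    · rcases mul_eq_zero.mp h1 with h2 | h2
      · exact (hm0' h2).elim
      · have : padicValNat l g = 0 := by exact_mod_cast h2
        omega
    · have : padicValNat l g = padicValInt l c := by exact_mod_cast mul_left_cancel₀ hm0' h1
      rw [this, padicValInt]
  obtain ⟨h', hh⟩ := hgc
  have ha1 : 1 ≤ padicValInt p c := by
    rw [padicValInt]
    exact one_le_padicValNat_of_dvd hcn0 (Int.natCast_dvd.mp hpc)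
  have hpC : p ≤ c.natAbs := Nat.le_of_dvd (Nat.pos_of_ne_zero hcn0) (Int.natCast_dvd.mp hpc)
  have hh0 : h' ≠ 0 := by rintro rfl; omega
  have vh : padicValNat p h' = 0 := by
    have : padicValNat p c.natAbs = padicValNat p g + padicValNat p h' := by rw [hh, padicValNat.mul hg0 hh0]
    rw [vg, padicValInt] at this; omega
  have hpT : p ∣ T := dvd_of_one_le_padicValNat (by omega)
  have hpg : p ∣ g := dvd_of_one_le_padicValNat (by omega)
  set Cn := c.natAbs with hCn
  have hCR : |(c : ℝ)| = (Cn : ℝ) := by rw [hCn, Nat.cast_natAbs, Int.cast_abs]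
  have hCn0 : (0 : ℝ) < Cn := by exact_mod_cast Nat.pos_of_ne_zero hcn0
  set L : ℝ := ((Cn : ℝ) ^ m) ^ (((2 * p : ℕ) : ℝ)⁻¹) with hL
  have hL0 : 0 < L := by positivity
  have hLC : L ^ (2 * p) = (Cn : ℝ) ^ m := Real.rpow_inv_natCast_pow (by positivity) (by omega)
  have hBC : |(β : ℝ)| ^ (2 * p) * (Cn : ℝ) ^ (4 * p) ≤ 2 * (Cn : ℝ) ^ (m + 1) := by
    rw [← hCR]; exact_mod_cast hbd
  have hC5 : (5 : ℝ) ≤ Cn := by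
    have : 5 ≤ Cn := by omega
    exact_mod_cast this
  have hBL : 2 * |(β : ℝ)| ≤ L := by
    have : (2 * |(β : ℝ)|) ^ (2 * p) ≤ L ^ (2 * p) := by
      rw [hLC]
      have e1 : (2 : ℝ) ^ (2 * p) * 2 * Cn ≤ (Cn : ℝ) ^ (4 * p) := by
        have e2 : (Cn : ℝ) ^ (4 * p) = (Cn : ℝ) ^ (4 * p - 1) * Cn := by rw [← pow_succ]; congr 1; omega
        rw [e2]; gcongr
        calc (2 : ℝ) ^ (2 * p) * 2 = 2 ^ (2 * p + 1) := by rw [pow_succ]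
          _ ≤ 2 ^ (4 * p - 1) := pow_le_pow_right₀ (by norm_num) (by omega)
          _ ≤ _ := by gcongr; linarith
      refine le_of_mul_le_mul_right ?_ (by positivity : (0 : ℝ) < (Cn : ℝ) ^ (4 * p))
      calc (2 * |(β : ℝ)|) ^ (2 * p) * (Cn : ℝ) ^ (4 * p) = 2 ^ (2 * p) * (|(β : ℝ)| ^ (2 * p) * (Cn : ℝ) ^ (4 * p)) := by
            rw [mul_pow]; ring
        _ ≤ 2 ^ (2 * p) * (2 * (Cn : ℝ) ^ (m + 1)) := by gcongr
        _ = (Cn : ℝ) ^ m * ((2 : ℝ) ^ (2 * p) * 2 * Cn) := by rw [pow_succ (Cn : ℝ)]; ring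
        _ ≤ _ := by gcongr
    exact le_of_pow_le_pow_left₀ (by omega) hL0.le this
  have a1 := arch_one (β := β) hp0 hy hL0 (by rw [hCR]; exact hLC) (by push_cast; linarith [abs_nonneg (β : ℝ)])
  have a2 := arch_two hp0 h hL0 (by rw [hCR]; exact hLC) hBL
  have hgR : (g : ℝ) ^ m = p * |(y : ℝ) - ((β : ℚ) : ℝ) ^ 2| := by
    have := congrArg (Rat.cast : ℚ → ℝ) hg
    rw [abs_mul] at this
    push_cast at this ⊢
    rw [← this, Nat.abs_cast]
  have hTR : (T : ℝ) ^ m = (p : ℝ) ^ 2 * |((((u - β) ^ 2 + (c : ℚ) ^ m * v ^ 2 : ℚ)) : ℝ)| := by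
    have := congrArg (Rat.cast : ℚ → ℝ) hT
    rw [abs_mul] at this
    push_cast at this ⊢
    rw [← this, abs_pow, Nat.abs_cast]
  have fin := F_arith hp hm4 hpC hh hL0 (abs_nonneg (β : ℝ)) hLC hBC hBL hgR hTR (by exact_mod_cast a1.1) (by exact_mod_cast a1.2)
    a2.1 a2.2 (Nat.pos_of_ne_zero hT0) hpT hpg
  have vfin := congrArg (padicValNat p) fin
  rw [padicValNat.mul (pow_ne_zero _ hT0) hh0, padicValNat.pow, padicValNat.pow, vT, vg, vh] at vfin
  rcases hp with rfl | rfl <;> omega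

theorem F_main {p d k : ℕ} {c : ℤ} (hp : p = 5 ∨ p = 7) (hd : 4 * p ≤ d) (hev : Even d) (hpd : p ∣ d) (hc0 : c ≠ 0)
    (hpc : (p : ℤ) ∣ c) (h1 : KeyP d c k p 1) (h2 : KeyP d c k p 2) : False := by
  have hpp : p.Prime := by rcases hp with rfl | rfl <;> norm_num
  obtain ⟨e, he⟩ : 2 * p ∣ d := by
    apply Nat.Coprime.mul_dvd_of_dvd_of_dvd _ hev.two_dvd hpd
    rcases hp with rfl | rfl <;> norm_num
  obtain ⟨y, hy⟩ := conc_one h1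
  obtain ⟨u, v, huv⟩ := conc_two h2
  have hd2 : d / 2 = e * p := by rw [he, mul_assoc, Nat.mul_div_cancel_left _ (by norm_num), mul_comm]
  have hm := m_odd hev (by omega) k
  have hmb := m_bound (d := d) (by omega) k
  have hcabs : (p : ℤ) ≤ |c| := by
    have := Int.le_of_dvd (abs_pos.mpr hc0) ((dvd_abs _ _).mpr hpc)
    exact this
  have h5 : 5 ≤ p := by omega
  have hab := aS_bound (d := d) (by omega) (c := c) (by have : (5 : ℤ) ≤ p := by exact_mod_cast h5
                                                        linarith) k
  have hcop : IsCoprime (aS d c k ^ e) c := (aS_cop (by omega) c k).pow_left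
  refine F_core hp hm (by omega) hc0 hpc hcop ?_ (y := y) (u := u) (v := v) ?_ ?_
  · have e1 : d ^ (k + 1) - 1 + 1 = d ^ (k + 1) := by
      have : 0 < d ^ (k + 1) := Nat.pow_pos (by omega)
      omega
    rw [e1]
    refine le_trans ?_ hab
    rw [abs_pow, ← pow_mul]
    have e2 : e * (2 * p) = d := by rw [he]; ring
    rw [e2]
    have : (1 : ℤ) ≤ |c| := Int.one_le_abs hc0
    gcongr
  · rw [hy]; push_cast
    rw [← pow_mul, ← pow_mul]
    congr 2; rw [he]; ring
  · rw [hd2, pow_mul] at huv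
    push_cast
    exact huv

end FMain


section HNorm

theorem norm_ex (D : ℚ) (q : ℚ[X]) : ∃ N : ℚ, ∀ (K : Type) [Field K] [CharZero K] (θ : ℕ → K),
    X ^ 5 + C (D : K) = ∏ i ∈ Finset.range 5, (X - C (θ i)) →
    (N : K) = ∏ i ∈ Finset.range 5, eval₂ (Rat.castHom K) (θ i) q := by
  refine ⟨resultant (X ^ 5 + C D) q 5 q.natDegree, ?_⟩
  intro K _ _ θ h
  have h1 := resultant_map_map (X ^ 5 + C D) q 5 q.natDegree (Rat.castHom K)
  rw [Rat.coe_castHom] at h1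
  rw [← h1]
  have e : (X ^ 5 + C D : ℚ[X]).map (Rat.castHom K) = X ^ 5 + C (D : K) := by simp
  rw [e]
  have hm : (X ^ 5 + C (D : K) : K[X]).Monic := monic_X_pow_add_C _ (by norm_num)
  have hd : (X ^ 5 + C (D : K) : K[X]).natDegree = 5 := natDegree_X_pow_add_C
  have hr : (X ^ 5 + C (D : K) : K[X]).roots = (Finset.range 5).val.map θ := by
    have e3 : Multiset.map (fun i => X - C (θ i)) (Finset.range 5).val = ((Finset.range 5).val.map θ).map (fun a => X - C a) := by
      rw [Multiset.map_map]; rfl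
    rw [h, Finset.prod, e3, roots_multiset_prod_X_sub_C]
  have hs : (X ^ 5 + C (D : K) : K[X]).Splits := by
    rw [h]
    apply Splits.prod
    intro i _
    exact Splits.X_sub_C _
  have h2 := resultant_eq_prod_eval (X ^ 5 + C (D : K)) (q.map (Rat.castHom K)) q.natDegree natDegree_map_le hs
  rw [hd] at h2
  rw [h2, hm.leadingCoeff, one_pow, one_mul, hr, Multiset.map_map, Finset.prod]
  congr 1
  apply Multiset.map_congr rfl
  intro i _
  simp [eval_map]

theorem roots_ex (K : Type) [Field K] [CharZero K] [IsAlgClosed K] (D : K) {α : K} (hα : α ^ 5 = -D) :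
    ∃ ζ : K, IsPrimitiveRoot ζ 5 ∧ X ^ 5 + C D = ∏ i ∈ Finset.range 5, (X - C (ζ ^ i * α)) := by
  have : NeZero ((5 : ℕ) : K) := ⟨by norm_num⟩
  obtain ⟨ζ, hζ⟩ := HasEnoughRootsOfUnity.exists_primitiveRoot K 5
  refine ⟨ζ, hζ, ?_⟩
  rw [← X_pow_sub_C_eq_prod hζ (by norm_num) hα]
  simp

end HNorm

section HLoc
variable {K : Type*} [NormedField K] [IsUltrametricDist K]

theorem loc_A {x b θ : K} (hb : ‖b‖ = 1) (hθ : ‖θ‖ < ‖(2 : K)‖ ^ 2) (h : 4 * x ^ 2 * (x ^ 2 - b) = -θ) :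
    ∃ ε : ℕ, ε ≤ 1 ∧ ‖x‖ ^ 2 * (‖(2 : K)‖ ^ 2) ^ ε = ‖θ‖ ^ ε ∧ ‖2 * x ^ 2 - b - (-1) ^ ε * b‖ < ‖(2 : K)‖ := by
  have h40 : 0 < ‖(2 : K)‖ ^ 2 := (norm_nonneg _).trans_lt hθ
  have h20 : 0 < ‖(2 : K)‖ := by
    rcases (norm_nonneg (2 : K)).eq_or_lt with h0 | h0
    · rw [← h0] at h40; norm_num at h40
    · exact h0
  have e : ‖(2 : K)‖ ^ 2 * (‖x‖ ^ 2 * ‖x ^ 2 - b‖) = ‖θ‖ := by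
    have := congrArg norm h
    rw [norm_neg] at this
    rw [← this, norm_mul, norm_mul, norm_pow]
    have : (4 : K) = 2 ^ 2 := by norm_num
    rw [this, norm_pow]; ring
  have e1 : ‖x‖ ^ 2 * ‖x ^ 2 - b‖ < 1 := by
    rw [← e] at hθ
    by_contra hh
    push Not at hh
    nlinarith
  have hx2 : ‖x ^ 2‖ = ‖x‖ ^ 2 := norm_pow _ _
  rcases lt_trichotomy ‖x ^ 2‖ 1 with h1 | h1 | h1
  · refine ⟨1, le_rfl, ?_, ?_⟩
    · have : ‖x ^ 2 - b‖ = 1 := by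
        rw [sub_eq_add_neg, add_comm, u_add_eq (by rw [norm_neg, hb]; exact h1), norm_neg, hb]
      rw [this] at e
      rw [pow_one, pow_one, ← e]; ring
    · have : 2 * x ^ 2 - b - (-1) ^ 1 * b = 2 * x ^ 2 := by ring
      rw [this, norm_mul]
      nlinarith
  · refine ⟨0, by norm_num, ?_, ?_⟩
    · rw [← hx2, h1]; simp
    · have : 2 * x ^ 2 - b - (-1) ^ 0 * b = 2 * (x ^ 2 - b) := by ring
      rw [this, norm_mul]
      rw [← hx2, h1, one_mul] at e1
      nlinarith
  · exfalso
    have : ‖x ^ 2 - b‖ = ‖x ^ 2‖ := by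
      rw [sub_eq_add_neg, u_add_eq (by rw [norm_neg, hb]; exact h1)]
    rw [this, ← hx2] at e1
    nlinarith

theorem loc_B {x b θ : K} (hb : ‖b‖ ≤ 1) (hθ : ‖θ‖ = 1) (h2 : ‖(2 : K)‖ = 1) (h : 4 * x ^ 2 * (x ^ 2 - b) = -θ) :
    ‖x‖ = 1 := by
  have e : ‖x ^ 2‖ * ‖x ^ 2 - b‖ = 1 := by
    have := congrArg norm h
    rw [norm_neg, norm_mul, norm_mul, hθ] at this
    have e4 : (4 : K) = 2 ^ 2 := by norm_num
    rw [e4, norm_pow, h2] at this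
    linarith
  have hx : ‖x ^ 2‖ = 1 := by
    rcases lt_trichotomy ‖x ^ 2‖ 1 with h1 | h1 | h1
    · exfalso
      have : ‖x ^ 2 - b‖ ≤ 1 := by
        rw [sub_eq_add_neg]; exact u_add_le _ _ h1.le (by rwa [norm_neg])
      nlinarith [norm_nonneg (x ^ 2)]
    · exact h1
    · exfalso
      have : ‖x ^ 2 - b‖ = ‖x ^ 2‖ := by
        rw [sub_eq_add_neg, u_add_eq (by rw [norm_neg]; linarith)]
      rw [this] at e
      nlinarith
  rw [norm_pow] at hx
  exact (pow_eq_one_iff_of_nonneg (norm_nonneg _) (by norm_num)).mp hx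

theorem loc_prod {s : Finset ℕ} {w v : ℕ → K} {r : ℝ} (hr : 0 < r) (hr1 : r ≤ 1) (hv : ∀ i, ‖v i‖ ≤ 1) (h : ∀ i ∈ s, ‖w i - v i‖ < r) :
    ‖∏ i ∈ s, w i - ∏ i ∈ s, v i‖ < r := by
  have hv' : ∀ s : Finset ℕ, ‖∏ i ∈ s, v i‖ ≤ 1 := by
    intro s
    rw [norm_prod]
    exact Finset.prod_le_one (fun i _ => norm_nonneg _) (fun i _ => hv i)
  induction s using Finset.induction_on with
  | empty => simpa using hr
  | insert a s ha ih =>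
    rw [Finset.prod_insert ha, Finset.prod_insert ha]
    have ih' := ih (fun i hi => h i (Finset.mem_insert_of_mem hi))
    have h1 := h a (Finset.mem_insert_self a s)
    have hw : ‖∏ i ∈ s, w i‖ ≤ 1 := by
      have : ∏ i ∈ s, w i = (∏ i ∈ s, w i - ∏ i ∈ s, v i) + ∏ i ∈ s, v i := by ring
      rw [this]
      exact u_add_le _ _ (by linarith) (hv' s)
    have e : w a * ∏ i ∈ s, w i - v a * ∏ i ∈ s, v i = (w a - v a) * ∏ i ∈ s, w i + v a * (∏ i ∈ s, w i - ∏ i ∈ s, v i) := by ring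
    rw [e]
    apply u_add_lt
    · rw [norm_mul]; nlinarith [norm_nonneg (w a - v a)]
    · rw [norm_mul]; nlinarith [norm_nonneg (∏ i ∈ s, w i - ∏ i ∈ s, v i), hv a]

end HLoc


section HVals

/-- the norm of `q` from the quintic algebra -/
def IsNm (D : ℚ) (q : ℚ[X]) (N : ℚ) : Prop := ∀ (K : Type) [Field K] [CharZero K] (θ : ℕ → K),
    X ^ 5 + C (D : K) = ∏ i ∈ Finset.range 5, (X - C (θ i)) →
    (N : K) = ∏ i ∈ Finset.range 5, eval₂ (Rat.castHom K) (θ i) q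

theorem quint_root {K : Type*} [Field K] [CharZero K] {D b : ℚ} {x : ℚ[X]}
    (h : X ^ 5 + C D ∣ (2 * x ^ 2 - C b) ^ 2 - C b ^ 2 + X) {θ : K} (hθ : θ ^ 5 = -(D : K)) :
    4 * (eval₂ (Rat.castHom K) θ x) ^ 2 * ((eval₂ (Rat.castHom K) θ x) ^ 2 - b) = -θ := by
  obtain ⟨g, hg⟩ := h
  have := congrArg (eval₂ (Rat.castHom K) θ) hg
  have e2 : eval₂ (Rat.castHom K) θ (2 : ℚ[X]) = 2 := by
    have : (2 : ℚ[X]) = C 2 := rfl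
    rw [this, eval₂_C]; simp
  simp only [eval₂_add, eval₂_sub, eval₂_mul, eval₂_pow, eval₂_C, eval₂_X, Rat.coe_castHom, hθ, e2] at this
  linear_combination this

theorem H_local {c β : ℤ} {m : ℕ} {x : ℚ[X]}
    (h : X ^ 5 + C ((c : ℚ) ^ m) ∣ (2 * x ^ 2 - C (β : ℚ)) ^ 2 - C (β : ℚ) ^ 2 + X)
    (l : ℕ) [hl : Fact l.Prime] : ∃ θ : ℕ → PadicAlgCl l,
    X ^ 5 + C ((((c : ℚ) ^ m : ℚ)) : PadicAlgCl l) = ∏ i ∈ Finset.range 5, (X - C (θ i)) ∧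
    ∀ i, ‖θ i‖ ^ 5 = ‖(c : PadicAlgCl l)‖ ^ m ∧
      4 * (eval₂ (Rat.castHom (PadicAlgCl l)) (θ i) x) ^ 2 * ((eval₂ (Rat.castHom (PadicAlgCl l)) (θ i) x) ^ 2 - β) = -θ i := by
  obtain ⟨ρ, hρ⟩ := IsAlgClosed.exists_pow_nat_eq (-(((c : ℚ) ^ m : ℚ) : PadicAlgCl l)) (n := 5) (by norm_num)
  obtain ⟨ζ, hζ, he⟩ := roots_ex (PadicAlgCl l) _ hρ
  refine ⟨fun i => ζ ^ i * ρ, he, ?_⟩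
  intro i
  have e1 : (ζ ^ i * ρ) ^ 5 = -(((c : ℚ) ^ m : ℚ) : PadicAlgCl l) := by
    rw [mul_pow, hρ, ← pow_mul, mul_comm i 5, pow_mul, hζ.pow_eq_one, one_pow, one_mul]
  constructor
  · rw [← norm_pow, e1, norm_neg]; push_cast; rw [norm_pow]
  · have := quint_root h e1
    push_cast at this ⊢
    exact this

theorem H_local_c {c β : ℤ} {m : ℕ} (hm : 11 ≤ m) (hc0 : c ≠ 0) (h2c : 2 ∣ c) (hβ : IsCoprime β c) {x : ℚ[X]}
    (h : X ^ 5 + C ((c : ℚ) ^ m) ∣ (2 * x ^ 2 - C (β : ℚ)) ^ 2 - C (β : ℚ) ^ 2 + X)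
    {Xn y5 : ℚ} (hX : IsNm ((c : ℚ) ^ m) x Xn) (hY : IsNm ((c : ℚ) ^ m) (2 * x ^ 2 - C (β : ℚ)) y5)
    (l : ℕ) [hl : Fact l.Prime] (hlc : (l : ℤ) ∣ c) : ∃ N ≤ 5,
      ‖(2 ^ N * Xn : PadicAlgCl l)‖ ^ 10 = (‖(c : PadicAlgCl l)‖ ^ m) ^ N ∧
      ‖((y5 : PadicAlgCl l) - (-1) ^ N * β ^ 5)‖ < ‖(2 : PadicAlgCl l)‖ := by
  obtain ⟨θ, hθ, hi⟩ := H_local h l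
  have hb := pa_cop_one l hβ hlc
  have hc1 : ‖(c : PadicAlgCl l)‖ < 1 := by
    obtain ⟨e, he⟩ := hlc
    rw [he]; push_cast; rw [norm_mul]
    have h1 := pa_int_le l e
    have h2 := pa_self l
    have hl1 : (1 : ℝ) < l := by exact_mod_cast hl.out.one_lt
    have h3 : ‖(l : PadicAlgCl l)‖ < 1 := by
      rw [h2, zpow_neg_one]; exact inv_lt_one_of_one_lt₀ hl1
    nlinarith [norm_nonneg (l : PadicAlgCl l), norm_nonneg (e : PadicAlgCl l)]
  have hcp : 0 < ‖(c : PadicAlgCl l)‖ := by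
    rw [norm_pos_iff]; exact_mod_cast hc0
  have hc2 : ‖(c : PadicAlgCl l)‖ ≤ ‖(2 : PadicAlgCl l)‖ := by
    obtain ⟨e, he⟩ := h2c
    rw [he]; push_cast; rw [norm_mul]
    have h1 := pa_int_le l e
    nlinarith [norm_nonneg (2 : PadicAlgCl l)]
  have h20 : 0 < ‖(2 : PadicAlgCl l)‖ := hcp.trans_le hc2
  have h21 : ‖(2 : PadicAlgCl l)‖ ≤ 1 := by exact_mod_cast u_nat (K := PadicAlgCl l) 2
  have hθs : ∀ i, ‖θ i‖ < ‖(2 : PadicAlgCl l)‖ ^ 2 := by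
    intro i
    have : ‖θ i‖ ^ 5 < (‖(2 : PadicAlgCl l)‖ ^ 2) ^ 5 := by
      rw [(hi i).1, ← pow_mul]
      calc ‖(c : PadicAlgCl l)‖ ^ m ≤ ‖(c : PadicAlgCl l)‖ ^ 11 := pow_le_pow_of_le_one hcp.le hc1.le hm
        _ < ‖(c : PadicAlgCl l)‖ ^ 10 := pow_lt_pow_right_of_lt_one₀ hcp hc1 (by norm_num)
        _ ≤ _ := by gcongr
    exact lt_of_pow_lt_pow_left₀ 5 (by positivity) this
  choose ε hε1 hε2 hε3 using fun i => loc_A hb (hθs i) (hi i).2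
  refine ⟨∑ i ∈ Finset.range 5, ε i, ?_, ?_, ?_⟩
  · calc ∑ i ∈ Finset.range 5, ε i ≤ ∑ i ∈ Finset.range 5, 1 := Finset.sum_le_sum (fun i _ => hε1 i)
      _ = 5 := by simp
  · have e1 := hX _ θ hθ
    rw [e1, norm_mul, norm_pow, norm_prod, mul_pow, ← Finset.prod_pow_eq_pow_sum, ← Finset.prod_pow_eq_pow_sum,
      ← Finset.prod_pow, ← Finset.prod_pow, ← Finset.prod_mul_distrib]
    apply Finset.prod_congr rfl
    intro i _
    have e5 : (‖θ i‖ ^ 5) ^ ε i = (‖θ i‖ ^ ε i) ^ 5 := by rw [← pow_mul, ← pow_mul, mul_comm]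
    rw [← (hi i).1, e5, ← hε2 i]; ring
  · have e1 := hY _ θ hθ
    have e2 : ((-1) ^ (∑ i ∈ Finset.range 5, ε i) * β ^ 5 : PadicAlgCl l) = ∏ i ∈ Finset.range 5, ((-1) ^ ε i * (β : PadicAlgCl l)) := by
      rw [Finset.prod_mul_distrib, Finset.prod_pow_eq_pow_sum]; simp
    rw [e1, e2]
    apply loc_prod h20 h21
    · intro i; simp [hb]
    · intro i _
      have e3 : eval₂ (Rat.castHom (PadicAlgCl l)) (θ i) (2 * x ^ 2 - C (β : ℚ)) = 2 * eval₂ (Rat.castHom (PadicAlgCl l)) (θ i) x ^ 2 - β := by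
        have e4 : (2 : ℚ[X]) = C 2 := rfl
        rw [e4, eval₂_sub, eval₂_mul, eval₂_pow, eval₂_C, eval₂_C]; simp
      rw [e3]; exact hε3 i

theorem H_vals {c β : ℤ} {m : ℕ} (hm : 11 ≤ m) (hm10 : m.Coprime 10) (hc0 : c ≠ 0) (h2c : 2 ∣ c) (hβ : IsCoprime β c) {x : ℚ[X]}
    (h : X ^ 5 + C ((c : ℚ) ^ m) ∣ (2 * x ^ 2 - C (β : ℚ)) ^ 2 - C (β : ℚ) ^ 2 + X)
    {Xn y5 : ℚ} (hX : IsNm ((c : ℚ) ^ m) x Xn) (hY : IsNm ((c : ℚ) ^ m) (2 * x ^ 2 - C (β : ℚ)) y5) :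
    ∃ N ≤ 5, ∃ τ : ℕ, τ ≠ 0 ∧ 2 ^ N * |Xn| = (τ : ℚ) ^ m ∧ 10 * padicValNat 2 τ = N * padicValInt 2 c ∧
      ‖((y5 : PadicAlgCl 2) - (-1) ^ N * β ^ 5)‖ < ‖(2 : PadicAlgCl 2)‖ := by
  obtain ⟨N, hN5, hNX, hNy⟩ := H_local_c hm hc0 h2c hβ h hX hY 2 (by exact_mod_cast h2c)
  have hc0' : (c : ℚ) ≠ 0 := by exact_mod_cast hc0
  have hcn : ∀ (l : ℕ) [Fact l.Prime] (N : ℕ), (‖(c : PadicAlgCl l)‖ ^ m) ^ N = (l : ℝ) ^ (-((m : ℤ) * (N * padicValInt l c))) := by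
    intro l hl N
    have := pa_norm l (r := (c : ℚ)) hc0'
    rw [padicValRat.of_int] at this
    push_cast at this
    rw [this, ← zpow_natCast, ← zpow_natCast, ← zpow_mul, ← zpow_mul]; congr 1; ring
  have hX0 : Xn ≠ 0 := by
    rintro rfl
    rw [hcn 2] at hNX
    push_cast at hNX
    rw [mul_zero, norm_zero, zero_pow (by norm_num)] at hNX
    have : (0 : ℝ) < (2 : ℝ) ^ (-((m : ℤ) * (N * padicValInt 2 c))) := by positivity
    linarith
  have hvn : ∀ (l : ℕ) [Fact l.Prime] (N n : ℕ), ‖(2 ^ N * Xn : PadicAlgCl l)‖ ^ 10 = (l : ℝ) ^ (-((m : ℤ) * n)) →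
      10 * padicValRat l (2 ^ N * Xn) = m * n := by
    intro l hl N n hh
    have := pa_norm l (r := 2 ^ N * Xn) (by positivity)
    push_cast at this
    rw [this, ← zpow_natCast, ← zpow_mul] at hh
    have := pa_inj l hh
    push_cast at this; linarith
  have hdiv : ∀ (v : ℤ) (n : ℕ), 10 * v = m * n → ∃ k : ℕ, v = m * k ∧ n = 10 * k := by
    intro v n hh
    have h1 : (10 : ℤ) ∣ m * n := ⟨v, hh.symm⟩
    have h2 : 10 ∣ m * n := by exact_mod_cast h1
    obtain ⟨k, hk⟩ := (Nat.Coprime.dvd_mul_left hm10.symm).mp h2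
    refine ⟨k, ?_, hk⟩
    rw [hk] at hh; push_cast at hh; linarith
  have vself := hvn 2 N (N * padicValInt 2 c) (by rw [hNX, hcn 2]; push_cast; rfl)
  obtain ⟨τ, hτ⟩ := rat_is_pow (m := m) (r := 2 ^ N * Xn) (by positivity) (by
    intro l hl
    have hlf := Fact.mk hl
    by_cases hl2 : l = 2
    · subst hl2
      obtain ⟨k, hk, -⟩ := hdiv _ _ vself
      exact ⟨k, hk⟩
    have h2n : ‖(2 : PadicAlgCl l)‖ = 1 := by
      exact_mod_cast pa_other l Nat.prime_two (fun h => hl2 h.symm)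
    by_cases hlc : (l : ℤ) ∣ c
    · obtain ⟨N', -, hN', -⟩ := H_local_c hm hc0 h2c hβ h hX hY l hlc
      obtain ⟨k, hk, -⟩ := hdiv _ _ (hvn l N (N' * padicValInt l c) (by
        rw [hcn l] at hN'
        rw [norm_mul, norm_pow, h2n] at hN' ⊢
        simp only [one_pow] at hN' ⊢
        rw [hN']; push_cast; rfl))
      exact ⟨k, hk⟩
    · obtain ⟨θ, hθ, hi⟩ := H_local h l
      have e1 := hX _ θ hθ
      have : ‖(Xn : PadicAlgCl l)‖ = 1 := by
        rw [e1, norm_prod]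
        apply Finset.prod_eq_one
        intro i _
        refine loc_B (pa_int_le l β) ?_ h2n (hi i).2
        have : ‖θ i‖ ^ 5 = 1 := by rw [(hi i).1, pa_int_one l hlc, one_pow]
        exact (pow_eq_one_iff_of_nonneg (norm_nonneg _) (by norm_num)).mp this
      obtain ⟨k, hk, -⟩ := hdiv _ _ (hvn l N 0 (by
        rw [norm_mul, norm_pow, h2n, this]; simp))
      exact ⟨k, hk⟩)
  have hτ0 : τ ≠ 0 := by
    rintro rfl
    rw [Nat.cast_zero, zero_pow (by omega), abs_eq_zero] at hτ
    have : (2 : ℚ) ^ N * Xn ≠ 0 := by positivity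
    exact this hτ
  refine ⟨N, hN5, τ, hτ0, ?_, ?_, hNy⟩
  · rw [← hτ, abs_mul, abs_of_pos (by positivity : (0 : ℚ) < 2 ^ N)]
  · have e : padicValRat 2 ((2 : ℚ) ^ N * Xn) = m * padicValNat 2 τ := by
      have : padicValRat 2 |2 ^ N * Xn| = padicValRat 2 (2 ^ N * Xn) := by
        rcases abs_choice (2 ^ N * Xn) with h1 | h1 <;> rw [h1]
        exact padicValRat.neg _
      rw [← this, hτ, padicValRat.pow, padicValRat.of_nat]
    rw [e] at vself
    have hm0 : (m : ℤ) ≠ 0 := by positivity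
    have : (m : ℤ) * (10 * padicValNat 2 τ) = m * (N * padicValInt 2 c) := by rw [Nat.cast_mul] at vself; linarith
    exact_mod_cast mul_left_cancel₀ hm0 this

end HVals


section HArch

theorem H_arch {c β : ℤ} {m : ℕ} (hβ : 0 < β) {x : ℚ[X]}
    (h : X ^ 5 + C ((c : ℚ) ^ m) ∣ (2 * x ^ 2 - C (β : ℚ)) ^ 2 - C (β : ℚ) ^ 2 + X)
    {Xn y5 : ℚ} (hX : IsNm ((c : ℚ) ^ m) x Xn) (hY : IsNm ((c : ℚ) ^ m) (2 * x ^ 2 - C (β : ℚ)) y5)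
    {Λ : ℝ} (hΛ : 0 < Λ) (hΛc : Λ ^ 10 = (c : ℝ) ^ m) (hβΛ : (β : ℝ) < Λ) :
    (Λ - 2 * β) ^ 5 ≤ 32 * (Xn : ℝ) ^ 2 ∧ 32 * (Xn : ℝ) ^ 2 ≤ (Λ + 2 * β) ^ 5 ∧ 0 < y5 ∧ y5 ^ 2 = (β : ℚ) ^ 10 + (c : ℚ) ^ m := by
  have hβ' : (0 : ℝ) < β := by exact_mod_cast hβ
  have hα : (((-Λ ^ 2 : ℝ)) : ℂ) ^ 5 = -(((c : ℚ) ^ m : ℚ) : ℂ) := by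
    have : ((-Λ ^ 2 : ℝ)) ^ 5 = -((c : ℝ) ^ m) := by rw [← hΛc]; ring
    have := congrArg (Complex.ofReal) this
    push_cast at this ⊢
    exact this
  obtain ⟨ζ, hζ, he⟩ := roots_ex ℂ _ hα
  have hζ1 : ‖ζ‖ = 1 := by
    have : ‖ζ‖ ^ 5 = 1 := by rw [← norm_pow, hζ.pow_eq_one, norm_one]
    exact (pow_eq_one_iff_of_nonneg (norm_nonneg _) (by norm_num)).mp this
  set α : ℝ := -Λ ^ 2 with hαd
  set θ : ℕ → ℂ := fun i => ζ ^ i * (α : ℂ) with hθ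
  have hθn : ∀ i, ‖θ i‖ = Λ ^ 2 := by
    intro i
    simp only [hθ, norm_mul, norm_pow, hζ1, one_pow, one_mul, Complex.norm_real, hαd, norm_neg, Real.norm_eq_abs, abs_of_pos hΛ]
  have hθ5 : ∀ i, θ i ^ 5 = -(((c : ℚ) ^ m : ℚ) : ℂ) := by
    intro i
    simp only [hθ]
    rw [mul_pow, hα, ← pow_mul, mul_comm i 5, pow_mul, hζ.pow_eq_one, one_pow, one_mul]
  set W : ℕ → ℂ := fun i => eval₂ (Rat.castHom ℂ) (θ i) (2 * x ^ 2 - C (β : ℚ)) with hW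
  set x' : ℕ → ℂ := fun i => eval₂ (Rat.castHom ℂ) (θ i) x with hx'
  have hWx : ∀ i, W i = 2 * x' i ^ 2 - β := by
    intro i
    have e4 : (2 : ℚ[X]) = C 2 := rfl
    simp only [hW, hx']
    rw [e4, eval₂_sub, eval₂_mul, eval₂_pow, eval₂_C, eval₂_C]; simp
  have hW2 : ∀ i, W i ^ 2 = β ^ 2 - θ i := by
    intro i
    have := quint_root h (hθ5 i)
    rw [hWx i]
    push_cast at this
    linear_combination this
  have hβn : ‖(β : ℂ)‖ = β := by rw [Complex.norm_intCast, abs_of_pos hβ']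
  have hWn : ∀ i, Λ - β ≤ ‖W i‖ ∧ ‖W i‖ ≤ Λ + β := by
    intro i
    have e1 : ‖W i‖ ^ 2 = ‖(β : ℂ) ^ 2 - θ i‖ := by rw [← norm_pow, hW2]
    have e2 : ‖(β : ℂ) ^ 2‖ = (β : ℝ) ^ 2 := by rw [norm_pow, hβn]
    refine arch_root (p := 2) (by norm_num) (norm_nonneg _) hβ'.le (by linarith) ?_ ?_
    · rw [e1, ← e2, ← hθn i]; linarith [norm_sub_le ((β : ℂ) ^ 2) (θ i)]
    · rw [e1, ← e2, ← hθn i]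
      have := norm_sub_norm_le (θ i) ((β : ℂ) ^ 2)
      rw [norm_sub_rev] at this; linarith
  have hxn : ∀ i, Λ - 2 * β ≤ 2 * ‖x' i‖ ^ 2 ∧ 2 * ‖x' i‖ ^ 2 ≤ Λ + 2 * β := by
    intro i
    have e1 : 2 * ‖x' i‖ ^ 2 = ‖W i + β‖ := by rw [hWx i]; simp
    obtain ⟨k1, k2⟩ := hWn i
    rw [e1]
    have k3 := norm_add_le (W i) (β : ℂ)
    have k4 := norm_sub_norm_le (W i) (-(β : ℂ))
    rw [sub_neg_eq_add, norm_neg] at k4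
    rw [hβn] at k3 k4
    constructor <;> linarith
  have eX := hX ℂ θ he
  have eY := hY ℂ θ he
  have eX2 : 32 * (Xn : ℝ) ^ 2 = ∏ i ∈ Finset.range 5, (2 * ‖x' i‖ ^ 2) := by
    rw [Finset.prod_mul_distrib, Finset.prod_pow, ← norm_prod, ← eX, Complex.norm_ratCast, sq_abs]; norm_num
  refine ⟨?_, ?_, ?_, ?_⟩
  · rcases lt_or_ge (Λ - 2 * β) 0 with hn | hn0
    · have h5 : (Λ - 2 * β) ^ 5 < 0 := Odd.pow_neg (by decide) hn
      nlinarith [sq_nonneg (Xn : ℝ)]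
    rw [eX2]
    calc (Λ - 2 * β) ^ 5 = ∏ i ∈ Finset.range 5, (Λ - 2 * β) := by simp
      _ ≤ _ := Finset.prod_le_prod (fun i _ => hn0) (fun i _ => (hxn i).1)
  · rw [eX2]
    calc _ ≤ ∏ i ∈ Finset.range 5, (Λ + 2 * β) := Finset.prod_le_prod (fun i _ => by positivity) (fun i _ => (hxn i).2)
      _ = _ := by simp
  · have hconj : ∀ z : ℂ, eval₂ (Rat.castHom ℂ) (starRingEnd ℂ z) (2 * x ^ 2 - C (β : ℚ)) = starRingEnd ℂ (eval₂ (Rat.castHom ℂ) z (2 * x ^ 2 - C (β : ℚ))) := by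
      intro z
      rw [hom_eval₂]
      congr 1
      exact RingHom.ext_rat _ _
    have hζc : starRingEnd ℂ ζ = ζ ^ 4 := by
      have h1 : ζ * starRingEnd ℂ ζ = 1 := by rw [Complex.mul_conj, Complex.normSq_eq_norm_sq, hζ1]; simp
      have h2 : ζ * ζ ^ 4 = 1 := by rw [← pow_succ']; exact hζ.pow_eq_one
      exact mul_left_cancel₀ (hζ.ne_zero (by norm_num)) (h1.trans h2.symm)
    have w4 : W 4 = starRingEnd ℂ (W 1) := by
      simp only [hW]
      rw [← hconj]; congr 1
      simp only [hθ, map_mul, Complex.conj_ofReal, pow_one, hζc]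
    have w3 : W 3 = starRingEnd ℂ (W 2) := by
      simp only [hW]
      rw [← hconj]; congr 1
      simp only [hθ, map_mul, map_pow, Complex.conj_ofReal, hζc]
      have := hζ.pow_eq_one
      rw [← pow_mul]
      have e8 : ζ ^ (4 * 2) = ζ ^ 5 * ζ ^ 3 := by ring
      rw [e8, this, one_mul]
    set w0 : ℝ := eval₂ (Rat.castHom ℝ) α (2 * x ^ 2 - C (β : ℚ)) with hw0
    have w0e : W 0 = (w0 : ℂ) := by
      simp only [hW, hθ, pow_zero, one_mul, hw0]
      have := hom_eval₂ (2 * x ^ 2 - C (β : ℚ)) (Rat.castHom ℝ) Complex.ofRealHom α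
      rw [Complex.ofRealHom_eq_coe] at this
      rw [this]
      congr 1
    have w0b : -(β : ℝ) ≤ w0 := by
      have e4 : (2 : ℚ[X]) = C 2 := rfl
      rw [hw0, e4, eval₂_sub, eval₂_mul, eval₂_pow, eval₂_C, eval₂_C]
      simp only [Rat.coe_castHom, Rat.cast_ofNat, Rat.cast_intCast]
      nlinarith [sq_nonneg (eval₂ (Rat.castHom ℝ) α x)]
    have w02 : w0 ^ 2 = (β : ℝ) ^ 2 + Λ ^ 2 := by
      have := hW2 0
      rw [w0e] at this
      simp only [hθ, pow_zero, one_mul] at this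
      rw [hαd] at this
      have h2 : w0 ^ 2 = (β : ℝ) ^ 2 - (-Λ ^ 2) := by exact_mod_cast this
      rw [h2]; ring
    have w0p : 0 < w0 := by
      by_contra hh
      push Not at hh
      nlinarith
    have hpos : ∀ i, 0 < Complex.normSq (W i) := by
      intro i
      rw [Complex.normSq_eq_norm_sq]
      have := (hWn i).1
      have : 0 < ‖W i‖ := by linarith
      positivity
    have e1 : (y5 : ℂ) = ((w0 * Complex.normSq (W 1) * Complex.normSq (W 2) : ℝ) : ℂ) := by
      rw [eY]
      change ∏ i ∈ Finset.range 5, W i = _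
      simp only [Finset.prod_range_succ, Finset.prod_range_zero, one_mul]
      rw [w4, w3, w0e]
      push_cast
      rw [← Complex.mul_conj, ← Complex.mul_conj]; ring
    have e2 : (y5 : ℝ) = w0 * Complex.normSq (W 1) * Complex.normSq (W 2) := by exact_mod_cast e1
    have : (0 : ℝ) < y5 := by
      rw [e2]; exact mul_pos (mul_pos w0p (hpos 1)) (hpos 2)
    exact_mod_cast this
  · have e1 : (y5 : ℂ) ^ 2 = (β : ℂ) ^ 10 + (c : ℂ) ^ m := by
      rw [eY, ← Finset.prod_pow]
      have h1 := congrArg (eval ((β : ℂ) ^ 2)) he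
      rw [eval_prod] at h1
      simp only [eval_add, eval_pow, eval_X, eval_C, eval_sub] at h1
      calc _ = ∏ i ∈ Finset.range 5, ((β : ℂ) ^ 2 - θ i) := Finset.prod_congr rfl (fun i _ => hW2 i)
        _ = ((β : ℂ) ^ 2) ^ 5 + (((c : ℚ) ^ m : ℚ) : ℂ) := h1.symm
        _ = _ := by push_cast; ring
    exact_mod_cast e1

end HArch


section HNu

theorem nu_aux {V R c : ℤ} {m : ℕ} (hm : Odd m) (hc : c ≠ 0) (h : V ^ 2 * R = c ^ m) (hVR : IsCoprime V R) :
    ∃ ν : ℕ, ν ≠ 0 ∧ |V| = (ν : ℤ) ^ m ∧ ν ^ 2 ∣ c.natAbs := by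
  have hm0 : m ≠ 0 := by rintro rfl; simp at hm
  have hV0 : V ≠ 0 := by
    rintro rfl
    have := pow_ne_zero m hc
    rw [← h] at this; simp at this
  obtain ⟨g, hg0, hg⟩ := int_pow_nonneg (sq_nonneg V) (hVR.pow_left) h
  obtain ⟨z, hz1, hz2⟩ := int_pow_cop (by norm_num) (Nat.pos_of_ne_zero hm0) (Nat.coprime_two_left.mpr hm) hg
  have hz0 : z ≠ 0 := by rintro rfl; rw [zero_pow hm0] at hz1; exact hV0 hz1
  refine ⟨z.natAbs, by simpa using hz0, ?_, ?_⟩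
  · rw [hz1, abs_pow, Int.natCast_natAbs]
  · rw [← Nat.pow_dvd_pow_iff hm0, ← Int.natAbs_pow, ← Int.natAbs_pow, ← Int.natAbs_pow, Int.natAbs_dvd_natAbs, ← h, ← hz2, hg]
    exact Dvd.intro _ rfl

theorem H_nu {c β U : ℤ} {m N : ℕ} (hm : Odd m) (hc : 0 < c) (hβ : Odd (β ^ 5)) (hU : 4 * U ^ 2 * (U ^ 2 - β ^ 5) = c ^ m)
    (hUA : IsCoprime U (β ^ 5)) {y5 : ℚ} (hy0 : 0 < y5) (hy : y5 ^ 2 = (β : ℚ) ^ 10 + (c : ℚ) ^ m)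
    (hN : ‖((y5 : PadicAlgCl 2) - (-1) ^ N * β ^ 5)‖ < ‖(2 : PadicAlgCl 2)‖) :
    ∃ ν : ℕ, ν ≠ 0 ∧ 2 ^ (N % 2) * |U| = (ν : ℤ) ^ m ∧ ν ^ 2 ∣ c.natAbs ∧ 2 * padicValNat 2 ν = (N % 2) * padicValInt 2 c := by
  have hm0 : m ≠ 0 := by rintro rfl; simp at hm
  have hcm : 0 < c ^ m := pow_pos hc m
  have hU2 : 0 < U ^ 2 - β ^ 5 := by
    by_contra hh
    push Not at hh
    have : 4 * U ^ 2 * (U ^ 2 - β ^ 5) ≤ 0 := mul_nonpos_of_nonneg_of_nonpos (by positivity) hh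
    linarith
  have hyU : y5 = ((2 * U ^ 2 - β ^ 5 : ℤ) : ℚ) := by
    have h1 : (0 : ℤ) < 2 * U ^ 2 - β ^ 5 := by nlinarith [sq_nonneg U]
    have h1' : (0 : ℚ) < ((2 * U ^ 2 - β ^ 5 : ℤ) : ℚ) := by exact_mod_cast h1
    have h2 : y5 ^ 2 = ((2 * U ^ 2 - β ^ 5 : ℤ) : ℚ) ^ 2 := by
      rw [hy]
      have : (c : ℚ) ^ m = 4 * U ^ 2 * (U ^ 2 - β ^ 5) := by exact_mod_cast hU.symm
      rw [this]; push_cast; ring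
    exact (pow_left_inj₀ hy0.le h1'.le (by norm_num)).mp h2
  have h20 : 0 < ‖(2 : PadicAlgCl 2)‖ := by rw [norm_pos_iff]; norm_num
  have key : ∀ z : ℤ, ‖((2 * z : ℤ) : PadicAlgCl 2)‖ < ‖(2 : PadicAlgCl 2)‖ → 2 ∣ z := by
    intro z hz
    by_contra hh
    have := pa_int_one 2 (z := z) (by exact_mod_cast hh)
    push_cast at hz
    rw [norm_mul, this, mul_one] at hz
    exact lt_irrefl _ hz
  have hβ2 : ¬ 2 ∣ β ^ 5 := by rw [← even_iff_two_dvd, Int.not_even_iff_odd]; exact hβ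
  rcases Nat.even_or_odd N with hNe | hNo
  · have hN0 : N % 2 = 0 := Nat.even_iff.mp hNe
    have hz : 2 ∣ U ^ 2 - β ^ 5 := by
      apply key
      rw [hyU, hNe.neg_one_pow] at hN
      push_cast at hN ⊢
      convert hN using 2
      ring
    have hUo : ¬ 2 ∣ U := by
      intro hh
      have : (2 : ℤ) ∣ U ^ 2 := dvd_pow hh (by norm_num)
      exact hβ2 ((dvd_sub_right this).mp hz)
    have hcop : IsCoprime U (4 * (U ^ 2 - β ^ 5)) := by
      apply IsCoprime.mul_right
      · have : IsCoprime U (2 ^ 2) := ((Int.prime_two.coprime_iff_not_dvd.mpr hUo).symm).pow_right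
        norm_num at this; exact this
      · have : U ^ 2 - β ^ 5 = -β ^ 5 + U * U := by ring
        rw [this, IsCoprime.add_mul_left_right_iff]
        exact hUA.neg_right
    obtain ⟨ν, hν0, hν1, hν2⟩ := nu_aux (V := U) (R := 4 * (U ^ 2 - β ^ 5)) hm hc.ne' (by rw [← hU]; ring) hcop
    refine ⟨ν, hν0, by rw [hN0, pow_zero, one_mul, hν1], hν2, ?_⟩
    rw [hN0, zero_mul, padicValNat.eq_zero_of_not_dvd, mul_zero]
    intro hh
    apply hUo
    rw [← dvd_abs, hν1]
    exact dvd_pow (by exact_mod_cast hh) hm0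
  · have hN1 : N % 2 = 1 := Nat.odd_iff.mp hNo
    have hz : 2 ∣ U ^ 2 := by
      apply key
      rw [hyU, hNo.neg_one_pow] at hN
      push_cast at hN ⊢
      convert hN using 2
      ring
    have hUe : 2 ∣ U := Int.prime_two.dvd_of_dvd_pow hz
    have hRo : ¬ 2 ∣ U ^ 2 - β ^ 5 := by
      intro hh
      exact hβ2 ((dvd_sub_right hz).mp hh)
    have hcop : IsCoprime (2 * U) (U ^ 2 - β ^ 5) := by
      apply IsCoprime.mul_left
      · exact Int.prime_two.coprime_iff_not_dvd.mpr hRo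
      · have : U ^ 2 - β ^ 5 = -β ^ 5 + U * U := by ring
        rw [this, IsCoprime.add_mul_left_right_iff]
        exact hUA.neg_right
    have hVR : (2 * U) ^ 2 * (U ^ 2 - β ^ 5) = c ^ m := by rw [← hU]; ring
    obtain ⟨ν, hν0, hν1, hν2⟩ := nu_aux (V := 2 * U) hm hc.ne' hVR hcop
    refine ⟨ν, hν0, by rw [hN1, pow_one, ← hν1, abs_mul]; rfl, hν2, ?_⟩
    rw [hN1, one_mul]
    have e1 : c.natAbs ^ m = (ν ^ m) ^ 2 * (U ^ 2 - β ^ 5).natAbs := by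
      have e2 : (2 * U).natAbs = ν ^ m := by
        have : ((2 * U).natAbs : ℤ) = ((ν ^ m : ℕ) : ℤ) := by rw [Int.natCast_natAbs, hν1]; push_cast; rfl
        exact_mod_cast this
      rw [← Int.natAbs_pow, ← hVR, Int.natAbs_mul, Int.natAbs_pow, e2]
    have hR0 : (U ^ 2 - β ^ 5).natAbs ≠ 0 := by simpa using hU2.ne'
    have e3 := congrArg (padicValNat 2) e1
    rw [padicValNat.mul (by positivity) hR0, padicValNat.pow, padicValNat.pow, padicValNat.pow,
      padicValNat.eq_zero_of_not_dvd (n := (U ^ 2 - β ^ 5).natAbs) (by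
        intro hh; exact hRo (by exact_mod_cast Int.natCast_dvd.mpr hh)), add_zero] at e3
    have e4 : m * (2 * padicValNat 2 ν) = m * padicValInt 2 c := by rw [padicValInt, e3]; ring
    exact Nat.eq_of_mul_eq_mul_left (Nat.pos_of_ne_zero hm0) e4

end HNu


section HArith

/-- the lower bound for `C` and the crude comparison of `C` with `ν ^ 4` -/
theorem H_c80 {C ν m ε : ℕ} (hm : 99 ≤ m) (hC : 2 ≤ C) (hC2 : 2 ∣ C) (hν0 : ν ≠ 0) (hν2 : ν ^ 2 ∣ C)
    (hε : (ε = 0 ∧ ¬ 2 ∣ ν) ∨ (ε = 1 ∧ 2 ∣ ν)) {Q : ℝ} (hQ1 : (C : ℝ) ^ m ≤ Q) (hQ2 : Q ≤ 9 * (C : ℝ) ^ m)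
    (hν : 4 * ((ν : ℝ) ^ 4) ^ m = 16 ^ ε * Q) : 80 ≤ C ∧ ν ^ 4 ≤ 2 * C ∧ C ≤ 2 * ν ^ 4 := by
  have hCp : (0 : ℝ) < C := by positivity
  have hνp : (0 : ℝ) < (ν : ℝ) ^ 4 := by positivity
  have bern : ∀ (u v : ℝ), 0 < u → 0 ≤ v → u ^ m * (1 + m * (v / u)) ≤ (u + v) ^ m := by
    intro u v hu hv
    have hN : (0 : ℝ) ≤ v / u := by positivity
    calc u ^ m * (1 + m * (v / u)) ≤ u ^ m * (1 + v / u) ^ m := by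
          gcongr; exact one_add_mul_le_pow (by linarith) m
      _ = (u + v) ^ m := by rw [← mul_pow]; congr 1; field_simp
  have hm' : (99 : ℝ) ≤ m := by exact_mod_cast hm
  have hCm : (0 : ℝ) < (C : ℝ) ^ m := by positivity
  have h2m : (9 : ℝ) * 4 ≤ 2 ^ m := by
    calc (9 : ℝ) * 4 ≤ 2 ^ 99 := by norm_num
      _ ≤ _ := pow_le_pow_right₀ (by norm_num) hm
  have hlow : (4 : ℝ) * ((ν : ℝ) ^ 4) ^ m ≥ (C : ℝ) ^ m := by
    rw [hν]; rcases hε with ⟨rfl, -⟩ | ⟨rfl, -⟩ <;> linarith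
  have hup : ((ν : ℝ) ^ 4) ^ m ≤ 36 * (C : ℝ) ^ m := by
    rcases hε with ⟨rfl, -⟩ | ⟨rfl, -⟩ <;> linarith
  refine ⟨?_, ?_, ?_⟩
  · rcases hε with ⟨rfl, hodd⟩ | ⟨rfl, hev⟩
    · rw [pow_zero, one_mul] at hν
      rcases lt_trichotomy C (ν ^ 4) with h1 | h1 | h1
      · have h2 : (C : ℝ) + 1 ≤ (ν : ℝ) ^ 4 := by exact_mod_cast h1
        have h3 := bern C 1 hCp (by norm_num)
        have h4 : ((C : ℝ) + 1) ^ m ≤ ((ν : ℝ) ^ 4) ^ m := by gcongr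
        have h5 : (C : ℝ) ^ m * (4 * (1 + m * (1 / C))) ≤ (C : ℝ) ^ m * 9 := by linarith
        have h6 := le_of_mul_le_mul_left h5 hCm
        have h7 : (m : ℝ) * (1 / C) ≤ 5 / 4 := by linarith
        rw [mul_one_div, div_le_iff₀ hCp] at h7
        have h8 : (79 : ℝ) < C := by linarith
        have : 79 < C := by exact_mod_cast h8
        omega
      · exfalso
        have : 2 ∣ ν ^ 4 := h1 ▸ hC2
        exact hodd (Nat.prime_two.dvd_of_dvd_pow this)
      · have h2 : (ν : ℝ) ^ 4 + 1 ≤ C := by exact_mod_cast h1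
        have h3 := bern ((ν : ℝ) ^ 4) 1 hνp (by norm_num)
        have h4 : ((ν : ℝ) ^ 4 + 1) ^ m ≤ (C : ℝ) ^ m := by gcongr
        have h5 : ((ν : ℝ) ^ 4) ^ m * (1 + m * (1 / (ν : ℝ) ^ 4)) ≤ ((ν : ℝ) ^ 4) ^ m * 4 := by linarith
        have h6 := le_of_mul_le_mul_left h5 (by positivity)
        have h7 : (m : ℝ) * (1 / (ν : ℝ) ^ 4) ≤ 3 := by linarith
        rw [mul_one_div, div_le_iff₀ hνp] at h7
        have h8 : (32 : ℝ) < (ν : ℝ) ^ 4 := by linarith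
        have h9 : 32 < ν ^ 4 := by exact_mod_cast h8
        have h10 : 3 ≤ ν := by
          by_contra hh
          have : ν ^ 4 ≤ 2 ^ 4 := Nat.pow_le_pow_left (by omega) 4
          omega
        have : 3 ^ 4 ≤ ν ^ 4 := Nat.pow_le_pow_left h10 4
        omega
    · rw [pow_one] at hν
      by_contra hh
      have h1 : 4 * (C : ℝ) ^ m ≤ ((ν : ℝ) ^ 4) ^ m := by linarith
      have h2 : C < ν ^ 4 := by
        have : (C : ℝ) ^ m < ((ν : ℝ) ^ 4) ^ m := by linarith
        have := lt_of_pow_lt_pow_left₀ m hνp.le this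
        exact_mod_cast this
      have h16 : 16 ∣ ν ^ 4 := by
        have := pow_dvd_pow_of_dvd hev 4
        simpa using this
      have h4C : 4 ∣ C := by
        have := pow_dvd_pow_of_dvd hev 2
        exact (by simpa using this : 4 ∣ ν ^ 2).trans hν2
      have h3 : C + 4 ≤ ν ^ 4 := by omega
      have h3' : (C : ℝ) + 4 ≤ (ν : ℝ) ^ 4 := by exact_mod_cast h3
      have hC79 : (C : ℝ) ≤ 79 := by
        have : C ≤ 79 := by omega
        exact_mod_cast this
      -- (1 + 4 / C) ^ m ≤ 36
      have h4 : ((C : ℝ) + 4) ^ m ≤ 36 * (C : ℝ) ^ m := by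
        calc ((C : ℝ) + 4) ^ m ≤ ((ν : ℝ) ^ 4) ^ m := by gcongr
          _ ≤ _ := hup
      have h5 : (1 + 4 / (C : ℝ)) ^ m ≤ 36 := by
        have : ((C : ℝ) + 4) ^ m = (C : ℝ) ^ m * (1 + 4 / C) ^ m := by rw [← mul_pow]; congr 1; field_simp
        rw [this] at h4
        have h4' : (C : ℝ) ^ m * (1 + 4 / C) ^ m ≤ (C : ℝ) ^ m * 36 := by linarith
        exact le_of_mul_le_mul_left h4' hCm
      have h6 : (1 + 44 / (C : ℝ)) ^ 9 ≤ 36 := by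
        calc (1 + 44 / (C : ℝ)) ^ 9 = (1 + (11 : ℕ) * (4 / (C : ℝ))) ^ 9 := by push_cast; ring
          _ ≤ ((1 + 4 / (C : ℝ)) ^ 11) ^ 9 := by
            gcongr
            exact one_add_mul_le_pow (by have : 0 ≤ 4 / (C : ℝ) := by positivity
                                         linarith) 11
          _ = (1 + 4 / (C : ℝ)) ^ 99 := by rw [← pow_mul]
          _ ≤ (1 + 4 / (C : ℝ)) ^ m := by
            apply pow_le_pow_right₀ _ hm
            have : 0 ≤ 4 / (C : ℝ) := by positivity
            linarith
          _ ≤ 36 := h5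
      have h7 : (1 + 44 / 79 : ℝ) ^ 9 ≤ (1 + 44 / (C : ℝ)) ^ 9 := by gcongr
      have h8 : (36 : ℝ) < (1 + 44 / 79 : ℝ) ^ 9 := by norm_num
      linarith
  · have h1 : ((ν : ℝ) ^ 4) ^ m ≤ (2 * C : ℝ) ^ m := by
      rw [mul_pow]; nlinarith
    have := le_of_pow_le_pow_left₀ (by omega) (by positivity) h1
    exact_mod_cast this
  · have h1 : (C : ℝ) ^ m ≤ (2 * (ν : ℝ) ^ 4) ^ m := by
      rw [mul_pow]
      have : 0 < ((ν : ℝ) ^ 4) ^ m := by positivity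
      nlinarith
    have := le_of_pow_le_pow_left₀ (by omega) (by positivity) h1
    exact_mod_cast this

theorem H_xY {C : ℕ} (hC : 80 ≤ C) {x Y : ℝ} (hx : 0 ≤ x) (hY : 0 ≤ Y) (hx10 : x ^ 10 * (C : ℝ) ^ 9 ≤ 2 ^ 11)
    (hY4 : Y ^ 4 ≤ 8 * (C : ℝ) ^ 3) : x * Y ≤ 4 := by
  have hC' : (80 : ℝ) ≤ C := by exact_mod_cast hC
  have hCp : (0 : ℝ) < C := by linarith
  have h1 : (x * Y) ^ 20 ≤ 4 ^ 20 := by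
    refine le_of_mul_le_mul_right ?_ (by positivity : (0 : ℝ) < (C : ℝ) ^ 18)
    calc (x * Y) ^ 20 * (C : ℝ) ^ 18 = (x ^ 10 * (C : ℝ) ^ 9) ^ 2 * (Y ^ 4) ^ 5 := by ring
      _ ≤ (2 ^ 11) ^ 2 * (8 * (C : ℝ) ^ 3) ^ 5 := by gcongr
      _ = 2 ^ 37 * (C : ℝ) ^ 15 := by ring
      _ ≤ 4 ^ 20 * (C : ℝ) ^ 15 * 1 := by nlinarith [pow_pos hCp 15]
      _ ≤ 4 ^ 20 * (C : ℝ) ^ 15 * (C : ℝ) ^ 3 := by gcongr; exact one_le_pow₀ (by linarith)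
      _ = _ := by ring
  exact le_of_pow_le_pow_left₀ (by norm_num) (by norm_num) h1

theorem H_x20 {C : ℕ} (hC : 80 ≤ C) {x : ℝ} (hx : 0 ≤ x) (hx10 : x ^ 10 * (C : ℝ) ^ 9 ≤ 2 ^ 11) : 20 * x ≤ 1 := by
  have hC' : (80 : ℝ) ≤ C := by exact_mod_cast hC
  have h1 : (20 * x) ^ 10 ≤ 1 ^ 10 := by
    refine le_of_mul_le_mul_right ?_ (by positivity : (0 : ℝ) < (80 : ℝ) ^ 9)
    calc (20 * x) ^ 10 * (80 : ℝ) ^ 9 = 20 ^ 10 * (x ^ 10 * 80 ^ 9) := by ring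
      _ ≤ 20 ^ 10 * (x ^ 10 * (C : ℝ) ^ 9) := by gcongr
      _ ≤ 20 ^ 10 * 2 ^ 11 := by gcongr
      _ ≤ _ := by norm_num
  exact le_of_pow_le_pow_left₀ (by norm_num) (by norm_num) h1

end HArith


section HFin

set_option maxHeartbeats 4000000 in
theorem H_fin {C ν τ m N : ℕ} (hm : 99 ≤ m) (hC : 2 ≤ C) (hC2 : 2 ∣ C) (hν0 : ν ≠ 0) (hτ0 : τ ≠ 0) (hν2 : ν ^ 2 ∣ C) (hN : N ≤ 5)
    (vτ : 10 * padicValNat 2 τ = N * padicValNat 2 C) (vν : 2 * padicValNat 2 ν = (N % 2) * padicValNat 2 C)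
    {Λ B Xa Ua : ℝ} (hΛ : 0 < Λ) (hB : 0 ≤ B) (hΛC : Λ ^ 10 = (C : ℝ) ^ m) (hBC : B ^ 10 * (C : ℝ) ^ 9 ≤ 2 * (C : ℝ) ^ m)
    (hτ : 2 ^ N * Xa = (τ : ℝ) ^ m) (hν : 2 ^ (N % 2) * Ua = (ν : ℝ) ^ m)
    (hX1 : (Λ - 2 * B) ^ 5 ≤ 32 * Xa ^ 2) (hX2 : 32 * Xa ^ 2 ≤ (Λ + 2 * B) ^ 5)
    (hU1 : Λ ^ 5 ≤ 2 * Ua ^ 2) (hU2 : 2 * Ua ^ 2 ≤ Λ ^ 5 + 2 * B ^ 5) : False := by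
  have hC0 : C ≠ 0 := by omega
  have va : 1 ≤ padicValNat 2 C := one_le_padicValNat_of_dvd hC0 hC2
  have hCp : (2 : ℝ) ≤ C := by exact_mod_cast hC
  have hBΛ : B ≤ Λ := by
    have : B ^ 10 ≤ Λ ^ 10 := by
      rw [hΛC]
      refine le_of_mul_le_mul_right ?_ (by positivity : (0 : ℝ) < 2)
      calc B ^ 10 * 2 ≤ B ^ 10 * (C : ℝ) ^ 9 := by
            gcongr
            calc (2 : ℝ) ≤ 2 ^ 9 := by norm_num
              _ ≤ _ := by gcongr
        _ ≤ _ := by linarith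
    exact le_of_pow_le_pow_left₀ (by norm_num) hΛ.le this
  -- step one
  have hε : (N % 2 = 0 ∧ ¬ 2 ∣ ν) ∨ (N % 2 = 1 ∧ 2 ∣ ν) := by
    rcases Nat.mod_two_eq_zero_or_one N with h | h
    · left
      refine ⟨h, fun h2 => ?_⟩
      have := one_le_padicValNat_of_dvd hν0 h2
      rw [h] at vν; omega
    · right
      refine ⟨h, dvd_of_one_le_padicValNat ?_⟩
      rw [h] at vν; omega
  have hΛ5 : (Λ ^ 5) ^ 2 = (C : ℝ) ^ m := by rw [← hΛC]; ring
  obtain ⟨hC80, hνC, hCν⟩ := H_c80 (ε := N % 2) (Q := (2 * Ua ^ 2) ^ 2) hm hC hC2 hν0 hν2 hε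
    (by rw [← hΛ5]; gcongr)
    (by
      rw [← hΛ5]
      have : 2 * Ua ^ 2 ≤ 3 * Λ ^ 5 := by
        have : B ^ 5 ≤ Λ ^ 5 := by gcongr
        linarith
      calc (2 * Ua ^ 2) ^ 2 ≤ (3 * Λ ^ 5) ^ 2 := by gcongr
        _ = _ := by ring)
    (by
      have : ((ν : ℝ) ^ 4) ^ m = ((ν : ℝ) ^ m) ^ 4 := by rw [← pow_mul, ← pow_mul, mul_comm]
      rw [this, ← hν, mul_pow, ← pow_mul, mul_comm (N % 2) 4, pow_mul]; norm_num; ring)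
  have hC80' : (80 : ℝ) ≤ C := by exact_mod_cast hC80
  have hνC' : (ν : ℝ) ^ 4 ≤ 2 * C := by exact_mod_cast hνC
  have hCν' : (C : ℝ) ≤ 2 * (ν : ℝ) ^ 4 := by exact_mod_cast hCν
  have hνp : (0 : ℝ) < ν := by positivity
  have hν1 : (1 : ℝ) ≤ ν := by exact_mod_cast Nat.pos_of_ne_zero hν0
  -- the small quantity
  set x : ℝ := 2 * (B / Λ) with hx
  have hx0 : 0 ≤ x := by positivity
  have hBx : B = x * Λ / 2 := by rw [hx]; field_simp
  have hx10 : x ^ 10 * (C : ℝ) ^ 9 ≤ 2 ^ 11 := by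
    refine le_of_mul_le_mul_right ?_ (by positivity : (0 : ℝ) < Λ ^ 10)
    calc x ^ 10 * (C : ℝ) ^ 9 * Λ ^ 10 = 2 ^ 10 * (B ^ 10 * (C : ℝ) ^ 9) := by rw [hBx]; ring
      _ ≤ 2 ^ 10 * (2 * (C : ℝ) ^ m) := by gcongr
      _ = _ := by rw [hΛC]; ring
  have hx20 := H_x20 hC80 hx0 hx10
  have hx1 : x ≤ 1 := by linarith
  have hE : 0 < Λ ^ 5 := by positivity
  obtain ⟨S, hS⟩ : ∃ S, 32 * Xa ^ 2 = S * Λ ^ 5 := ⟨32 * Xa ^ 2 / Λ ^ 5, by field_simp⟩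
  obtain ⟨R, hR⟩ : ∃ R, 2 * Ua ^ 2 = R * Λ ^ 5 := ⟨2 * Ua ^ 2 / Λ ^ 5, by field_simp⟩
  have hS1 : (1 - x) ^ 5 ≤ S := by
    refine le_of_mul_le_mul_right ?_ hE
    rw [← hS]
    calc (1 - x) ^ 5 * Λ ^ 5 = (Λ - 2 * B) ^ 5 := by rw [hBx]; ring
      _ ≤ _ := hX1
  have hS2 : S ≤ (1 + x) ^ 5 := by
    refine le_of_mul_le_mul_right ?_ hE
    rw [← hS]
    calc _ ≤ _ := hX2
      _ = (1 + x) ^ 5 * Λ ^ 5 := by rw [hBx]; ring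
  have hR1 : 1 ≤ R := by
    refine le_of_mul_le_mul_right ?_ hE
    rw [← hR, one_mul]; exact hU1
  have hR2 : R ≤ 1 + x := by
    refine le_of_mul_le_mul_right ?_ hE
    rw [← hR]
    have h5 : x ^ 5 ≤ x := by
      calc x ^ 5 ≤ x ^ 1 := pow_le_pow_of_le_one hx0 hx1 (by norm_num)
        _ = x := pow_one x
    calc 2 * Ua ^ 2 ≤ Λ ^ 5 + 2 * B ^ 5 := hU2
      _ = Λ ^ 5 * (1 + x ^ 5 / 16) := by rw [hBx]; ring
      _ ≤ Λ ^ 5 * (1 + x) := by gcongr; linarith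
      _ = _ := by ring
  have hz0 : 0 ≤ 1 - x := by linarith
  have hz1 : 1 - x ≤ 1 := by linarith
  have hpz : (1 + x) * (1 - x) ≤ 1 := by nlinarith
  have hpz0 : 0 ≤ (1 + x) * (1 - x) := by positivity
  have hS0 : 0 ≤ S := by have := pow_nonneg hz0 5; linarith
  have hR0 : 0 ≤ R := by linarith
  have zpow : ∀ n : ℕ, ((1 + x) * (1 - x)) ^ n ≤ 1 := fun n => pow_le_one₀ hpz0 hpz
  have zpow' : ∀ n : ℕ, (1 - x) ^ n ≤ 1 := fun n => pow_le_one₀ hz0 hz1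
  have f1 : S * (1 - x) ^ 10 ≤ R ^ 5 := by
    calc S * (1 - x) ^ 10 ≤ (1 + x) ^ 5 * (1 - x) ^ 10 := by gcongr
      _ = ((1 + x) * (1 - x)) ^ 5 * (1 - x) ^ 5 := by ring
      _ ≤ 1 * 1 := by gcongr; exacts [zpow 5, zpow' 5]
      _ ≤ R ^ 5 := by rw [one_mul]; exact one_le_pow₀ hR1
  have f1' : R ^ 5 * (1 - x) ^ 10 ≤ S := by
    calc R ^ 5 * (1 - x) ^ 10 ≤ (1 + x) ^ 5 * (1 - x) ^ 10 := by gcongr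
      _ = ((1 + x) * (1 - x)) ^ 5 * (1 - x) ^ 5 := by ring
      _ ≤ 1 * (1 - x) ^ 5 := by gcongr; exact zpow 5
      _ ≤ S := by rw [one_mul]; exact hS1
  have f2 : S * (1 - x) ^ 10 ≤ R := by
    calc S * (1 - x) ^ 10 ≤ (1 + x) ^ 5 * (1 - x) ^ 10 := by gcongr
      _ = ((1 + x) * (1 - x)) ^ 5 * (1 - x) ^ 5 := by ring
      _ ≤ 1 * 1 := by gcongr; exacts [zpow 5, zpow' 5]
      _ ≤ R := by rw [one_mul]; exact hR1
  have f2' : R * (1 - x) ^ 10 ≤ S := by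
    calc R * (1 - x) ^ 10 ≤ R ^ 5 * (1 - x) ^ 10 := by
          gcongr
          exact le_self_pow₀ hR1 (by norm_num)
      _ ≤ S := f1'
  have f3 : S * R ^ 3 * (1 - x) ^ 10 ≤ 1 := by
    calc S * R ^ 3 * (1 - x) ^ 10 ≤ (1 + x) ^ 5 * (1 + x) ^ 3 * (1 - x) ^ 10 := by gcongr
      _ = ((1 + x) * (1 - x)) ^ 8 * (1 - x) ^ 2 := by ring
      _ ≤ 1 * 1 := by gcongr; exacts [zpow 8, zpow' 2]
      _ = 1 := one_mul 1
  have f3' : (1 - x) ^ 10 ≤ S * R ^ 3 := by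
    calc (1 - x) ^ 10 = (1 - x) ^ 5 * (1 - x) ^ 5 := by ring
      _ ≤ S * 1 := by gcongr; exact zpow' 5
      _ ≤ S * R ^ 3 := by gcongr; exact one_le_pow₀ hR1
  -- powers
  have pτ : ((τ : ℝ)) ^ (2 * m) = 4 ^ N * (S * Λ ^ 5 / 32) := by
    rw [← hS, mul_comm 2 m, pow_mul, ← hτ, mul_pow, ← pow_mul, mul_comm N 2, pow_mul]; norm_num
  have pν : ((ν : ℝ)) ^ (2 * m) = 4 ^ (N % 2) * (R * Λ ^ 5 / 2) := by
    rw [← hR, mul_comm 2 m, pow_mul, ← hν, mul_pow, ← pow_mul, mul_comm (N % 2) 2, pow_mul]; norm_num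
  have pC : ((C : ℝ)) ^ (2 * m) = (Λ ^ 5) ^ 4 := by
    rw [mul_comm 2 m, pow_mul, ← hΛ5]; ring
  have pν5 : ((ν : ℝ) ^ 5) ^ (2 * m) = (4 ^ (N % 2) * (R * Λ ^ 5 / 2)) ^ 5 := by
    rw [pow_right_comm, pν]
  have pν3 : ((ν : ℝ) ^ 3) ^ (2 * m) = (4 ^ (N % 2) * (R * Λ ^ 5 / 2)) ^ 3 := by
    rw [pow_right_comm, pν]
  have hY1 : ((ν : ℝ) ^ 3) ^ 4 ≤ 8 * (C : ℝ) ^ 3 := by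
    calc ((ν : ℝ) ^ 3) ^ 4 = ((ν : ℝ) ^ 4) ^ 3 := by ring
      _ ≤ (2 * (C : ℝ)) ^ 3 := by gcongr
      _ = _ := by ring
  have hm' : (99 : ℝ) ≤ m := by exact_mod_cast hm
  have big : ∀ (Q N' : ℕ) (Y : ℝ), 0 ≤ Y → 0 < N' → (Q : ℝ) = Y * N' → Y ^ 4 ≤ 8 * (C : ℝ) ^ 3 →
      2 * (10 : ℕ) * x * Q < (2 * m : ℕ) * N' := by
    intro Q N' Y hY hN' hQ hY4
    have h1 := H_xY hC80 hx0 hY hx10 hY4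
    have hN'' : (0 : ℝ) < N' := by exact_mod_cast hN'
    rw [hQ]; push_cast
    calc 2 * 10 * x * (Y * N') = 20 * (x * Y) * N' := by ring
      _ ≤ 20 * 4 * N' := by gcongr
      _ < 2 * m * N' := mul_lt_mul_of_pos_right (by linarith) hN''
  have hν2p : 0 < ν ^ 2 := by positivity
  -- first type
  have t1 : (N = 0 ∨ N = 5) → τ * C = ν ^ 5 := by
    intro hN'
    refine PQ_eq (N := ν ^ 2) (m := 2 * m) (n := 10) (x := x) (by positivity) (by positivity) (hν2.mul_left _)
      (pow_dvd_pow ν (by norm_num)) hx0 hx1 (by push_cast; linarith) ?_ ?_ ?_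
    · refine big _ _ ((ν : ℝ) ^ 3) (by positivity) hν2p (by push_cast; ring) hY1
    all_goals
      push_cast
      rw [mul_pow, pτ, pC, pν5]
    · rcases hN' with rfl | rfl
      · norm_num
        calc _ = (S * (1 - x) ^ 10) * ((Λ ^ 5) ^ 5 / 32) := by ring
          _ ≤ R ^ 5 * ((Λ ^ 5) ^ 5 / 32) := by gcongr
          _ = _ := by ring
      · norm_num
        calc _ = (S * (1 - x) ^ 10) * (32 * (Λ ^ 5) ^ 5) := by ring
          _ ≤ R ^ 5 * (32 * (Λ ^ 5) ^ 5) := by gcongr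
          _ = _ := by ring
    · rcases hN' with rfl | rfl
      · norm_num
        calc _ = (R ^ 5 * (1 - x) ^ 10) * ((Λ ^ 5) ^ 5 / 32) := by ring
          _ ≤ S * ((Λ ^ 5) ^ 5 / 32) := by gcongr
          _ = _ := by ring
      · norm_num
        calc _ = (R ^ 5 * (1 - x) ^ 10) * (32 * (Λ ^ 5) ^ 5) := by ring
          _ ≤ S * (32 * (Λ ^ 5) ^ 5) := by gcongr
          _ = _ := by ring
  -- second type
  have t2 : (N = 2 ∨ N = 3) → τ = ν := by
    intro hN'
    refine PQ_eq (N := 1) (m := 2 * m) (n := 10) (x := x) (by positivity) (by positivity) (one_dvd _)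
      (one_dvd _) hx0 hx1 (by push_cast; linarith) ?_ ?_ ?_
    · refine big _ _ ν (by positivity) one_pos (by push_cast; ring) ?_
      calc (ν : ℝ) ^ 4 ≤ 2 * C := hνC'
        _ ≤ 8 * (C : ℝ) ^ 3 := by
          have : (C : ℝ) ≤ (C : ℝ) ^ 3 := le_self_pow₀ (by linarith) (by norm_num)
          linarith
    all_goals rw [pτ, pν]
    · rcases hN' with rfl | rfl
      · norm_num
        calc _ = (S * (1 - x) ^ 10) * (Λ ^ 5 / 2) := by ring
          _ ≤ R * (Λ ^ 5 / 2) := by gcongr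
          _ = _ := by ring
      · norm_num
        calc _ = (S * (1 - x) ^ 10) * (2 * Λ ^ 5) := by ring
          _ ≤ R * (2 * Λ ^ 5) := by gcongr
          _ = _ := by ring
    · rcases hN' with rfl | rfl
      · norm_num
        calc _ = (R * (1 - x) ^ 10) * (Λ ^ 5 / 2) := by ring
          _ ≤ S * (Λ ^ 5 / 2) := by gcongr
          _ = _ := by ring
      · norm_num
        calc _ = (R * (1 - x) ^ 10) * (2 * Λ ^ 5) := by ring
          _ ≤ S * (2 * Λ ^ 5) := by gcongr
          _ = _ := by ring
  -- third type
  have t3 : (N = 1 ∨ N = 4) → τ * ν ^ 3 = C := by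
    intro hN'
    refine PQ_eq (N := ν ^ 2) (m := 2 * m) (n := 10) (x := x) (by positivity) (by positivity)
      ((pow_dvd_pow ν (by norm_num)).mul_left _) hν2 hx0 hx1 (by push_cast; linarith) ?_ ?_ ?_
    · refine big _ _ ((C : ℝ) / (ν : ℝ) ^ 2) (by positivity) hν2p (by push_cast; field_simp) ?_
      rw [div_pow, div_le_iff₀ (by positivity)]
      have h1 : (C : ℝ) ^ 1 ≤ 2 * (ν : ℝ) ^ 4 := by rw [pow_one]; exact hCν'
      have h2 : (1 : ℝ) ≤ (ν : ℝ) ^ 4 := one_le_pow₀ hν1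
      calc (C : ℝ) ^ 4 = (C : ℝ) ^ 3 * C := by ring
        _ ≤ (C : ℝ) ^ 3 * (2 * (ν : ℝ) ^ 4) := by gcongr
        _ ≤ (C : ℝ) ^ 3 * (8 * ((ν : ℝ) ^ 4 * (ν : ℝ) ^ 4)) :=
          mul_le_mul_of_nonneg_left (by nlinarith) (by positivity)
        _ = _ := by ring
    all_goals
      push_cast
      rw [mul_pow, pτ, pC, pν3]
    · rcases hN' with rfl | rfl
      · norm_num
        calc _ = (S * R ^ 3 * (1 - x) ^ 10) * ((Λ ^ 5) ^ 4) := by ring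
          _ ≤ 1 * ((Λ ^ 5) ^ 4) := by gcongr
          _ = _ := by ring
      · norm_num
        calc _ = (S * R ^ 3 * (1 - x) ^ 10) * ((Λ ^ 5) ^ 4) := by ring
          _ ≤ 1 * ((Λ ^ 5) ^ 4) := by gcongr
          _ = _ := by ring
    · rcases hN' with rfl | rfl
      · norm_num
        calc _ = (1 - x) ^ 10 * ((Λ ^ 5) ^ 4) := by ring
          _ ≤ (S * R ^ 3) * ((Λ ^ 5) ^ 4) := by gcongr
          _ = _ := by ring
      · norm_num
        calc _ = (1 - x) ^ 10 * ((Λ ^ 5) ^ 4) := by ring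
          _ ≤ (S * R ^ 3) * ((Λ ^ 5) ^ 4) := by gcongr
          _ = _ := by ring
  have v1 : τ * C = ν ^ 5 → padicValNat 2 τ + padicValNat 2 C = 5 * padicValNat 2 ν := by
    intro h
    have := congrArg (padicValNat 2) h
    rwa [padicValNat.mul hτ0 hC0, padicValNat.pow] at this
  have v3 : τ * ν ^ 3 = C → padicValNat 2 τ + 3 * padicValNat 2 ν = padicValNat 2 C := by
    intro h
    have := congrArg (padicValNat 2) h
    rwa [padicValNat.mul hτ0 (pow_ne_zero _ hν0), padicValNat.pow] at this
  interval_cases N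
  · have := v1 (t1 (Or.inl rfl)); omega
  · have := v3 (t3 (Or.inl rfl)); omega
  · have := t2 (Or.inl rfl); subst this; omega
  · have := t2 (Or.inr rfl); subst this; omega
  · have := v3 (t3 (Or.inr rfl)); omega
  · have := v1 (t1 (Or.inr rfl)); omega

end HFin


section HMain

theorem aS_pos_of_pos (d : ℕ) {c : ℤ} (hc : 0 < c) (k : ℕ) : 0 < aS d c k := by
  induction k with
  | zero => simp [aS]
  | succ k ih => rw [aS]; positivity

theorem H_main {d k : ℕ} {c : ℤ} (hd0 : d ≠ 0) (hd10 : 10 ∣ d) (hk : 1 ≤ k) (hc0 : c ≠ 0)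
    (h2 : KeyP d c k 2 2) (h10 : KeyP d c k 2 10) : False := by
  obtain ⟨e, rfl⟩ := hd10
  have he : 1 ≤ e := by omega
  have hdE : Even (10 * e) := ⟨5 * e, by ring⟩
  have hmo := m_odd hdE hd0 k
  have hpow : 100 ≤ (10 * e) ^ (k + 1) := by
    calc 100 = 10 ^ 2 := by norm_num
      _ ≤ (10 * e) ^ 2 := by gcongr; omega
      _ ≤ _ := Nat.pow_le_pow_right (by omega) (by omega)
  have hdvd : 10 ∣ (10 * e) ^ (k + 1) := (Dvd.intro _ rfl).trans (dvd_pow_self _ (by omega))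
  have hm1 : (10 * e) ^ (k + 1) = ((10 * e) ^ (k + 1) - 1) + 1 := by omega
  have hbound : ∀ (_ : 2 ≤ |c|), |aS (10 * e) c k| ^ (10 * e) * |c| ^ 9 ≤ 2 * |c| ^ ((10 * e) ^ (k + 1) - 1) := by
    intro hc2
    have h := aS_bound (d := 10 * e) (by omega) hc2 k
    have hcp : 0 < |c| := by omega
    refine le_of_mul_le_mul_right ?_ hcp
    calc |aS (10 * e) c k| ^ (10 * e) * |c| ^ 9 * |c| = |aS (10 * e) c k| ^ (10 * e) * |c| ^ 10 := by ring
      _ ≤ |aS (10 * e) c k| ^ (10 * e) * |c| ^ (10 * e) :=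
        mul_le_mul_of_nonneg_left (pow_le_pow_right₀ (by omega) (by omega)) (by positivity)
      _ ≤ 2 * |c| ^ ((10 * e) ^ (k + 1)) := h
      _ = _ := by rw [hm1, Nat.add_sub_cancel, pow_succ]; ring
  obtain ⟨u, v, h1, h1'⟩ := conc_two_two h2
  obtain ⟨x, hx⟩ := conc_even' (j := 5) h10
  have hq5 : 10 * e / 2 = e * 5 := by omega
  have hq1 : 10 * e / (2 * 5) = e := by omega
  rw [hq5, pow_mul] at h1
  rw [hq1] at hx
  have hcop : IsCoprime (aS (10 * e) c k ^ e) c := (aS_cop (by omega) c k).pow_left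
  have hb : |aS (10 * e) c k| ^ (10 * e) = |aS (10 * e) c k ^ e| ^ 10 := by
    rw [abs_pow, ← pow_mul, mul_comm]
  rw [hb] at hbound
  have hpos : 0 < c → 0 < aS (10 * e) c k ^ e := fun h => pow_pos (aS_pos_of_pos _ h k) e
  have hx' : X ^ 5 + C ((c : ℚ) ^ ((10 * e) ^ (k + 1) - 1)) ∣
      (2 * x ^ 2 - C (((aS (10 * e) c k ^ e : ℤ) : ℚ))) ^ 2 - C ((aS (10 * e) c k ^ e : ℤ) : ℚ) ^ 2 + X := by
    push_cast; exact hx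
  have h1'' : u ^ 2 - (c : ℚ) ^ ((10 * e) ^ (k + 1) - 1) * v ^ 2 = (((aS (10 * e) c k ^ e) ^ 5 : ℤ) : ℚ) := by
    push_cast; exact h1
  have hm10 : ((10 * e) ^ (k + 1) - 1).Coprime 10 := by
    obtain ⟨q, hq⟩ := hdvd
    have : (10 * e) ^ (k + 1) - 1 = 10 * (q - 1) + 9 := by omega
    rw [this]
    simp [Nat.coprime_mul_right_add_left, Nat.Coprime]
  have hm99 : 99 ≤ (10 * e) ^ (k + 1) - 1 := by omega
  generalize aS (10 * e) c k ^ e = β at *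
  generalize (10 * e) ^ (k + 1) - 1 = m at *
  clear h1 hx hb hm1 hdvd hpow h2 h10
  obtain ⟨U, rfl, hU, hUA, h2c, hA⟩ := p2_setup (by omega) hcop.pow_left h1'' h1'
  have hc2 : 2 ≤ |c| := by
    obtain ⟨w, rfl⟩ := h2c
    rcases abs_cases (2 * w) with h | h <;> omega
  have hbd := hbound hc2
  rcases lt_or_gt_of_ne hc0 with hneg | hcp
  · have hcm : |c| ^ m = - c ^ m := by
      rw [← abs_pow, abs_of_neg (hmo.pow_neg hneg)]
    have e1 : |c| ^ m ≤ |β| ^ 10 := by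
      have : |β| ^ 10 = (β ^ 5) ^ 2 := by
        rw [Even.pow_abs (by decide)]; ring
      rw [hcm, this, ← hU]
      nlinarith [sq_nonneg (β ^ 5 - 2 * U ^ 2)]
    have hp : 0 < |c| ^ m := by positivity
    have : 2 ^ 9 ≤ |c| ^ 9 := by gcongr
    nlinarith
  have hβ := hpos hcp
  rw [abs_of_pos hβ, abs_of_pos hcp] at hbd
  have hcR : (0 : ℝ) < c := by exact_mod_cast hcp
  obtain ⟨Λ, hΛ, hΛc⟩ : ∃ Λ : ℝ, 0 < Λ ∧ Λ ^ 10 = (c : ℝ) ^ m :=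
    ⟨((c : ℝ) ^ m) ^ (((10 : ℕ) : ℝ)⁻¹), by positivity, Real.rpow_inv_natCast_pow (by positivity) (by norm_num)⟩
  have hbdR : (β : ℝ) ^ 10 * (c : ℝ) ^ 9 ≤ 2 * (c : ℝ) ^ m := by exact_mod_cast hbd
  have hβR : (0 : ℝ) < β := by exact_mod_cast hβ
  have hc2R : (2 : ℝ) ≤ c := by
    rw [abs_of_pos hcp] at hc2
    exact_mod_cast hc2
  have hβΛ : (β : ℝ) < Λ := by
    refine lt_of_pow_lt_pow_left₀ 10 hΛ.le ?_
    rw [hΛc]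
    have h3 : (2 : ℝ) ^ 9 ≤ (c : ℝ) ^ 9 := by gcongr
    have h4 : (0 : ℝ) < (β : ℝ) ^ 10 := by positivity
    nlinarith
  obtain ⟨Xn, hXn⟩ := norm_ex ((c : ℚ) ^ m) x
  obtain ⟨y5, hy5⟩ := norm_ex ((c : ℚ) ^ m) (2 * x ^ 2 - C (β : ℚ))
  obtain ⟨N, hN5, τ, hτ0, hτ, vτ, hyN⟩ := H_vals (by omega) hm10 hc0 h2c hcop hx' hXn hy5
  obtain ⟨a1, a2, hy0, hyy⟩ := H_arch hβ hx' hXn hy5 hΛ hΛc hβΛ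
  obtain ⟨ν, hν0, hν, hνd, vν⟩ := H_nu hmo hcp hA hU hUA hy0 hyy hyN
  have hcn : ((c.natAbs : ℕ) : ℝ) = (c : ℝ) := by
    rw [Nat.cast_natAbs, abs_of_pos hcp]
  have hUR : 4 * (U : ℝ) ^ 2 * ((U : ℝ) ^ 2 - (β : ℝ) ^ 5) = (Λ ^ 5) ^ 2 := by
    have : (Λ ^ 5) ^ 2 = (c : ℝ) ^ m := by rw [← hΛc]; ring
    rw [this]; exact_mod_cast hU
  have hUpos : (0 : ℝ) < (U : ℝ) ^ 2 - (β : ℝ) ^ 5 := by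
    have h3 : 0 < (Λ ^ 5) ^ 2 := by positivity
    by_contra h4
    push Not at h4
    nlinarith [mul_nonneg (sq_nonneg (U : ℝ)) (neg_nonneg.mpr h4)]
  have hL5 : 0 < Λ ^ 5 := by positivity
  have hb5 : 0 < (β : ℝ) ^ 5 := by positivity
  refine H_fin (C := c.natAbs) (ν := ν) (τ := τ) (m := m) (N := N) (Λ := Λ) (B := β) (Xa := |(Xn : ℝ)|) (Ua := |(U : ℝ)|)
    hm99 (by omega) (by omega) hν0 hτ0 hνd hN5 vτ vν hΛ hβR.le (by rw [hcn]; exact hΛc) (by rw [hcn]; exact hbdR)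
    ?_ ?_ (by rw [sq_abs]; exact a1) (by rw [sq_abs]; exact a2) ?_ ?_
  · have := congrArg (Rat.cast : ℚ → ℝ) hτ
    push_cast at this
    exact this
  · have := congrArg (Int.cast : ℤ → ℝ) hν
    push_cast at this
    exact this
  · rw [sq_abs]
    refine le_of_pow_le_pow_left₀ (n := 2) (by norm_num) (by positivity) ?_
    rw [← hUR]; nlinarith [mul_nonneg (sq_nonneg (U : ℝ)) hb5.le]
  · rw [sq_abs]
    have h5 : 2 * (U : ℝ) ^ 2 - (β : ℝ) ^ 5 ≤ Λ ^ 5 + (β : ℝ) ^ 5 := by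
      refine le_of_pow_le_pow_left₀ (n := 2) (by norm_num) (by positivity) ?_
      have : (2 * (U : ℝ) ^ 2 - (β : ℝ) ^ 5) ^ 2 = (Λ ^ 5) ^ 2 + ((β : ℝ) ^ 5) ^ 2 := by rw [← hUR]; ring
      rw [this]
      nlinarith [mul_pos hL5 hb5]
    linarith

end HMain

theorem stmt4_aux (r s t : ℕ) (hr : 1 ≤ r) (d : ℕ) (hd : d = 2 ^ r * 5 ^ s * 7 ^ t)
    (hmod : d % 3 = 1) (c : ℤ) (hc : c ≠ 0) (hirr : Irreducible (fP d c)) :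
    ∀ n : ℕ, 1 ≤ n → Irreducible (itP (fP d c) n) := by
  have hd0 : d ≠ 0 := by rintro rfl; simp at hmod
  have h2d : 2 ∣ d := by rw [hd, mul_assoc]; exact (dvd_pow_self 2 (by omega)).mul_right _
  have hdE : Even d := even_iff_two_dvd.mpr h2d
  have hd2 : 2 ≤ d := Nat.le_of_dvd (by omega) h2d
  have hodd : Odd (5 ^ s * 7 ^ t) := (Odd.pow (by decide)).mul (Odd.pow (by decide))
  have hd' : d = 2 ^ r * (5 ^ s * 7 ^ t) := by rw [hd, mul_assoc]
  have hc1 : c ≠ -1 := by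
    rintro rfl
    have hroot : (fP d (-1)).IsRoot 1 := by simp [fP]
    have h1 := Polynomial.degree_eq_one_of_irreducible_of_root hirr hroot
    have h3 : (fP d (-1)).natDegree = d := by unfold fP; exact natDegree_X_pow_add_C
    have := natDegree_eq_of_degree_eq_some h1
    rw [h3] at this
    norm_num at this
    omega
  refine reduction r (5 ^ s * 7 ^ t) hodd hr d hd' hc hirr ?_ ?_
  · intro k k2 k4 k10
    by_cases hk : k = 0
    · subst hk; exact p2_zero hd2 hmod hc k2
    have hk1 : 1 ≤ k := by omega
    by_cases h4 : 4 ∣ d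
    · exact p2_succ hd2 hmod k hc h4 (k4 h4 hk1)
    have hr1 : r = 1 := by
      by_contra hne
      apply h4
      rw [hd']
      exact (pow_dvd_pow 2 (by omega : 2 ≤ r)).mul_right _
    have hs : s ≠ 0 := by
      rintro rfl
      subst hr1
      have : 7 ^ t % 3 = 1 := by rw [Nat.pow_mod]; norm_num
      rw [hd] at hmod
      omega
    have h10 : 10 ∣ d := by
      rw [hd]
      exact ((mul_dvd_mul (dvd_pow_self 2 (by omega)) (dvd_pow_self 5 hs)) : 2 * 5 ∣ 2 ^ r * 5 ^ s).mul_right _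
    exact H_main hd0 h10 hk1 hc k2 (k10 h4 h10)
  · intro k p hp hpe hK
    have hpd : p ∣ d := by rw [hd']; exact hpe.mul_left _
    have hp57 : p = 5 ∨ p = 7 := by
      rcases hp.dvd_mul.mp hpe with h | h
      · left; exact (Nat.prime_dvd_prime_iff_eq hp (by norm_num)).mp (hp.dvd_of_dvd_pow h)
      · right; exact (Nat.prime_dvd_prime_iff_eq hp (by norm_num)).mp (hp.dvd_of_dvd_pow h)
    have hcase : 4 * p ≤ d ∨ (p = 5 ∧ d = 10) := by
      obtain ⟨a, ha⟩ := hpd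
      rcases hp57 with rfl | rfl <;> omega
    by_cases hpc : (p : ℤ) ∣ c
    · rcases hcase with h | ⟨rfl, rfl⟩
      · exact F_main hp57 h hdE hpd hc hpc (hK 1 (one_dvd _)) (hK 2 h2d)
      · exact ten_five hc (by exact_mod_cast hpc) (hK 2 h2d)
    · refine E_main hp ?_ ?_ hdE hpd hc hc1 hpc (hK 1 (one_dvd _))
      · rcases hp57 with rfl | rfl <;> decide
      · rcases hp57 with rfl | rfl <;> omega

/-- If `d = 2^r · 5^s · 7^t` with `r ≥ 1`, `s, t ≥ 0`, `d ≡ 1 (mod 3)`,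
`c` a nonzero integer, and `f(z) = z^d + 1/c` is irreducible over `ℚ`,
then every iterate `fⁿ` (`n ≥ 1`) is irreducible over `ℚ`. -/
theorem stmt4 (r s t : ℕ) (hr : 1 ≤ r) (d : ℕ) (hd : d = 2 ^ r * 5 ^ s * 7 ^ t)
    (hmod : d % 3 = 1) (c : ℤ) (hc : c ≠ 0)
    (f : ℚ[X]) (hf : f = X ^ d + C (1 / (c : ℚ))) (hirr : Irreducible f) :
    ∀ n : ℕ, 1 ≤ n → Irreducible ((f.comp ·)^[n] X) := by
  subst hf
  exact stmt4_aux r s t hr d hd hmod c hc hirr
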